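/- arXiv:1704.03771 — 2 statements merged into one kernel-verified Lean document; each statement's English description precedes it below -/
import Mathlib

section
/- Let a Beurling generalized number system be given. Suppose there are distinct real numbers t_1, …, t_k > 0 and real numbers y_1, …, y_k and b_1, …, b_k such that ∫_2^∞ |Π(x) − (x/log x)(1 + Σ_{j=1}^k b_j cos(t_j log x + y_j))| x^{−2} dx < ∞ and (1 + t_j²)^{1/2} |b_j cos(y_j + arctan t_j)| < 2 for each j = 1, …, k. Then m(x) → 0 as x → ∞. -/
open Filter MeasureTheory Set Topology
open scoped Classical

/-- Value `n(α) = ∏ p_k^{α(k)}` of a generalized integer `α`. -/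
noncomputable def nval (p : ℕ → ℝ) (α : ℕ →₀ ℕ) : ℝ := α.prod fun k e => p k ^ e

/-- Counting function `N(x)` of the generalized integers. -/
noncomputable def Ncount (p : ℕ → ℝ) (x : ℝ) : ℕ := Nat.card {α : ℕ →₀ ℕ // nval p α ≤ x}

/-- Riemann prime counting function `Π(x) = Σ_{j ≥ 1} π(x^{1/j})/j`. -/
noncomputable def PiCount (p : ℕ → ℝ) (x : ℝ) : ℝ :=
  ∑' j : ℕ, (Nat.card {k : ℕ // p k ≤ x ^ ((1 : ℝ) / (j + 1))} : ℝ) / (j + 1)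

/-- `log ζ(s) = ∫_1^∞ x^{-s} dΠ(x)`, the Lebesgue–Stieltjes integral against the purely
atomic measure `dΠ`, which carries mass `1/j` at each point `p_k^j`. -/
noncomputable def logZeta (p : ℕ → ℝ) (s : ℂ) : ℂ :=
  ∑' (j : ℕ) (k : ℕ), ((p k : ℂ) ^ (-s * (j + 1))) / (j + 1)

/-- The Beurling zeta function `ζ(s) = exp(∫_1^∞ x^{-s} dΠ(x))`. -/
noncomputable def zetaB (p : ℕ → ℝ) (s : ℂ) : ℂ := Complex.exp (logZeta p s)

/-- Beurling Möbius function. -/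
noncomputable def muB (α : ℕ →₀ ℕ) : ℝ :=
  if ∀ k, α k ≤ 1 then (-1 : ℝ) ^ α.support.card else 0

/-- `m(x) = Σ_{n(α) ≤ x} μ(α)/n(α)`. -/
noncomputable def mB (p : ℕ → ℝ) (x : ℝ) : ℝ :=
  ∑' α : {α : ℕ →₀ ℕ // nval p α ≤ x}, muB α / nval p α

/-- Beurling Liouville function. -/
noncomputable def lambdaB (α : ℕ →₀ ℕ) : ℝ := (-1 : ℝ) ^ (α.sum fun _ e => e)

/-- `ℓ(x) = Σ_{n(α) ≤ x} λ(α)/n(α)`. -/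
noncomputable def ellB (p : ℕ → ℝ) (x : ℝ) : ℝ :=
  ∑' α : {α : ℕ →₀ ℕ // nval p α ≤ x}, lambdaB α / nval p α

/-- An analytic function `G` on `{Re s > 1}` has `A_loc`-boundary behavior on `1 + iU`:
for every compact `K ⊂ U` there is `g ∈ L¹(ℝ)` with `G(σ + it) → ∫ g(x) e^{-itx} dx`
as `σ → 1⁺`, uniformly for `t ∈ K`. -/
def ALocBoundary (G : ℂ → ℂ) (U : Set ℝ) : Prop :=
  ∀ K : Set ℝ, K ⊆ U → IsCompact K → ∃ g : ℝ → ℂ, Integrable g ∧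
    TendstoUniformlyOn (fun σ : ℝ => fun t : ℝ => G (σ + t * Complex.I))
      (fun t : ℝ => ∫ x : ℝ, g x * Complex.exp (-(t * x) * Complex.I)) (𝓝[>] 1) K

/-- An analytic function `G` on `{Re s > 1}` has local pseudofunction boundary behavior on
`1 + iU`: for every smooth compactly supported `φ` with `supp φ ⊂ U` and every `x`, the limit
`g_φ(x) = lim_{σ→1⁺} ∫ G(σ + it) φ(t) e^{-ixt} dt` exists, and `g_φ(x) → 0` as `|x| → ∞`. -/
def LocalPseudofunctionBoundary (G : ℂ → ℂ) (U : Set ℝ) : Prop :=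
  ∀ φ : ℝ → ℂ, ContDiff ℝ (⊤ : ℕ∞) φ → HasCompactSupport φ → tsupport φ ⊆ U →
    ∃ gφ : ℝ → ℂ,
      (∀ x : ℝ, Tendsto (fun σ : ℝ => ∫ t : ℝ, G (σ + t * Complex.I) * φ t *
          Complex.exp (-(x * t) * Complex.I)) (𝓝[>] 1) (𝓝 (gφ x))) ∧
      Tendsto gφ (cocompact ℝ) (𝓝 0)

/-- `Π₀(x) = ∫_1^x (1 - 1/u)/log u du`. -/
noncomputable def Pi0 (x : ℝ) : ℝ := ∫ u in (1:ℝ)..x, (1 - 1/u) / Real.log u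


/-! ### Part A: Fourier integrals and local multipliers -/

/-- `e^{ix}`. -/
noncomputable def cis (x : ℝ) : ℂ := Complex.exp ((x : ℂ) * Complex.I)

lemma norm_cis (x : ℝ) : ‖cis x‖ = 1 := Complex.norm_exp_ofReal_mul_I x

lemma cis_add (x y : ℝ) : cis (x + y) = cis x * cis y := by
  simp only [cis]; rw [← Complex.exp_add]; push_cast; ring_nf

lemma cis_zero : cis 0 = 1 := by simp [cis]

@[fun_prop]
lemma continuous_cis : Continuous cis := by
  unfold cis; fun_prop

@[fun_prop]
lemma measurable_cis : Measurable cis := continuous_cis.measurable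

/-- The Fourier integral `∫ f(t) e^{iut} dt`. -/
noncomputable def FI (f : ℝ → ℂ) (u : ℝ) : ℂ := ∫ t, f t * cis (u * t)

lemma integrable_mul_cis {f : ℝ → ℂ} (hf : Integrable f) (u : ℝ) :
    Integrable (fun t => f t * cis (u * t)) := by
  refine hf.mul_bdd (c := 1) (by fun_prop) ?_
  exact Eventually.of_forall fun t => (norm_cis _).le

lemma norm_FI_le {f : ℝ → ℂ} (u : ℝ) : ‖FI f u‖ ≤ ∫ t, ‖f t‖ := by
  refine (norm_integral_le_integral_norm _).trans (le_of_eq ?_)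
  congr 1; ext t; rw [norm_mul, norm_cis, mul_one]

/-- `F` acts as a multiplier with norm at most `C` on functions supported in `[-δ, δ]`. -/
def Mult (δ C : ℝ) (F : ℝ → ℂ) : Prop :=
  Continuous F ∧ 0 ≤ C ∧ ∀ f : ℝ → ℂ, Integrable f → (∀ t, δ < |t| → f t = 0) →
    ∀ B, (∀ u, ‖FI f u‖ ≤ B) → ∀ u, ‖FI (fun t => F t * f t) u‖ ≤ C * B

lemma bdd_of_cont {F : ℝ → ℂ} (hF : Continuous F) (δ : ℝ) :
    ∃ R, 0 ≤ R ∧ ∀ t, |t| ≤ δ → ‖F t‖ ≤ R := by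
  obtain ⟨R, hR⟩ := (isCompact_Icc (a := -δ) (b := δ)).exists_bound_of_continuousOn hF.continuousOn
  refine ⟨max R 0, le_max_right _ _, fun t ht => (hR t ?_).trans (le_max_left _ _)⟩
  exact abs_le.mp ht

lemma integrable_cont_mul {F f : ℝ → ℂ} {δ : ℝ} (hF : Continuous F) (hf : Integrable f)
    (hs : ∀ t, δ < |t| → f t = 0) : Integrable (fun t => F t * f t) := by
  obtain ⟨R, hR0, hR⟩ := bdd_of_cont hF δ
  refine (hf.norm.const_mul R).mono' (hF.aestronglyMeasurable.mul hf.1) ?_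
  refine Eventually.of_forall fun t => ?_
  rw [norm_mul]
  by_cases h : |t| ≤ δ
  · exact mul_le_mul_of_nonneg_right (hR t h) (norm_nonneg _)
  · rw [hs t (not_le.mp h)]; simp

namespace Mult

lemma mono {δ C C' : ℝ} {F : ℝ → ℂ} (h : Mult δ C F) (hC : C ≤ C') : Mult δ C' F := by
  refine ⟨h.1, h.2.1.trans hC, fun f hf hs B hB u => (h.2.2 f hf hs B hB u).trans ?_⟩
  have : 0 ≤ B := (norm_nonneg _).trans (hB 0)
  exact mul_le_mul_of_nonneg_right hC this

lemma mul {δ C D : ℝ} {F G : ℝ → ℂ} (hF : Mult δ C F) (hG : Mult δ D G) :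
    Mult δ (C * D) (fun t => F t * G t) := by
  refine ⟨hF.1.mul hG.1, mul_nonneg hF.2.1 hG.2.1, fun f hf hs B hB u => ?_⟩
  have h1 := hG.2.2 f hf hs B hB
  have h2 := hF.2.2 _ (integrable_cont_mul hG.1 hf hs) (fun t ht => by simp [hs t ht]) _ h1 u
  simpa [mul_assoc] using h2

lemma add {δ C D : ℝ} {F G : ℝ → ℂ} (hF : Mult δ C F) (hG : Mult δ D G) :
    Mult δ (C + D) (fun t => F t + G t) := by
  refine ⟨hF.1.add hG.1, add_nonneg hF.2.1 hG.2.1, fun f hf hs B hB u => ?_⟩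
  have h1 := hF.2.2 f hf hs B hB u
  have h2 := hG.2.2 f hf hs B hB u
  have : FI (fun t => (F t + G t) * f t) u
      = FI (fun t => F t * f t) u + FI (fun t => G t * f t) u := by
    unfold FI
    rw [← integral_add (integrable_mul_cis (integrable_cont_mul hF.1 hf hs) u)
      (integrable_mul_cis (integrable_cont_mul hG.1 hf hs) u)]
    congr 1; ext t; ring
  rw [this, add_mul]
  exact (norm_add_le _ _).trans (add_le_add h1 h2)

lemma const (δ : ℝ) (c : ℂ) : Mult δ ‖c‖ (fun _ => c) := by
  refine ⟨continuous_const, norm_nonneg _, fun f hf hs B hB u => ?_⟩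
  have : FI (fun t => c * f t) u = c * FI f u := by
    unfold FI
    rw [← integral_const_mul]
    congr 1; ext t; ring
  rw [this, norm_mul]
  exact mul_le_mul_of_nonneg_left (hB u) (norm_nonneg _)

lemma const_mul {δ C : ℝ} {F : ℝ → ℂ} (c : ℂ) (hF : Mult δ C F) :
    Mult δ (‖c‖ * C) (fun t => c * F t) := (Mult.const δ c).mul hF

lemma sum {ι : Type*} {δ : ℝ} (s : Finset ι) {C : ι → ℝ} {F : ι → ℝ → ℂ}
    (h : ∀ i ∈ s, Mult δ (C i) (F i)) : Mult δ (∑ i ∈ s, C i) (fun t => ∑ i ∈ s, F i t) := by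
  induction s using Finset.induction_on with
  | empty => simpa using Mult.const δ 0
  | insert a s ha ih =>
    simp only [Finset.sum_insert ha]
    exact (h a (Finset.mem_insert_self _ _)).add
      (ih fun i hi => h i (Finset.mem_insert_of_mem hi))

lemma prod {ι : Type*} {δ : ℝ} (s : Finset ι) {C : ι → ℝ} {F : ι → ℝ → ℂ}
    (h : ∀ i ∈ s, Mult δ (C i) (F i)) : Mult δ (∏ i ∈ s, C i) (fun t => ∏ i ∈ s, F i t) := by
  induction s using Finset.induction_on with
  | empty => simpa using Mult.const δ 1
  | insert a s ha ih =>
    simp only [Finset.prod_insert ha]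
    exact (h a (Finset.mem_insert_self _ _)).mul
      (ih fun i hi => h i (Finset.mem_insert_of_mem hi))

lemma pow {δ C : ℝ} {F : ℝ → ℂ} (hF : Mult δ C F) (n : ℕ) :
    Mult δ (C ^ n) (fun t => F t ^ n) := by
  simpa using Mult.prod (Finset.range n) (C := fun _ => C) (F := fun _ => F) (fun _ _ => hF)

lemma lim {δ C R : ℝ} {G : ℕ → ℝ → ℂ} {F : ℝ → ℂ} (hF : Continuous F)
    (hG : ∀ n, Mult δ C (G n)) (hR : ∀ n t, |t| ≤ δ → ‖G n t‖ ≤ R)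
    (hlim : ∀ t, |t| ≤ δ → Tendsto (fun n => G n t) atTop (𝓝 (F t))) : Mult δ C F := by
  refine ⟨hF, (hG 0).2.1, fun f hf hs B hB u => ?_⟩
  have ht : Tendsto (fun n => FI (fun t => G n t * f t) u) atTop
      (𝓝 (FI (fun t => F t * f t) u)) := by
    unfold FI
    refine tendsto_integral_of_dominated_convergence (fun t => R * ‖f t‖) ?_
      (hf.norm.const_mul R) ?_ ?_
    · intro n
      exact (integrable_mul_cis (integrable_cont_mul (hG n).1 hf hs) u).1
    · intro n
      refine Eventually.of_forall fun t => ?_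
      rw [norm_mul, norm_cis, mul_one, norm_mul]
      by_cases h : |t| ≤ δ
      · exact mul_le_mul_of_nonneg_right (hR n t h) (norm_nonneg _)
      · rw [hs t (not_le.mp h)]; simp
    · refine Eventually.of_forall fun t => ?_
      by_cases h : |t| ≤ δ
      · exact ((hlim t h).mul_const _).mul_const _
      · simp [hs t (not_le.mp h)]
  exact le_of_tendsto ht.norm (Eventually.of_forall fun n => (hG n).2.2 f hf hs B hB u)

lemma exp {δ C : ℝ} {F : ℝ → ℂ} (hF : Mult δ C F) :
    Mult δ (Real.exp C) (fun t => Complex.exp (F t)) := by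
  obtain ⟨R, hR0, hR⟩ := bdd_of_cont hF.1 δ
  refine Mult.lim (G := fun n t => (1 + F t / n) ^ n) (R := Real.exp R)
    (Complex.continuous_exp.comp hF.1) ?_ ?_ ?_
  · intro n
    have h1 : Mult δ (1 + C / n) (fun t => 1 + F t / n) := by
      have := (Mult.const δ 1).add (hF.const_mul (1 / (n : ℂ)))
      refine (Eq.mp ?_ this)
      congr 1
      · simp; ring
      · ext t; ring
    refine (h1.pow n).mono ?_
    calc (1 + C / n) ^ n ≤ (Real.exp (C / n)) ^ n := by
          gcongr
          · have := hF.2.1; positivity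
          · rw [add_comm]; exact Real.add_one_le_exp _
      _ ≤ Real.exp C := by
          rw [← Real.exp_nat_mul]
          apply Real.exp_le_exp.mpr
          rcases Nat.eq_zero_or_pos n with h | h
          · simp [h, hF.2.1]
          · rw [mul_div_cancel₀]; positivity
  · intro n t ht
    rw [norm_pow]
    calc ‖1 + F t / n‖ ^ n ≤ (Real.exp (R / n)) ^ n := by
          gcongr
          refine (norm_add_le _ _).trans ?_
          rw [norm_one, norm_div, Complex.norm_natCast, add_comm]
          refine le_trans ?_ (Real.add_one_le_exp _)
          gcongr
          exact hR t ht
      _ ≤ Real.exp R := by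
          rw [← Real.exp_nat_mul]
          apply Real.exp_le_exp.mpr
          rcases Nat.eq_zero_or_pos n with h | h
          · simp [h, hR0]
          · rw [mul_div_cancel₀]; positivity
  · intro t _
    exact Complex.tendsto_one_add_div_pow_exp (F t)

lemma of_integral {α : Type*} [MeasurableSpace α] {μ : Measure α} [SFinite μ] {δ : ℝ}
    {w : α → ℂ} (hw : Integrable w μ) {l : α → ℝ} (hl : Measurable l) {F : ℝ → ℂ}
    (hF : Continuous F)
    (h : ∀ t, |t| ≤ δ → F t = ∫ v, w v * cis (-(t * l v)) ∂μ) :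
    Mult δ (∫ v, ‖w v‖ ∂μ) F := by
  refine ⟨hF, integral_nonneg fun _ => norm_nonneg _, fun f hf hs B hB u => ?_⟩
  have key : FI (fun t => F t * f t) u = ∫ v, w v * FI f (u - l v) ∂μ := by
    have e1 : FI (fun t => F t * f t) u
        = ∫ t, ∫ v, (w v * cis (-(t * l v))) * (f t * cis (u * t)) ∂μ := by
      unfold FI
      congr 1; ext t
      rw [integral_mul_const]
      beta_reduce
      by_cases ht : |t| ≤ δ
      · rw [h t ht]; ring
      · rw [hs t (not_le.mp ht)]; simp
    rw [e1, integral_integral_swap]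
    · congr 1; ext v
      unfold FI
      rw [← integral_const_mul]
      congr 1; ext t
      rw [show (u - l v) * t = -(t * l v) + u * t by ring, cis_add]; ring
    · have h0 : Integrable (fun q : ℝ × α => f q.1 * w q.2) (volume.prod μ) :=
        hf.mul_prod hw
      refine (h0.mul_bdd (c := 1) (g := fun q : ℝ × α => cis (-(q.1 * l q.2)) * cis (u * q.1))
        ?_ ?_).congr ?_
      · have : Measurable (fun q : ℝ × α => cis (-(q.1 * l q.2)) * cis (u * q.1)) := by fun_prop
        exact this.aestronglyMeasurable
      · refine Eventually.of_forall fun q => ?_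
        rw [norm_mul, norm_cis, norm_cis, mul_one]
      · refine Eventually.of_forall fun q => ?_
        simp only [Function.uncurry]
        ring
  rw [key, ← integral_mul_const]
  refine norm_integral_le_of_norm_le (hw.norm.mul_const B) ?_
  refine Eventually.of_forall fun v => ?_
  rw [norm_mul]
  exact mul_le_mul_of_nonneg_left (hB _) (norm_nonneg _)

lemma char (δ : ℝ) (c : ℂ) (l : ℝ) : Mult δ ‖c‖ (fun t => c * cis (-(t * l))) := by
  have := Mult.of_integral (μ := Measure.dirac ()) (δ := δ) (w := fun _ => c) (by simp)
    (l := fun _ => l) (by fun_prop) (F := fun t => c * cis (-(t * l))) (by fun_prop) (by simp)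
  simpa using this

lemma congr {δ C : ℝ} {F G : ℝ → ℂ} (h : Mult δ C F) (hFG : ∀ t, G t = F t) : Mult δ C G := by
  have : G = F := funext hFG
  rwa [this]

end Mult



/-- A Schwartz function which equals `1` near the origin (on `[-1,1]`). -/
lemma exists_bump : ∃ χ : SchwartzMap ℝ ℂ, (∀ t, |t| ≤ 1 → χ t = 1) ∧ (∀ t, 2 ≤ |t| → χ t = 0) := by
  let b : ContDiffBump (0 : ℝ) := ⟨1, 2, by norm_num, by norm_num⟩
  have hc : HasCompactSupport (fun t : ℝ => ((b t : ℝ) : ℂ)) :=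
    b.hasCompactSupport.comp_left (g := fun x : ℝ => (x : ℂ)) (by simp)
  have hd : ContDiff ℝ (⊤ : ℕ∞) (fun t : ℝ => ((b t : ℝ) : ℂ)) :=
    Complex.ofRealCLM.contDiff.comp b.contDiff
  refine ⟨hc.toSchwartzMap hd, fun t ht => ?_, fun t ht => ?_⟩
  · have : b t = 1 := b.one_of_mem_closedBall (by simpa using ht)
    simp [this]
  · have : b t = 0 := b.zero_of_le_dist (by simpa using ht)
    simp [this]

lemma exists_mult_t : ∃ Ct : ℝ, 0 < Ct ∧ ∀ δ : ℝ, 0 < δ → Mult δ (Ct * δ) (fun t => (t : ℂ)) := by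
  obtain ⟨χ, h1, h2⟩ := exists_bump
  have hg : (fun t : ℝ => (t : ℂ)).HasTemperateGrowth := by
    exact Complex.ofRealCLM.hasTemperateGrowth
  let g : SchwartzMap ℝ ℂ := SchwartzMap.smulLeftCLM ℂ (fun t : ℝ => (t : ℂ)) χ
  have hgt : ∀ t, g t = t * χ t := fun t => by
    simp [g, SchwartzMap.smulLeftCLM_apply_apply hg]
  let h : SchwartzMap ℝ ℂ := FourierTransformInv.fourierInv g
  have hh : ∀ t : ℝ, g t = ∫ v, h v * cis (-(t * (2 * Real.pi * v))) := by
    intro t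
    have e : g = FourierTransform.fourier h := by simp [h]
    rw [e, SchwartzMap.fourier_coe, Real.fourier_real_eq_integral_exp_smul]
    congr 1; ext v
    rw [smul_eq_mul, mul_comm, cis]
    congr 2
    push_cast; ring
  refine ⟨(∫ v, ‖h v‖) + 1, by positivity, fun δ hδ => ?_⟩
  refine Mult.mono (C := ∫ v, ‖(δ : ℂ) * h v‖) ?_ ?_
  · refine Mult.of_integral (w := fun v => (δ : ℂ) * h v) (h.integrable.const_mul _)
      (l := fun v => 2 * Real.pi * v / δ) (by fun_prop) (by fun_prop) ?_
    intro t ht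
    have h3 : |t / δ| ≤ 1 := by rw [abs_div, abs_of_pos hδ]; exact (div_le_one hδ).mpr ht
    have h4 := hh (t / δ)
    rw [hgt, h1 _ h3, mul_one] at h4
    have hδ' : (δ : ℂ) ≠ 0 := by exact_mod_cast hδ.ne'
    have : (t : ℂ) = δ * ((t / δ : ℝ) : ℂ) := by
      push_cast; rw [mul_div_cancel₀ _ hδ']
    rw [this, h4, ← integral_const_mul]
    congr 1; ext v
    rw [show t / δ * (2 * Real.pi * v) = t * (2 * Real.pi * v / δ) by ring]
    ring
  · simp_rw [norm_mul]
    rw [integral_const_mul, Complex.norm_real, Real.norm_of_nonneg hδ.le]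
    nlinarith

lemma Mult.inv {δ C : ℝ} (hδ : Mult δ C (fun t => (t : ℂ))) {w : ℂ}
    (hw : 0 < w.re) (hC : C < ‖w‖) :
    Mult δ (1 / (‖w‖ - C)) (fun t => 1 / (w + t * Complex.I)) := by
  have hne : ∀ t : ℝ, w + t * Complex.I ≠ 0 := by
    intro t h
    have := congrArg Complex.re h
    simp at this
    linarith
  have hcont : Continuous (fun t : ℝ => 1 / (w + t * Complex.I)) := by
    refine continuous_const.div (by fun_prop) hne
  refine ⟨hcont, by have := sub_pos.mpr hC; positivity, fun f hf hs B hB u => ?_⟩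
  set g : ℝ → ℂ := fun t => 1 / (w + t * Complex.I) * f t with hg
  have hgi : Integrable g := integrable_cont_mul hcont hf hs
  have hgs : ∀ t, δ < |t| → g t = 0 := fun t ht => by simp [hg, hs t ht]
  have hbd : BddAbove (Set.range fun u => ‖FI g u‖) :=
    ⟨∫ t, ‖g t‖, by rintro _ ⟨u, rfl⟩; exact norm_FI_le u⟩
  set M := ⨆ u, ‖FI g u‖
  have hM : ∀ u, ‖FI g u‖ ≤ M := fun u => le_ciSup hbd u
  have h1 := hδ.2.2 g hgi hgs M hM
  have h2 : ∀ u, ‖FI g u‖ ≤ (B + C * M) / ‖w‖ := by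
    intro u
    have e : FI f u = w * FI g u + Complex.I * FI (fun t => (t : ℂ) * g t) u := by
      unfold FI
      rw [← integral_const_mul, ← integral_const_mul, ← integral_add]
      · congr 1; ext t
        have := hne t
        simp only [hg]
        field_simp
      · exact (integrable_mul_cis hgi u).const_mul _
      · exact (integrable_mul_cis (integrable_cont_mul (by fun_prop) hgi hgs) u).const_mul _
    have hw0 : 0 < ‖w‖ := hδ.2.1.trans_lt hC
    rw [le_div_iff₀ hw0, mul_comm, ← norm_mul]
    have e2 : w * FI g u = FI f u - Complex.I * FI (fun t => (t : ℂ) * g t) u := by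
      rw [e]; ring
    rw [e2]
    refine (norm_sub_le _ _).trans (add_le_add (hB u) ?_)
    rw [norm_mul, Complex.norm_I, one_mul]
    exact h1 u
  have h3 : M ≤ (B + C * M) / ‖w‖ := ciSup_le h2
  have hw0 : 0 < ‖w‖ := hδ.2.1.trans_lt hC
  rw [le_div_iff₀ hw0] at h3
  refine (hM u).trans ?_
  rw [one_div, inv_mul_eq_div, le_div_iff₀ (sub_pos.mpr hC)]
  nlinarith



/-! ### Part B: Laplace transforms -/

noncomputable def Lap (w : ℝ → ℂ) (z : ℂ) : ℂ := ∫ v in Ioi (0:ℝ), w v * Complex.exp (-z * v)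

lemma norm_exp_neg_mul (z : ℂ) (v : ℝ) : ‖Complex.exp (-z * v)‖ = Real.exp (-z.re * v) := by
  rw [Complex.norm_exp]; simp

lemma norm_exp_neg_mul_le {z : ℂ} (hz : 0 ≤ z.re) {v : ℝ} (hv : 0 ≤ v) :
    ‖Complex.exp (-z * v)‖ ≤ 1 := by
  rw [norm_exp_neg_mul, Real.exp_le_one_iff]
  nlinarith [mul_nonneg hz hv]

lemma Lap_integrable {w : ℝ → ℂ} (hw : IntegrableOn w (Ioi 0)) {z : ℂ} (hz : 0 ≤ z.re) :
    IntegrableOn (fun v : ℝ => w v * Complex.exp (-z * v)) (Ioi 0) := by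
  refine Integrable.mul_bdd (c := 1) hw ?_ ?_
  · exact (by fun_prop : Continuous fun v : ℝ => Complex.exp (-z * v)).aestronglyMeasurable
  · filter_upwards [ae_restrict_mem measurableSet_Ioi] with v hv
    exact norm_exp_neg_mul_le hz (le_of_lt hv)

lemma Lap_bound {w : ℝ → ℂ} (hw : IntegrableOn w (Ioi 0)) {z : ℂ} (hz : 0 ≤ z.re) :
    ‖Lap w z‖ ≤ ∫ v in Ioi (0:ℝ), ‖w v‖ := by
  refine norm_integral_le_of_norm_le hw.norm ?_
  filter_upwards [ae_restrict_mem measurableSet_Ioi] with v hv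
  rw [norm_mul]
  exact mul_le_of_le_one_right (norm_nonneg _) (norm_exp_neg_mul_le hz (le_of_lt hv))

lemma Lap_continuousOn {w : ℝ → ℂ} (hw : IntegrableOn w (Ioi 0)) :
    ContinuousOn (Lap w) {z | 0 ≤ z.re} := by
  refine continuousOn_of_dominated (bound := fun v => ‖w v‖) ?_ ?_ hw.norm ?_
  · intro z hz
    exact (Lap_integrable hw hz).1
  · intro z hz
    filter_upwards [ae_restrict_mem measurableSet_Ioi] with v hv
    rw [norm_mul]
    exact mul_le_of_le_one_right (norm_nonneg _) (norm_exp_neg_mul_le hz (le_of_lt hv))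
  · refine Eventually.of_forall fun v => ?_
    exact (by fun_prop : Continuous fun z : ℂ => w v * Complex.exp (-z * v)).continuousOn

lemma Lap_mult {w : ℝ → ℂ} (hw : IntegrableOn w (Ioi 0)) {z₀ : ℂ} (hz : 0 ≤ z₀.re) (δ : ℝ) :
    Mult δ (∫ v in Ioi (0:ℝ), ‖w v‖) (fun t : ℝ => Lap w (z₀ + t * Complex.I)) := by
  have hc : Continuous (fun t : ℝ => Lap w (z₀ + t * Complex.I)) := by
    refine (Lap_continuousOn hw).comp_continuous (by fun_prop) ?_
    intro t; simpa using hz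
  refine Mult.mono (Mult.of_integral (Lap_integrable hw hz) (l := fun v => v) (by fun_prop) hc ?_) ?_
  · intro t _
    unfold Lap
    congr 1; ext v
    rw [mul_assoc, cis, ← Complex.exp_add]
    congr 2
    push_cast; ring
  · refine setIntegral_mono_on (Lap_integrable hw hz).norm hw.norm measurableSet_Ioi ?_
    intro v hv
    rw [norm_mul]
    exact mul_le_of_le_one_right (norm_nonneg _) (norm_exp_neg_mul_le hz (le_of_lt hv))

/-- `∫_1^∞ e^{-zv}/v dv`. -/
noncomputable def Lk (z : ℂ) : ℂ := ∫ v in Ioi (1:ℝ), Complex.exp (-z * v) / v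

noncomputable def w0 (v : ℝ) : ℂ := (1 - Real.exp (-v)) / v
noncomputable def w1 (v : ℝ) : ℂ := (Ioi (1:ℝ)).indicator (fun v => 1 / (v:ℂ)) v - w0 v
noncomputable def w2 (v : ℝ) : ℂ := (Ioi (1:ℝ)).indicator (fun v => 1 / (v:ℂ) ^ 2) v

lemma measurable_w0 : Measurable w0 := by unfold w0; fun_prop

lemma norm_w0_le {v : ℝ} (hv : 0 < v) : ‖w0 v‖ ≤ 1 := by
  unfold w0
  rw [← Complex.ofReal_one, ← Complex.ofReal_sub, ← Complex.ofReal_div, Complex.norm_real,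
    Real.norm_eq_abs, abs_le]
  have h1 : Real.exp (-v) ≤ 1 := by rw [Real.exp_le_one_iff]; linarith
  have h2 := Real.add_one_le_exp (-v)
  constructor
  · have : 0 ≤ (1 - Real.exp (-v)) / v := div_nonneg (by linarith) hv.le
    linarith
  · rw [div_le_one hv]; linarith

lemma integrableOn_w2 : IntegrableOn w2 (Ioi 0) := by
  have h : IntegrableOn (fun v : ℝ => 1 / (v:ℂ) ^ 2) (Ioi 1) := by
    have := integrableOn_Ioi_rpow_of_lt (a := -2) (by norm_num) (c := 1) one_pos
    refine (this.ofReal (𝕜 := ℂ)).congr ?_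
    filter_upwards [ae_restrict_mem measurableSet_Ioi] with v hv
    have hv : (0:ℝ) < v := lt_trans one_pos hv
    rw [Real.rpow_neg hv.le]
    simp
  have h3 : Integrable w2 := by
    have := h.integrable_indicator measurableSet_Ioi
    exact this
  exact h3.integrableOn

lemma integrableOn_w1 : IntegrableOn w1 (Ioi 0) := by
  have hm : Measurable w1 := by
    unfold w1
    exact (Measurable.indicator (by fun_prop) measurableSet_Ioi).sub measurable_w0
  have hb : IntegrableOn (fun v => Real.exp (-v)) (Ioi 0) := by
    simpa using exp_neg_integrableOn_Ioi 0 one_pos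
  refine Integrable.mono' (g := fun v => Real.exp 1 * Real.exp (-v)) (hb.const_mul _) hm.aestronglyMeasurable ?_
  filter_upwards [ae_restrict_mem measurableSet_Ioi] with v (hv : 0 < v)
  by_cases h : 1 < v
  · have e : w1 v = ((Real.exp (-v) / v : ℝ) : ℂ) := by
      simp only [w1, w0, indicator_of_mem (mem_Ioi.mpr h)]; push_cast; ring
    rw [e, Complex.norm_real, Real.norm_of_nonneg (by positivity)]
    have h1 := Real.exp_pos (-v)
    rw [div_le_iff₀ hv]
    have h2 : (1:ℝ) ≤ Real.exp 1 := Real.one_le_exp (by norm_num)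
    nlinarith [mul_le_mul h2 h.le (by norm_num) (by positivity)]
  · have e : w1 v = - w0 v := by
      simp only [w1]; rw [indicator_of_notMem (by simpa using h)]; ring
    rw [e, norm_neg]
    refine (norm_w0_le hv).trans ?_
    rw [← Real.exp_add]
    exact Real.one_le_exp (by linarith)

lemma integrableOn_exp_neg_mul {z : ℂ} (hz : 0 < z.re) (c : ℝ) :
    IntegrableOn (fun v : ℝ => Complex.exp (-z * v)) (Ioi c) :=
  integrableOn_exp_mul_complex_Ioi (a := -z) (by simpa using hz) c

lemma integrableOn_Lk {z : ℂ} (hz : 0 < z.re) :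
    IntegrableOn (fun v : ℝ => Complex.exp (-z * v) / v) (Ioi 1) := by
  refine Integrable.mono (integrableOn_exp_neg_mul hz 1) ?_ ?_
  · exact (by fun_prop : Measurable fun v : ℝ => Complex.exp (-z * v) / v).aestronglyMeasurable
  · filter_upwards [ae_restrict_mem measurableSet_Ioi] with v (hv : 1 < v)
    rw [norm_div, Complex.norm_real, Real.norm_of_nonneg (by linarith)]
    exact div_le_self (norm_nonneg _) hv.le

lemma Lap_w0 {z : ℂ} (hz : 0 < z.re) : Lap w0 z = Complex.log (1 + z) - Complex.log z := by
  have e1 : Lap w0 z = ∫ v in Ioi (0:ℝ), ∫ r in (0:ℝ)..1, Complex.exp (-(z + r) * v) := by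
    refine setIntegral_congr_fun measurableSet_Ioi fun v (hv : 0 < v) => ?_
    have hv' : (v:ℂ) ≠ 0 := by exact_mod_cast hv.ne'
    have : ∀ r : ℝ, Complex.exp (-(z + r) * v) = Complex.exp (-z * v) * Complex.exp (-v * r) := by
      intro r; rw [← Complex.exp_add]; congr 1; ring
    simp_rw [this]
    rw [intervalIntegral.integral_const_mul, integral_exp_mul_complex (by simpa using hv')]
    simp only [w0]
    push_cast
    field_simp
    simp
  have hcont : Continuous (fun q : ℝ × ℝ => Complex.exp (-(z + q.2) * q.1)) := by fun_prop
  rw [e1]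
  simp_rw [intervalIntegral.integral_of_le (zero_le_one (α := ℝ))]
  rw [integral_integral_swap]
  · have e2 : ∀ r ∈ Ioc (0:ℝ) 1, (∫ v in Ioi (0:ℝ), Complex.exp (-(z + r) * v)) = 1 / (z + r) := by
      intro r hr
      have hre : (-(z + r)).re < 0 := by simp; linarith [hr.1]
      rw [integral_exp_mul_complex_Ioi hre]
      have : z + r ≠ 0 := by intro h; rw [h] at hre; simp at hre
      simp only [Complex.ofReal_zero, mul_zero, Complex.exp_zero]
      rw [neg_div_neg_eq]
    rw [setIntegral_congr_fun measurableSet_Ioc e2,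
      ← intervalIntegral.integral_of_le (zero_le_one (α := ℝ))]
    have hs : ∀ r ∈ uIcc (0:ℝ) 1, z + r ∈ Complex.slitPlane := by
      intro r hr
      rw [uIcc_of_le zero_le_one] at hr
      left; simp; linarith [hr.1]
    have := intervalIntegral.integral_eq_sub_of_hasDerivAt (a := 0) (b := 1)
      (f := fun r : ℝ => Complex.log (z + r)) (f' := fun r : ℝ => 1 / (z + r)) ?_ ?_
    · rw [this]; simp [add_comm]
    · intro r hr
      have h := (hs r hr)
      have h1 : HasDerivAt (fun r : ℝ => z + r) 1 r := (Complex.ofRealCLM.hasDerivAt).const_add z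
      exact h1.clog_real h
    · apply ContinuousOn.intervalIntegrable
      intro r hr
      have := Complex.slitPlane_ne_zero (hs r hr)
      refine ContinuousAt.continuousWithinAt ?_
      exact continuousAt_const.div (by fun_prop) this
  · have hd : Integrable (fun q : ℝ × ℝ => Real.exp (-z.re * q.1) * 1)
        ((volume.restrict (Ioi 0)).prod (volume.restrict (Ioc 0 1))) := by
      have : IntegrableOn (fun v => Real.exp (-z.re * v)) (Ioi 0) := exp_neg_integrableOn_Ioi 0 hz
      exact Integrable.mul_prod (f := fun v => Real.exp (-z.re * v)) (g := fun _ : ℝ => (1:ℝ)) this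
        (by simp)
    refine hd.mono' hcont.aestronglyMeasurable ?_
    rw [Measure.prod_restrict]
    filter_upwards [ae_restrict_mem (measurableSet_Ioi.prod measurableSet_Ioc)] with q hq
    simp only [Function.uncurry]
    rw [norm_exp_neg_mul, mul_one]
    apply Real.exp_le_exp.mpr
    have h1 : 0 < q.1 := hq.1
    have h2 : 0 < q.2 := hq.2.1
    simp
    nlinarith [mul_pos h1 h2]

lemma Lk_eq {z : ℂ} (hz : 0 < z.re) :
    Lk z = (Complex.log (1 + z) - Complex.log z) + Lap w1 z := by
  rw [← Lap_w0 hz]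
  have i0 : IntegrableOn (fun v : ℝ => w0 v * Complex.exp (-z * v)) (Ioi 0) := by
    refine Integrable.bdd_mul (c := 1) (integrableOn_exp_neg_mul hz 0) measurable_w0.aestronglyMeasurable ?_
    filter_upwards [ae_restrict_mem measurableSet_Ioi] with v hv using norm_w0_le hv
  unfold Lap Lk
  rw [← integral_add i0 (Lap_integrable integrableOn_w1 hz.le)]
  have : ∀ v : ℝ, w0 v * Complex.exp (-z * v) + w1 v * Complex.exp (-z * v)
      = (Ioi (1:ℝ)).indicator (fun v : ℝ => Complex.exp (-z * v) / v) v := by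
    intro v
    simp only [w1, indicator]
    split_ifs <;> ring
  simp_rw [this]
  rw [setIntegral_indicator measurableSet_Ioi, inter_eq_right.mpr (Ioi_subset_Ioi zero_le_one)]

lemma z_mul_Lk {z : ℂ} (hz : 0 < z.re) : z * Lk z = Complex.exp (-z) - Lap w2 z := by
  have e2 : Lap w2 z = ∫ v in Ioi (1:ℝ), Complex.exp (-z * v) / v ^ 2 := by
    unfold Lap
    have : ∀ v : ℝ, w2 v * Complex.exp (-z * v)
        = (Ioi (1:ℝ)).indicator (fun v : ℝ => Complex.exp (-z * v) / v ^ 2) v := by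
      intro v
      simp only [w2, indicator]
      split_ifs <;> ring
    simp_rw [this]
    rw [setIntegral_indicator measurableSet_Ioi, inter_eq_right.mpr (Ioi_subset_Ioi zero_le_one)]
  have i2 : IntegrableOn (fun v : ℝ => Complex.exp (-z * v) / (v:ℂ) ^ 2) (Ioi 1) := by
    refine Integrable.mono (integrableOn_exp_neg_mul hz 1) ?_ ?_
    · exact (by fun_prop : Measurable fun v : ℝ => Complex.exp (-z * v) / (v:ℂ) ^ 2).aestronglyMeasurable
    · filter_upwards [ae_restrict_mem measurableSet_Ioi] with v (hv : 1 < v)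
      rw [norm_div, norm_pow, Complex.norm_real, Real.norm_of_nonneg (by linarith)]
      exact div_le_self (norm_nonneg _) (one_le_pow₀ hv.le)
  rw [e2, eq_sub_iff_add_eq]
  unfold Lk
  rw [← integral_const_mul, ← integral_add ((integrableOn_Lk hz).const_mul _) i2]
  have i3 : IntegrableOn (fun v : ℝ => z * (Complex.exp (-z * v) / v)
      + Complex.exp (-z * v) / v ^ 2) (Ioi 1) :=
    (((integrableOn_Lk hz).const_mul z).add i2).congr (Eventually.of_forall fun v => rfl)
  have := integral_Ioi_of_hasDerivAt_of_tendsto (a := (1:ℝ)) (m := 0)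
    (f := fun v : ℝ => -(Complex.exp (-z * v) / v))
    (f' := fun v : ℝ => z * (Complex.exp (-z * v) / v) + Complex.exp (-z * v) / v ^ 2) ?_ ?_
    i3 ?_
  · rw [this]; simp
  · refine ContinuousAt.continuousWithinAt ?_
    refine (ContinuousAt.div (by fun_prop) (by fun_prop) (by simp)).neg
  · intro v (hv : 1 < v)
    have hv' : (v:ℂ) ≠ 0 := by
      have : v ≠ 0 := by linarith
      exact_mod_cast this
    have h1 : HasDerivAt (fun v : ℝ => (v:ℂ)) 1 v := Complex.ofRealCLM.hasDerivAt
    have h2 := ((h1.const_mul (-z)).cexp.div h1 hv').neg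
    refine (h2.congr_deriv ?_)
    field_simp
    ring
  · refine squeeze_zero_norm' (a := fun v : ℝ => v⁻¹) ?_ tendsto_inv_atTop_zero
    filter_upwards [eventually_gt_atTop 0] with v hv
    rw [norm_neg, norm_div, Complex.norm_real, Real.norm_of_nonneg hv.le, inv_eq_one_div]
    gcongr
    exact norm_exp_neg_mul_le hz.le hv.le



lemma intervalIntegrable_abs_rpow {r : ℝ} (hr : -1 < r) (x y : ℝ) :
    IntervalIntegrable (fun t : ℝ => |t| ^ r) volume x y := by
  have h1 : ∀ T : ℝ, 0 ≤ T → IntervalIntegrable (fun t : ℝ => |t| ^ r) volume 0 T := by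
    intro T hT
    refine (intervalIntegral.intervalIntegrable_rpow' (a := 0) (b := T) hr).congr ?_
    intro t ht
    rw [uIoc_of_le hT] at ht
    beta_reduce
    rw [abs_of_pos ht.1]
  have h2 : ∀ T : ℝ, IntervalIntegrable (fun t : ℝ => |t| ^ r) volume 0 T := by
    intro T
    rcases le_total 0 T with h | h
    · exact h1 T h
    · have := h1 (-T) (by linarith)
      rw [IntervalIntegrable.iff_comp_neg] at this
      simpa using this
  exact (h2 x).symm.trans (h2 y)

lemma integrableOn_abs_sub_rpow {r : ℝ} (hr : -1 < r) (a T : ℝ) :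
    IntegrableOn (fun t : ℝ => |t - a| ^ r) (Icc (-T) T) := by
  rcases lt_or_ge T (-T) with h | h
  · rw [Icc_eq_empty (not_le.mpr h)]; simp
  have := (intervalIntegrable_abs_rpow hr (-T - a) (T - a)).comp_sub_right a
  rw [intervalIntegrable_iff_integrableOn_Icc_of_le (by linarith)] at this
  simpa using this

/-- Product of integrable singularities at distinct points. -/
lemma prod_sing {ι : Type*} [Fintype ι] {a : ι → ℝ} (ha : Function.Injective a) {θ : ℝ}
    (h0 : 0 < θ) : ∃ K, 0 ≤ K ∧ ∀ t, ∏ i, |t - a i| ^ (-θ) ≤ K * (1 + ∑ i, |t - a i| ^ (-θ)) := by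
  have hsep : ∃ η : ℝ, 0 < η ∧ η ≤ 1 ∧ ∀ i j, i ≠ j → 2 * η ≤ |a i - a j| := by
    have h1 : ∀ i j, ∀ᶠ η in 𝓝[>] (0:ℝ), i ≠ j → 2 * η ≤ |a i - a j| := by
      intro i j
      by_cases hij : i = j
      · simp [hij]
      · have hpos : 0 < |a i - a j| / 2 := by
          have := abs_pos.mpr (sub_ne_zero.mpr (ha.ne hij))
          linarith
        filter_upwards [Ioo_mem_nhdsGT hpos] with η hη _
        linarith [hη.2]
    have h2 : ∀ᶠ η in 𝓝[>] (0:ℝ), ∀ i j, i ≠ j → 2 * η ≤ |a i - a j| := by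
      rw [eventually_all]; intro i; rw [eventually_all]; exact h1 i
    obtain ⟨η, hη, hη2⟩ := (h2.and (Ioo_mem_nhdsGT (zero_lt_one (α := ℝ)))).exists
    exact ⟨η, hη2.1, hη2.2.le, hη⟩
  obtain ⟨η, hη0, hη1, hη⟩ := hsep
  set X := η ^ (-θ) with hX
  have hX1 : 1 ≤ X := Real.one_le_rpow_of_pos_of_le_one_of_nonpos hη0 hη1 (by linarith)
  have hbig : ∀ x : ℝ, η ≤ |x| → |x| ^ (-θ) ≤ X := fun x hx =>
    Real.rpow_le_rpow_of_nonpos hη0 hx (by linarith)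
  have hnn : ∀ x : ℝ, 0 ≤ |x| ^ (-θ) := fun x => Real.rpow_nonneg (abs_nonneg _) _
  refine ⟨X ^ Fintype.card ι, by positivity, fun t => ?_⟩
  have hsum : 0 ≤ ∑ i, |t - a i| ^ (-θ) := Finset.sum_nonneg fun i _ => hnn _
  by_cases hall : ∀ i, η ≤ |t - a i|
  · calc ∏ i, |t - a i| ^ (-θ) ≤ ∏ _i : ι, X :=
          Finset.prod_le_prod (fun i _ => hnn _) (fun i _ => hbig _ (hall i))
      _ = X ^ Fintype.card ι := by simp
      _ ≤ X ^ Fintype.card ι * (1 + ∑ i, |t - a i| ^ (-θ)) := by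
          apply le_mul_of_one_le_right (by positivity); linarith
  · push Not at hall
    obtain ⟨j, hj⟩ := hall
    rw [← Finset.mul_prod_erase _ _ (Finset.mem_univ j)]
    have h1 : ∏ i ∈ Finset.univ.erase j, |t - a i| ^ (-θ) ≤ X ^ Fintype.card ι := by
      calc ∏ i ∈ Finset.univ.erase j, |t - a i| ^ (-θ) ≤ ∏ _i ∈ Finset.univ.erase j, X := by
            refine Finset.prod_le_prod (fun i _ => hnn _) (fun i hi => hbig _ ?_)
            have hij : i ≠ j := Finset.ne_of_mem_erase hi
            have h2 := hη i j hij
            have h3 := abs_sub_abs_le_abs_sub (a i - a j) (t - a j)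
            rw [show a i - a j - (t - a j) = -(t - a i) by ring, abs_neg] at h3
            linarith
        _ = X ^ (Finset.univ.erase j).card := by simp
        _ ≤ X ^ Fintype.card ι := pow_le_pow_right₀ hX1 (Finset.card_le_univ _)
    calc |t - a j| ^ (-θ) * ∏ i ∈ Finset.univ.erase j, |t - a i| ^ (-θ)
        ≤ (1 + ∑ i, |t - a i| ^ (-θ)) * X ^ Fintype.card ι := by
          refine mul_le_mul ?_ h1 (Finset.prod_nonneg fun i _ => hnn _) (by linarith)
          have := Finset.single_le_sum (fun i _ => hnn (t - a i)) (Finset.mem_univ j)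
          linarith
      _ = _ := mul_comm _ _

/-- Dominated convergence combined with the Riemann-Lebesgue lemma. -/
lemma RL_limit {F : ℝ → ℝ → ℂ} {g : ℝ → ℝ} (hg : Integrable g)
    (hm : ∀ ε, 0 < ε → ε ≤ 1 → AEStronglyMeasurable (F ε) volume)
    (hb : ∀ ε, 0 < ε → ε ≤ 1 → ∀ᵐ t, ‖F ε t‖ ≤ g t)
    (hl : ∀ᵐ t, ∃ y, Tendsto (fun ε => F ε t) (𝓝[>] 0) (𝓝 y)) :
    ∃ r : ℝ → ℂ, (∀ u, Tendsto (fun ε => FI (F ε) u) (𝓝[>] 0) (𝓝 (r u))) ∧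
      Tendsto r atTop (𝓝 0) := by
  let F0 : ℝ → ℂ := fun t => limUnder (𝓝[>] 0) (fun ε => F ε t)
  have hF0 : ∀ᵐ t, Tendsto (fun ε => F ε t) (𝓝[>] 0) (𝓝 (F0 t)) := by
    filter_upwards [hl] with t ht using tendsto_nhds_limUnder ht
  have hev : ∀ᶠ ε in 𝓝[>] (0:ℝ), 0 < ε ∧ ε ≤ 1 := by
    filter_upwards [Ioo_mem_nhdsGT (zero_lt_one (α := ℝ))] with ε hε using ⟨hε.1, hε.2.le⟩
  refine ⟨FI F0, fun u => ?_, ?_⟩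
  · unfold FI
    refine tendsto_integral_filter_of_dominated_convergence g ?_ ?_ hg ?_
    · filter_upwards [hev] with ε hε
      exact (hm ε hε.1 hε.2).mul (by fun_prop : Measurable fun t => cis (u * t)).aestronglyMeasurable
    · filter_upwards [hev] with ε hε
      filter_upwards [hb ε hε.1 hε.2] with t ht
      rwa [norm_mul, norm_cis, mul_one]
    · filter_upwards [hF0] with t ht using ht.mul_const _
  · have h := Real.tendsto_integral_exp_smul_cocompact F0
    have h2 : Tendsto (fun u : ℝ => -u / (2 * Real.pi)) atTop (cocompact ℝ) := by
      have : Tendsto (fun u : ℝ => -u / (2 * Real.pi)) atTop atBot :=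
        (tendsto_neg_atTop_atBot).atBot_div_const (by positivity)
      exact this.mono_right atBot_le_cocompact
    refine (h.comp h2).congr fun u => ?_
    simp only [Function.comp, FI]
    congr 1; ext t
    rw [Circle.smul_def, smul_eq_mul, mul_comm, Real.fourierChar_apply, cis]
    congr 2
    push_cast
    field_simp

lemma norm_exp_log_diff {c z : ℂ} {θ : ℝ} (hz : 0 < z.re) (hz1 : z.re ≤ 1) (him : z.im ≠ 0)
    (hθ : |c.re| ≤ θ) (hθ1 : θ ≤ 1) :
    ‖Complex.exp (c * (Complex.log (1 + z) - Complex.log z))‖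
      ≤ Real.exp (2 * Real.pi * |c.im| + (2 + |z.im|)) * |z.im| ^ (-θ) := by
  have hz0 : z ≠ 0 := by intro h; simp [h] at hz
  have hzn : 0 < ‖z‖ := norm_pos_iff.mpr hz0
  have him' : 0 < |z.im| := abs_pos.mpr him
  have hle : ‖z‖ ≤ ‖1 + z‖ := by
    rw [Complex.norm_def, Complex.norm_def]
    apply Real.sqrt_le_sqrt
    simp [Complex.normSq_apply]; nlinarith
  have hn1 : ‖1 + z‖ ≤ 2 + |z.im| := by
    refine (Complex.norm_le_abs_re_add_abs_im _).trans ?_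
    simp
    rw [abs_of_pos (by linarith)]; linarith
  have hθ0 : 0 ≤ θ := (abs_nonneg _).trans hθ
  rw [Complex.norm_exp, Real.rpow_def_of_pos him', ← Real.exp_add]
  apply Real.exp_le_exp.mpr
  rw [Complex.mul_re, Complex.sub_re, Complex.sub_im, Complex.log_re, Complex.log_re,
    Complex.log_im, Complex.log_im]
  have hD0 : 0 ≤ Real.log ‖1 + z‖ - Real.log ‖z‖ := by
    have := Real.log_le_log hzn hle; linarith
  have hD1 : Real.log ‖1 + z‖ ≤ 2 + |z.im| :=
    (Real.log_le_self (norm_nonneg _)).trans hn1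
  have hD2 : Real.log |z.im| ≤ Real.log ‖z‖ := Real.log_le_log him' (Complex.abs_im_le_norm z)
  have h1 : c.re * (Real.log ‖1 + z‖ - Real.log ‖z‖) ≤ θ * (Real.log ‖1 + z‖ - Real.log ‖z‖) :=
    mul_le_mul_of_nonneg_right ((le_abs_self _).trans hθ) hD0
  have h1b : 0 ≤ Real.log ‖1 + z‖ := by
    have h3 : (1:ℝ) ≤ ‖1 + z‖ := by
      refine le_trans ?_ (Complex.abs_re_le_norm _)
      simp; rw [abs_of_pos (by linarith)]; linarith
    exact Real.log_nonneg h3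
  have h2 : θ * (Real.log ‖1 + z‖ - Real.log ‖z‖) ≤ (2 + |z.im|) + Real.log |z.im| * -θ := by
    nlinarith [mul_le_mul_of_nonneg_left hD2 hθ0, mul_le_mul_of_nonneg_right hθ1 h1b]
  have h3 : -(c.im * ((1 + z).arg - z.arg)) ≤ 2 * Real.pi * |c.im| := by
    have h4 : |(1 + z).arg - z.arg| ≤ 2 * Real.pi := by
      refine (abs_sub _ _).trans ?_
      have := Complex.abs_arg_le_pi (1 + z)
      have := Complex.abs_arg_le_pi z
      linarith
    calc -(c.im * ((1 + z).arg - z.arg)) ≤ |c.im * ((1 + z).arg - z.arg)| := neg_le_abs _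
      _ = |c.im| * |(1 + z).arg - z.arg| := abs_mul _ _
      _ ≤ |c.im| * (2 * Real.pi) := mul_le_mul_of_nonneg_left h4 (abs_nonneg _)
      _ = _ := by ring
  linarith



/-- `z L(z)` in explicit form. -/
noncomputable def Bf (z : ℂ) : ℂ := Complex.exp (-z) - Lap w2 z

lemma Bf_continuousOn : ContinuousOn Bf {z | 0 ≤ z.re} :=
  (by fun_prop : Continuous fun z : ℂ => Complex.exp (-z)).continuousOn.sub
    (Lap_continuousOn integrableOn_w2)

lemma Bf_mult {z₀ : ℂ} (hz : 0 ≤ z₀.re) (δ : ℝ) :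
    Mult δ (1 + ∫ v in Ioi (0:ℝ), ‖w2 v‖) (fun t : ℝ => Bf (z₀ + t * Complex.I)) := by
  have h1 : Mult δ 1 (fun t : ℝ => Complex.exp (-(z₀ + t * Complex.I))) := by
    refine ((Mult.char δ (Complex.exp (-z₀)) 1).mono ?_).congr ?_
    · have := norm_exp_neg_mul_le hz (v := 1) zero_le_one
      simpa using this
    · intro t
      rw [cis, ← Complex.exp_add]; congr 1; push_cast; ring
  have h2 := (Lap_mult integrableOn_w2 hz δ).const_mul (-1)
  refine ((h1.add h2).mono ?_).congr ?_
  · simp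
  · intro t; simp only [Bf]; ring

section
variable {ι : Type*} [Fintype ι] (a : ι → ℝ) (β : ι → ℂ) (E : ℝ → ℂ)

/-- The model for `log ζ(1+z)`. -/
noncomputable def Hf (z : ℂ) : ℂ :=
  (1 + z) * (Lk z + ∑ i, β i * Lk (z - a i * Complex.I) + Lap E z)

noncomputable def Mf (z : ℂ) : ℂ :=
  (1 + z) * Complex.exp ((Lap w1 z + Bf z) +
    (1 + z) * (∑ i, β i * (Bf (z - a i * Complex.I) * (1 / (z - a i * Complex.I))) + Lap E z))

noncomputable def Qf (z : ℂ) : ℂ :=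
  Lap w1 z + Bf z + ∑ i, (β i * (1 + a i * Complex.I) * Lap w1 (z - a i * Complex.I)
    + β i * Bf (z - a i * Complex.I)) + (1 + z) * Lap E z

/-- The singular factor. -/
noncomputable def Sf (z : ℂ) : ℂ :=
  ∑ i, β i * (1 + a i * Complex.I) *
    (Complex.log (1 + (z - a i * Complex.I)) - Complex.log (z - a i * Complex.I))

lemma exp_log_diff {z : ℂ} (hz : 0 < z.re) :
    Complex.exp (Complex.log (1 + z) - Complex.log z) = (1 + z) / z := by
  have h0 : z ≠ 0 := by intro h; simp [h] at hz
  have h1 : 1 + z ≠ 0 := by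
    intro h; have := congrArg Complex.re h; simp at this; linarith
  rw [Complex.exp_sub, Complex.exp_log h0, Complex.exp_log h1]

lemma exp_Hf {z : ℂ} (hz : 0 < z.re) : Complex.exp (Hf a β E z) = Mf a β E z * (1 / z) := by
  have hzi : ∀ i, 0 < (z - a i * Complex.I).re := fun i => by simpa using hz
  have e : Hf a β E z = (Complex.log (1 + z) - Complex.log z) + ((Lap w1 z + Bf z) +
    (1 + z) * (∑ i, β i * (Bf (z - a i * Complex.I) * (1 / (z - a i * Complex.I))) + Lap E z)) := by
    have h1 : ∀ i, Bf (z - a i * Complex.I) * (1 / (z - a i * Complex.I)) = Lk (z - a i * Complex.I) := by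
      intro i
      have h0 : z - a i * Complex.I ≠ 0 := by intro h; have := hzi i; simp [h] at this
      rw [Bf, ← z_mul_Lk (hzi i)]
      field_simp
    simp_rw [h1]
    rw [Bf, ← z_mul_Lk hz, Hf]
    have := Lk_eq hz
    linear_combination this
  rw [e, Complex.exp_add, exp_log_diff hz, Mf]
  ring

lemma Hf_eq {z : ℂ} (hz : 0 < z.re) :
    Hf a β E z = (Complex.log (1 + z) - Complex.log z) + Sf a β z + Qf a β E z := by
  have hzi : ∀ i, 0 < (z - a i * Complex.I).re := fun i => by simpa using hz
  have h1 : (1 + z) * ∑ i, β i * Lk (z - a i * Complex.I) = Sf a β z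
      + ∑ i, (β i * (1 + a i * Complex.I) * Lap w1 (z - a i * Complex.I)
        + β i * Bf (z - a i * Complex.I)) := by
    rw [Sf, Finset.mul_sum, ← Finset.sum_add_distrib]
    refine Finset.sum_congr rfl fun i _ => ?_
    rw [Bf, ← z_mul_Lk (hzi i)]
    have := Lk_eq (hzi i)
    linear_combination (β i * (1 + a i * Complex.I)) * this
  have h2 := Lk_eq hz
  have h3 := z_mul_Lk hz
  rw [Hf, Qf, Bf, ← h3]
  linear_combination h1 + h2

lemma Qf_continuousOn (hE : IntegrableOn E (Ioi 0)) :
    ContinuousOn (Qf a β E) {z | 0 ≤ z.re} := by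
  have hs : ∀ (i : ι) (f : ℂ → ℂ), ContinuousOn f {z | 0 ≤ z.re} →
      ContinuousOn (fun z => f (z - a i * Complex.I)) {z : ℂ | 0 ≤ z.re} := by
    intro i f hf
    refine hf.comp (by fun_prop) ?_
    intro z hz; simpa using hz
  unfold Qf
  refine (((Lap_continuousOn integrableOn_w1).add Bf_continuousOn).add ?_).add ?_
  · refine continuousOn_finsetSum _ fun i _ => ?_
    exact (continuousOn_const.mul (hs i _ (Lap_continuousOn integrableOn_w1))).add
      (continuousOn_const.mul (hs i _ Bf_continuousOn))
  · exact (by fun_prop : Continuous fun z : ℂ => 1 + z).continuousOn.mul (Lap_continuousOn hE)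

lemma Mf_mult (hE : IntegrableOn E (Ioi 0)) (ha : ∀ i, a i ≠ 0) :
    ∃ δ : ℝ, 0 < δ ∧ ∃ C, ∀ ε : ℝ, 0 < ε → ε ≤ 1 →
      Mult δ C (fun t : ℝ => Mf a β E (ε + t * Complex.I)) := by
  obtain ⟨Ct, hCt, hmt⟩ := exists_mult_t
  have hδ : ∃ δ : ℝ, 0 < δ ∧ ∀ i, 2 * (Ct * δ) ≤ |a i| := by
    have h1 : ∀ᶠ δ in 𝓝[>] (0:ℝ), ∀ i, 2 * (Ct * δ) ≤ |a i| := by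
      rw [eventually_all]; intro i
      have hpos : 0 < |a i| / (2 * Ct) := by have := abs_pos.mpr (ha i); positivity
      filter_upwards [Ioo_mem_nhdsGT hpos] with δ hδ
      have := hδ.2
      rw [lt_div_iff₀ (by positivity)] at this
      linarith
    obtain ⟨δ, h, h'⟩ := (h1.and self_mem_nhdsWithin).exists
    exact ⟨δ, h', h⟩
  obtain ⟨δ, hδ0, hδ⟩ := hδ
  have hT := hmt δ hδ0
  refine ⟨δ, hδ0, ?_⟩
  set I1 := ∫ v in Ioi (0:ℝ), ‖w1 v‖
  set I2 := ∫ v in Ioi (0:ℝ), ‖w2 v‖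
  set IE := ∫ v in Ioi (0:ℝ), ‖E v‖
  have hI2 : 0 ≤ I2 := integral_nonneg fun _ => norm_nonneg _
  have hIE : 0 ≤ IE := integral_nonneg fun _ => norm_nonneg _
  refine ⟨(2 + Ct * δ) * Real.exp ((I1 + (1 + I2)) +
    (2 + Ct * δ) * ((∑ i, ‖β i‖ * ((1 + I2) * (2 / |a i|))) + IE)), fun ε hε hε1 => ?_⟩
  have hlin : Mult δ (2 + Ct * δ) (fun t : ℝ => 1 + ((ε:ℂ) + t * Complex.I)) := by
    refine (((Mult.const δ (1 + (ε:ℂ))).add (hT.const_mul Complex.I)).mono ?_).congr ?_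
    · have : ‖(1 + (ε:ℂ))‖ = 1 + ε := by
        rw [← Complex.ofReal_one, ← Complex.ofReal_add, Complex.norm_real,
          Real.norm_of_nonneg (by positivity)]
      rw [this, Complex.norm_I]; linarith
    · intro t; ring
  have hre : 0 ≤ (ε:ℂ).re := by simpa using hε.le
  have hzi : ∀ i, (0:ℝ) < ((ε:ℂ) - a i * Complex.I).re := fun i => by simpa using hε
  have hshift : ∀ (i : ι) (t : ℝ), (ε:ℂ) + t * Complex.I - a i * Complex.I
      = ((ε:ℂ) - a i * Complex.I) + t * Complex.I := by intro i t; ring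
  refine hlin.mul (Mult.exp (((Lap_mult integrableOn_w1 hre δ).add (Bf_mult hre δ)).add
    (hlin.mul ((Mult.sum _ fun i _ => ?_).add (Lap_mult hE hre δ)))))
  refine Mult.const_mul (β i) ?_
  simp_rw [hshift i]
  refine (Bf_mult (hzi i).le δ).mul ?_
  have hnorm : |a i| ≤ ‖(ε:ℂ) - a i * Complex.I‖ := by
    have := Complex.abs_im_le_norm ((ε:ℂ) - a i * Complex.I)
    simpa using this
  have hai := abs_pos.mpr (ha i)
  refine (hT.inv (hzi i) (by have := hδ i; linarith)).mono ?_
  rw [div_le_div_iff₀ (by have := hδ i; linarith) hai]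
  have := hδ i; linarith

/-- The regular part of `exp(± log ζ)`. -/
noncomputable def Rf (τ : ℂ) (z : ℂ) : ℂ := Complex.exp (τ * (Sf a β z + Qf a β E z))

lemma Rf_continuous (hE : IntegrableOn E (Ioi 0)) (τ : ℂ) {ε : ℝ} (hε : 0 < ε) :
    Continuous (fun t : ℝ => Rf a β E τ (ε + t * Complex.I)) := by
  unfold Rf
  refine Complex.continuous_exp.comp (continuous_const.mul (Continuous.add ?_ ?_))
  · unfold Sf
    refine continuous_finsetSum _ fun i _ => continuous_const.mul ?_
    refine (Continuous.clog (by fun_prop) ?_).sub (Continuous.clog (by fun_prop) ?_)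
    · intro t; left; simp; linarith
    · intro t; left; simp; linarith
  · refine (Qf_continuousOn a β E hE).comp_continuous (by fun_prop) ?_
    intro t; simp; linarith

lemma tendsto_eps (t : ℝ) : Tendsto (fun ε : ℝ => (ε:ℂ) + t * Complex.I) (𝓝[>] 0)
    (𝓝[{z | 0 ≤ z.re}] (t * Complex.I)) := by
  refine tendsto_nhdsWithin_iff.mpr ⟨?_, ?_⟩
  · have : Continuous (fun ε : ℝ => (ε:ℂ) + t * Complex.I) := by fun_prop
    have h := this.tendsto 0
    simp only [Complex.ofReal_zero, zero_add] at h
    exact h.mono_left nhdsWithin_le_nhds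
  · filter_upwards [self_mem_nhdsWithin] with ε hε
    simpa using le_of_lt hε

lemma Rf_tendsto (hE : IntegrableOn E (Ioi 0)) (τ : ℂ) {t : ℝ} (ht : ∀ i, t ≠ a i) :
    ∃ y, Tendsto (fun ε : ℝ => Rf a β E τ (ε + t * Complex.I)) (𝓝[>] 0) (𝓝 y) := by
  refine ⟨Complex.exp (τ * (Sf a β (t * Complex.I) + Qf a β E (t * Complex.I))),
    (Complex.continuous_exp.tendsto _).comp (Tendsto.const_mul τ (Tendsto.add ?_ ?_))⟩
  · have : ContinuousAt (Sf a β) (t * Complex.I) := by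
      unfold Sf
      refine tendsto_finsetSum _ fun i _ => ?_
      refine ContinuousAt.mul continuousAt_const ?_
      refine (ContinuousAt.clog (by fun_prop) ?_).sub (ContinuousAt.clog (by fun_prop) ?_)
      · left; simp
      · right; simp; exact sub_ne_zero.mpr (ht i)
    exact this.tendsto.comp ((tendsto_eps t).mono_right nhdsWithin_le_nhds)
  · refine Tendsto.comp (Qf_continuousOn a β E hE (t * Complex.I) ?_) (tendsto_eps t)
    simp

lemma Rf_bound (hE : IntegrableOn E (Ioi 0)) (hinj : Function.Injective a)
    (hc : ∀ i, |(β i * (1 + a i * Complex.I)).re| < 1) (τ : ℝ) (hτ : |τ| = 1) (T : ℝ) :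
    ∃ g : ℝ → ℝ, IntegrableOn g (Icc (-T) T) ∧ ∀ ε : ℝ, 0 < ε → ε ≤ 1 → ∀ t ∈ Icc (-T) T,
      (∀ i, t ≠ a i) → ‖Rf a β E τ (ε + t * Complex.I)‖ ≤ g t := by
  have hθ : ∃ θ : ℝ, 0 < θ ∧ θ < 1 ∧ ∀ i, |(β i * (1 + a i * Complex.I)).re| ≤ θ := by
    have h1 : ∀ᶠ θ in 𝓝[<] (1:ℝ), ∀ i, |(β i * (1 + a i * Complex.I)).re| ≤ θ := by
      rw [eventually_all]; intro i
      filter_upwards [Ioo_mem_nhdsLT (hc i)] with θ hθ using hθ.1.le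
    obtain ⟨θ, h, h'⟩ := (h1.and (Ioo_mem_nhdsLT (zero_lt_one (α := ℝ)))).exists
    exact ⟨θ, h'.1, h'.2, h⟩
  obtain ⟨θ, hθ0, hθ1, hθ⟩ := hθ
  obtain ⟨K, hK0, hK⟩ := prod_sing hinj hθ0
  -- bound for Q
  obtain ⟨CQ, hCQ⟩ : ∃ CQ, ∀ z ∈ Icc (0:ℝ) 1 ×ℂ Icc (-T) T, ‖Qf a β E z‖ ≤ CQ := by
    refine IsCompact.exists_bound_of_continuousOn (isCompact_Icc.reProdIm isCompact_Icc) ?_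
    exact (Qf_continuousOn a β E hE).mono fun z hz => hz.1.1
  let c : ι → ℂ := fun i => τ * (β i * (1 + a i * Complex.I))
  let Ki : ι → ℝ := fun i => Real.exp (2 * Real.pi * |(c i).im| + (2 + (T + |a i|)))
  refine ⟨fun t => Real.exp CQ * ((∏ i, Ki i) * (K * (1 + ∑ i, |t - a i| ^ (-θ)))), ?_, ?_⟩
  · refine Integrable.const_mul (Integrable.const_mul (Integrable.const_mul ?_ _) _) _
    refine Integrable.add (by simp) ?_
    exact integrable_finsetSum _ fun i _ => integrableOn_abs_sub_rpow (by linarith) (a i) T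
  · intro ε hε hε1 t ht hta
    have hQ : ‖Complex.exp (τ * Qf a β E (ε + t * Complex.I))‖ ≤ Real.exp CQ := by
      rw [Complex.norm_exp]
      apply Real.exp_le_exp.mpr
      refine (Complex.re_le_norm _).trans ?_
      rw [norm_mul, Complex.norm_real, Real.norm_eq_abs, hτ, one_mul]
      apply hCQ
      rw [Complex.mem_reProdIm]
      constructor
      · simpa using ⟨hε.le, hε1⟩
      · simpa using ht
    have hS : ‖Complex.exp (τ * Sf a β (ε + t * Complex.I))‖
        ≤ (∏ i, Ki i) * (K * (1 + ∑ i, |t - a i| ^ (-θ))) := by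
      rw [Sf, Finset.mul_sum, Complex.exp_sum, norm_prod]
      calc _ ≤ ∏ i, (Ki i * |t - a i| ^ (-θ)) := by
            refine Finset.prod_le_prod (fun i _ => norm_nonneg _) fun i _ => ?_
            rw [← mul_assoc]
            have him : ((ε:ℂ) + t * Complex.I - a i * Complex.I).im = t - a i := by simp
            have hre : ((ε:ℂ) + t * Complex.I - a i * Complex.I).re = ε := by simp
            have := norm_exp_log_diff (c := c i) (z := (ε:ℂ) + t * Complex.I - a i * Complex.I)
              (θ := θ) (by rw [hre]; exact hε) (by rw [hre]; exact hε1)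
              (by rw [him]; exact sub_ne_zero.mpr (hta i)) ?_ hθ1.le
            · refine this.trans ?_
              rw [him]
              refine mul_le_mul_of_nonneg_right ?_ (Real.rpow_nonneg (abs_nonneg _) _)
              apply Real.exp_le_exp.mpr
              have h1 : |t - a i| ≤ |t| + |a i| := abs_sub _ _
              have h2 : |t| ≤ T := abs_le.mpr ht
              linarith
            · simp only [c]
              rw [Complex.re_ofReal_mul, abs_mul, hτ, one_mul]
              exact hθ i
        _ = (∏ i, Ki i) * ∏ i, |t - a i| ^ (-θ) := Finset.prod_mul_distrib
        _ ≤ _ := mul_le_mul_of_nonneg_left (hK t)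
            (Finset.prod_nonneg fun i _ => (Real.exp_pos _).le)
    rw [Rf, mul_add, Complex.exp_add, norm_mul, mul_comm]
    exact mul_le_mul hQ hS (norm_nonneg _) (Real.exp_pos _).le

end



/-- Laplace transform of a step function. -/
lemma laplace_step {σ : Type*} [Countable σ] {l : σ → ℝ} {c : σ → ℂ} (hl : ∀ q, 0 ≤ l q) {s : ℂ}
    (hs : 0 < s.re) (hsum : Summable fun q => ‖c q‖ * Real.exp (-s.re * l q)) {f : ℝ → ℂ}
    (hf : ∀ v, 0 < v → HasSum (fun q => if l q ≤ v then c q else 0) (f v)) :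
    ∫ v in Ioi (0:ℝ), f v * Complex.exp (-s * v) = (∑' q, c q * Complex.exp (-s * l q)) / s := by
  have hs0 : s ≠ 0 := by intro h; simp [h] at hs
  let F : σ → ℝ → ℂ := fun q v => (Ici (l q)).indicator (fun v => c q * Complex.exp (-s * v)) v
  have hioi : ∀ q, IntegrableOn (fun v : ℝ => c q * Complex.exp (-s * v)) (Ici (l q)) := by
    intro q
    rw [integrableOn_Ici_iff_integrableOn_Ioi]
    exact (integrableOn_exp_neg_mul hs _).const_mul _
  have hFi : ∀ q, Integrable (F q) (volume.restrict (Ioi 0)) := by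
    intro q
    exact ((integrable_indicator_iff measurableSet_Ici).mpr (hioi q)).integrableOn
  have hset : ∀ (q : σ) (g : ℝ → ℂ), ∫ v in Ioi (0:ℝ), (Ici (l q)).indicator g v = ∫ v in Ioi (l q), g v := by
    intro q g
    rw [setIntegral_indicator measurableSet_Ici, ← integral_Ici_eq_integral_Ioi (x := l q)]
    rw [Set.inter_comm, ← integral_indicator (measurableSet_Ici.inter measurableSet_Ioi), ← integral_indicator measurableSet_Ici]
    refine integral_congr_ae ?_
    have : ∀ᵐ v : ℝ, v ≠ 0 := Measure.ae_ne volume 0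
    filter_upwards [this] with v hv
    by_cases h : l q ≤ v
    · have : 0 < v := lt_of_le_of_ne ((hl q).trans h) (Ne.symm hv)
      simp [indicator, h, this]
    · simp [indicator, h]
  have hInt0 : ∀ q, ∫ v in Ioi (0:ℝ), F q v = c q * Complex.exp (-s * l q) / s := by
    intro q
    rw [hset, integral_const_mul, integral_exp_mul_complex_Ioi (by simpa using hs)]
    field_simp
  have hnorm : ∀ q, ∫ v in Ioi (0:ℝ), ‖F q v‖ = ‖c q‖ * Real.exp (-s.re * l q) / s.re := by
    intro q
    have h1 : ∀ v, ‖F q v‖ = (Ici (l q)).indicator (fun v => ‖c q‖ * Real.exp (-s.re * v)) v := by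
      intro v
      simp only [F, norm_indicator_eq_indicator_norm, norm_mul, norm_exp_neg_mul]
    have h2 : ((∫ v in Ioi (0:ℝ), ‖F q v‖ : ℝ) : ℂ) = ‖c q‖ * Real.exp (-s.re * l q) / s.re := by
      rw [← integral_complex_ofReal]
      have : ∀ v, ((‖F q v‖ : ℝ) : ℂ) = (Ici (l q)).indicator (fun v : ℝ => (‖c q‖ : ℂ) * Complex.exp (-(s.re:ℂ) * v)) v := by
        intro v
        rw [h1]; simp only [indicator]; split_ifs <;> simp
      simp_rw [this]
      have hr : (s.re : ℂ) ≠ 0 := by exact_mod_cast hs.ne'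
      rw [hset, integral_const_mul, integral_exp_mul_complex_Ioi (by simpa using hs)]
      push_cast; field_simp
    exact_mod_cast h2
  have key := hasSum_integral_of_summable_integral_norm hFi (by
    simp_rw [hnorm]; exact hsum.div_const _)
  rw [← tsum_div_const]
  simp_rw [← hInt0]
  rw [key.tsum_eq]
  refine setIntegral_congr_fun measurableSet_Ioi fun v hv => ?_
  have := (hf v hv).mul_right (Complex.exp (-s * v))
  rw [← this.tsum_eq]
  refine tsum_congr fun q => ?_
  simp only [F, indicator, mem_Ici]
  split_ifs <;> simp

/-- partial converse: summability from integrability. -/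
lemma summable_of_laplace {σ : Type*} {l : σ → ℝ} {c : σ → ℝ} (hl : ∀ q, 0 ≤ l q)
    (hc : ∀ q, 0 ≤ c q) {s : ℝ} (hs : 0 < s) {f : ℝ → ℝ}
    (hf : ∀ v, 0 < v → HasSum (fun q => if l q ≤ v then c q else 0) (f v))
    (hi : IntegrableOn (fun v => f v * Real.exp (-s * v)) (Ioi 0)) :
    Summable fun q => c q * Real.exp (-s * l q) := by
  have hI : ∀ q, IntegrableOn (fun v : ℝ => (Ici (l q)).indicator (fun v => c q * Real.exp (-s * v)) v) (Ioi 0) := by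
    intro q
    refine ((integrable_indicator_iff measurableSet_Ici).mpr ?_).integrableOn
    rw [integrableOn_Ici_iff_integrableOn_Ioi]
    exact (exp_neg_integrableOn_Ioi _ hs).const_mul _
  have hInt0 : ∀ q, c q * Real.exp (-s * l q) / s =
      ∫ v in Ioi (0:ℝ), (Ici (l q)).indicator (fun v => c q * Real.exp (-s * v)) v := by
    intro q
    rw [setIntegral_indicator measurableSet_Ici]
    have : ∫ v in Ioi 0 ∩ Ici (l q), c q * Real.exp (-s * v) = ∫ v in Ioi (l q), c q * Real.exp (-s * v) := by
      refine setIntegral_congr_set ?_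
      have : ∀ᵐ v : ℝ, v ≠ l q := Measure.ae_ne volume _
      filter_upwards [this] with v hv
      refine propext ⟨fun h => lt_of_le_of_ne h.2 (Ne.symm hv), fun h => ⟨lt_of_le_of_lt (hl q) h, le_of_lt h⟩⟩
    rw [this, integral_const_mul, integral_exp_mul_Ioi (by linarith)]
    field_simp
  suffices h : Summable fun q => c q * Real.exp (-s * l q) / s by
    have := h.mul_right s
    refine this.congr fun q => ?_
    field_simp
  refine summable_of_sum_le (c := ∫ v in Ioi (0:ℝ), f v * Real.exp (-s * v)) (fun q => ?_) fun u => ?_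
  · have := hc q; positivity
  · simp_rw [hInt0]
    rw [← integral_finsetSum _ fun q _ => hI q]
    refine setIntegral_mono_on (integrable_finsetSum _ fun q _ => hI q) hi measurableSet_Ioi fun v hv => ?_
    have := sum_le_hasSum u (fun q _ => by split_ifs; exacts [hc q, le_rfl]) (hf v hv)
    refine le_trans (le_of_eq ?_) (mul_le_mul_of_nonneg_right this (Real.exp_pos _).le)
    rw [Finset.sum_mul]
    refine Finset.sum_congr rfl fun q _ => ?_
    simp only [indicator, mem_Ici]
    split_ifs <;> simp



/-- logarithms of the primes -/
noncomputable def Lpr (p : ℕ → ℝ) (k : ℕ) : ℝ := Real.log (p k)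

/-- logarithms of prime powers `p_k^(j+1)`. -/
noncomputable def Lq (p : ℕ → ℝ) (q : ℕ × ℕ) : ℝ := ((q.1 : ℝ) + 1) * Lpr p q.2

section
variable {p : ℕ → ℝ} (hmono : Monotone p) (hp1 : 1 < p 0) (hptop : Tendsto p atTop atTop)

include hmono hp1

lemma p_gt_one (k : ℕ) : 1 < p k := hp1.trans_le (hmono (Nat.zero_le k))

lemma Lpr_pos (k : ℕ) : 0 < Lpr p k := Real.log_pos (p_gt_one hmono hp1 k)

lemma exp_Lp (k : ℕ) : Real.exp (Lpr p k) = p k :=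
  Real.exp_log (zero_lt_one.trans (p_gt_one hmono hp1 k))

lemma Lpr_mono : Monotone (Lpr p) := fun i j h =>
  Real.log_le_log (zero_lt_one.trans (p_gt_one hmono hp1 i)) (hmono h)

lemma Lq_pos (q : ℕ × ℕ) : 0 < Lq p q := mul_pos (by positivity) (Lpr_pos hmono hp1 _)

include hptop

lemma Lpr_finite (v : ℝ) : {k | Lpr p k ≤ v}.Finite := by
  have h : Tendsto (Lpr p) atTop atTop := Real.tendsto_log_atTop.comp hptop
  have := (h.eventually_gt_atTop v)
  obtain ⟨N, hN⟩ := eventually_atTop.mp this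
  refine (Set.finite_Iio N).subset fun k hk => ?_
  by_contra hc
  exact absurd (hN k (not_lt.mp hc)) (not_lt.mpr hk)

lemma Lq_finite (v : ℝ) : {q | Lq p q ≤ v}.Finite := by
  have h0 := Lpr_pos hmono hp1 0
  obtain ⟨J, hJ⟩ := exists_nat_gt (v / Lpr p 0)
  refine ((Set.finite_Iio J).prod (Lpr_finite hmono hp1 hptop v)).subset fun q hq => ?_
  have hq : ((q.1:ℝ) + 1) * Lpr p q.2 ≤ v := hq
  have hk := Lpr_pos hmono hp1 q.2
  have hk0 : Lpr p 0 ≤ Lpr p q.2 := Lpr_mono hmono hp1 (Nat.zero_le _)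
  have hj : (0:ℝ) ≤ q.1 := Nat.cast_nonneg _
  constructor
  · have h2 : (q.1:ℝ) * Lpr p 0 ≤ v := by nlinarith
    have := (le_div_iff₀ h0).mpr h2
    exact_mod_cast this.trans_lt hJ
  · show Lpr p q.2 ≤ v
    nlinarith

lemma PiCount_hasSum (v : ℝ) :
    HasSum (fun q : ℕ × ℕ => if Lq p q ≤ v then (1:ℝ) / (q.1 + 1) else 0) (PiCount p (Real.exp v)) := by
  have hs : Summable (fun q : ℕ × ℕ => if Lq p q ≤ v then (1:ℝ) / (q.1 + 1) else 0) := by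
    refine summable_of_hasFiniteSupport ((Lq_finite hmono hp1 hptop v).subset fun q hq => ?_)
    by_contra h
    exact hq (if_neg h)
  have : PiCount p (Real.exp v) = ∑' q : ℕ × ℕ, if Lq p q ≤ v then (1:ℝ) / (q.1 + 1) else 0 := by
    rw [hs.tsum_prod]
    unfold PiCount
    refine tsum_congr fun j => ?_
    have hiff : ∀ k, p k ≤ Real.exp v ^ ((1:ℝ) / (j + 1)) ↔ Lq p (j, k) ≤ v := by
      intro k
      rw [← Real.exp_mul, ← Real.log_le_iff_le_exp (zero_lt_one.trans (p_gt_one hmono hp1 k))]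
      have : (0:ℝ) < j + 1 := by positivity
      unfold Lq Lpr
      rw [mul_one_div, le_div_iff₀ this, mul_comm]
    simp_rw [hiff]
    have hfin : {k | Lq p (j, k) ≤ v}.Finite := by
      have := (Lq_finite hmono hp1 hptop v).preimage (f := fun k => (j, k)) (fun a _ b _ h => by simpa using h)
      exact this
    rw [tsum_eq_sum (s := hfin.toFinset)]
    · rw [Finset.sum_congr rfl (g := fun _ => (1:ℝ) / (j + 1)) (by
        intro k hk
        rw [Set.Finite.mem_toFinset] at hk
        exact if_pos hk)]
      rw [Finset.sum_const, nsmul_eq_mul]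
      have : Nat.card {k // Lq p (j, k) ≤ v} = hfin.toFinset.card := by
        rw [← Set.ncard_eq_toFinset_card _ hfin]; rfl
      rw [this]; ring
    · intro k hk
      rw [Set.Finite.mem_toFinset] at hk
      exact if_neg hk
  rw [this]
  exact hs.hasSum

lemma PiCount_mono : Monotone (fun v => PiCount p (Real.exp v)) := by
  intro v w h
  refine hasSum_le (fun q => ?_) (PiCount_hasSum hmono hp1 hptop v) (PiCount_hasSum hmono hp1 hptop w)
  have : (0:ℝ) ≤ 1 / (q.1 + 1) := by positivity
  split_ifs with h1 h2
  · exact le_rfl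
  · exact absurd (h1.trans h) h2
  · exact this
  · exact le_rfl

lemma PiCount_nonneg (v : ℝ) : 0 ≤ PiCount p (Real.exp v) := by
  refine (PiCount_hasSum hmono hp1 hptop v).nonneg fun q => ?_
  split_ifs
  · positivity
  · exact le_rfl

end

section
variable {k : ℕ} (t y b : Fin k → ℝ)

/-- frequencies -/
def af : Fin k ⊕ Fin k → ℝ := Sum.elim t (fun j => -t j)
noncomputable def bf : Fin k ⊕ Fin k → ℂ :=
  Sum.elim (fun j => b j / 2 * cis (y j)) (fun j => b j / 2 * cis (-y j))

variable {t y b}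

lemma af_inj (htinj : Function.Injective t) (htpos : ∀ j, 0 < t j) : Function.Injective (af t) := by
  rintro (i | i) (j | j) h <;> simp only [af, Sum.elim_inl, Sum.elim_inr] at h
  · rw [htinj h]
  · have := htpos i; have := htpos j; linarith
  · have := htpos i; have := htpos j; linarith
  · rw [htinj (neg_injective h)]

lemma af_ne (htpos : ∀ j, 0 < t j) (i) : af t i ≠ 0 := by
  rcases i with i | i
  · exact (htpos i).ne'
  · exact (neg_neg_of_pos (htpos i)).ne

lemma cos_aux (s y : ℝ) : Real.sqrt (1 + s ^ 2) * Real.cos (y + Real.arctan s)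
    = Real.cos y - s * Real.sin y := by
  rw [Real.cos_add, Real.cos_arctan, Real.sin_arctan]
  have : Real.sqrt (1 + s ^ 2) ≠ 0 := (Real.sqrt_pos.mpr (by positivity)).ne'
  field_simp

lemma bf_cond (hcond : ∀ j, √(1 + t j ^ 2) * |b j * Real.cos (y j + Real.arctan (t j))| < 2) (i) :
    |(bf y b i * (1 + af t i * Complex.I)).re| < 1 := by
  have key : ∀ j, |b j / 2 * (Real.cos (y j) - t j * Real.sin (y j))| < 1 := by
    intro j
    have h := hcond j
    rw [← cos_aux, abs_mul, abs_mul, abs_div, abs_of_nonneg (Real.sqrt_nonneg _), abs_two]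
    rw [abs_mul] at h
    linarith
  rcases i with j | j
  · have : (bf y b (Sum.inl j) * (1 + af t (Sum.inl j) * Complex.I)).re
        = b j / 2 * (Real.cos (y j) - t j * Real.sin (y j)) := by
      simp only [bf, af, Sum.elim_inl, cis, Complex.exp_mul_I, ← Complex.ofReal_cos, ← Complex.ofReal_sin]
      simp [Complex.cos_ofReal_re, Complex.sin_ofReal_re]
      ring
    rw [this]; exact key j
  · have : (bf y b (Sum.inr j) * (1 + af t (Sum.inr j) * Complex.I)).re
        = b j / 2 * (Real.cos (y j) - t j * Real.sin (y j)) := by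
      simp only [bf, af, Sum.elim_inr, cis, Complex.exp_mul_I, ← Complex.ofReal_cos, ← Complex.ofReal_sin]
      simp [Complex.cos_ofReal_re, Complex.sin_ofReal_re]
      ring
    rw [this]; exact key j

lemma sum_cos (v : ℝ) : ((∑ j, b j * Real.cos (t j * v + y j) : ℝ) : ℂ)
    = ∑ i, bf y b i * cis (af t i * v) := by
  rw [Fintype.sum_sum_type, ← Finset.sum_add_distrib]
  push_cast
  refine Finset.sum_congr rfl fun j _ => ?_
  simp only [bf, af, Sum.elim_inl, Sum.elim_inr]
  rw [mul_assoc, mul_assoc, ← cis_add, ← cis_add, Complex.cos]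
  simp only [cis]
  push_cast
  have e1 : -((t j : ℂ) * v + y j) * Complex.I = (-(y j:ℂ) + -t j * v) * Complex.I := by ring
  have e2 : ((t j : ℂ) * v + y j) * Complex.I = ((y j:ℂ) + t j * v) * Complex.I := by ring
  rw [e1, e2]; ring

end



section
variable {p : ℕ → ℝ} (hmono : Monotone p) (hp1 : 1 < p 0) (hptop : Tendsto p atTop atTop)
  {k : ℕ} {t y b : Fin k → ℝ}

/-- model density -/
noncomputable def Md (t y b : Fin k → ℝ) (v : ℝ) : ℂ :=
  (Ioi (1:ℝ)).indicator (fun v : ℝ => (1 + ∑ i, bf y b i * cis (af t i * v)) / (v:ℂ)) v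

/-- error term -/
noncomputable def Ef (p : ℕ → ℝ) (t y b : Fin k → ℝ) (v : ℝ) : ℂ :=
  (Real.exp (-v) * PiCount p (Real.exp v) : ℝ) - Md t y b v

lemma measurable_Md : Measurable (Md t y b) := by
  unfold Md
  refine Measurable.indicator ?_ measurableSet_Ioi
  have : Continuous fun v : ℝ => (1 + ∑ i, bf y b i * cis (af t i * v)) := by
    refine continuous_const.add (continuous_finsetSum _ fun i _ => continuous_const.mul ?_)
    exact continuous_cis.comp (by fun_prop)
  exact this.measurable.div (by fun_prop)

lemma Md_integral {z : ℂ} (hz : 0 < z.re) :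
    IntegrableOn (fun v : ℝ => Md t y b v * Complex.exp (-z * v)) (Ioi 0) ∧
    ∫ v in Ioi (0:ℝ), Md t y b v * Complex.exp (-z * v)
      = Lk z + ∑ i, bf y b i * Lk (z - af t i * Complex.I) := by
  have hzi : ∀ i, 0 < (z - af t i * Complex.I).re := fun i => by simpa using hz
  have e : (fun v : ℝ => Md t y b v * Complex.exp (-z * v)) = (Ioi (1:ℝ)).indicator (fun v : ℝ =>
      Complex.exp (-z * v) / v + ∑ i, bf y b i * (Complex.exp (-(z - af t i * Complex.I) * v) / v)) := by
    funext v
    simp only [Md, indicator]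
    split_ifs with h
    · rw [add_div, add_mul, Finset.sum_div, Finset.sum_mul]
      congr 1
      · ring
      · refine Finset.sum_congr rfl fun i _ => ?_
        have : Complex.exp (-(z - af t i * Complex.I) * v) = cis (af t i * v) * Complex.exp (-z * v) := by
          rw [cis, ← Complex.exp_add]; congr 1; push_cast; ring
        rw [this]; ring
    · simp
  have hi2 : IntegrableOn (fun v : ℝ => ∑ i, bf y b i * (Complex.exp (-(z - af t i * Complex.I) * v) / v)) (Ioi 1) :=
    integrable_finsetSum _ fun i _ => (integrableOn_Lk (hzi i)).const_mul _
  have hi : IntegrableOn (fun v : ℝ =>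
      Complex.exp (-z * v) / v + ∑ i, bf y b i * (Complex.exp (-(z - af t i * Complex.I) * v) / v)) (Ioi 1) :=
    (integrableOn_Lk hz).add hi2
  rw [e]
  constructor
  · exact ((integrable_indicator_iff measurableSet_Ioi).mpr hi).integrableOn
  · rw [setIntegral_indicator measurableSet_Ioi, inter_eq_self_of_subset_right (Ioi_subset_Ioi zero_le_one),
      integral_add (integrableOn_Lk hz) hi2, integral_finsetSum _ fun i _ => (integrableOn_Lk (hzi i)).const_mul _]
    simp_rw [integral_const_mul]
    rfl

include hmono hp1 hptop

lemma Ef_integrable (hL1 : ∫⁻ x in Set.Ici (2:ℝ), ENNReal.ofReal (|PiCount p x - x / Real.log x *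
      (1 + ∑ j, b j * Real.cos (t j * Real.log x + y j))| / x ^ 2) < ⊤) :
    IntegrableOn (Ef p t y b) (Ioi 0) := by
  have hPm : Measurable fun v => PiCount p (Real.exp v) := (PiCount_mono hmono hp1 hptop).measurable
  have hEm : Measurable (Ef p t y b) := by
    unfold Ef
    refine Measurable.sub (Complex.measurable_ofReal.comp (Measurable.mul (by fun_prop) hPm)) measurable_Md
  rw [← Ioc_union_Ioi_eq_Ioi (zero_le_one (α := ℝ)), integrableOn_union]
  constructor
  · refine Measure.integrableOn_of_bounded (M := PiCount p (Real.exp 1)) (by simp) hEm.aestronglyMeasurable ?_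
    filter_upwards [ae_restrict_mem measurableSet_Ioc] with v hv
    have : Md t y b v = 0 := indicator_of_notMem (by simpa using hv.2) _
    rw [Ef, this, sub_zero, Complex.norm_real, norm_mul, Real.norm_of_nonneg (Real.exp_pos _).le,
      Real.norm_of_nonneg (PiCount_nonneg hmono hp1 hptop v)]
    have h1 : Real.exp (-v) ≤ 1 := by rw [Real.exp_le_one_iff]; linarith [hv.1]
    have h2 := PiCount_mono hmono hp1 hptop hv.2
    have h3 := PiCount_nonneg hmono hp1 hptop v
    simp only at h2
    calc _ ≤ 1 * PiCount p (Real.exp v) := mul_le_mul_of_nonneg_right h1 h3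
      _ ≤ _ := by rw [one_mul]; exact h2
  · refine ⟨hEm.aestronglyMeasurable, ?_⟩
    unfold HasFiniteIntegral
    refine lt_of_le_of_lt ?_ hL1
    have himg : Real.exp '' Ioi 1 ⊆ Ici 2 := by
      rintro _ ⟨v, hv, rfl⟩
      have := Real.add_one_le_exp v
      have hv : 1 < v := hv
      show 2 ≤ Real.exp v
      linarith
    refine le_trans ?_ (lintegral_mono_set himg)
    rw [lintegral_image_eq_lintegral_abs_deriv_mul measurableSet_Ioi
      (fun v _ => (Real.hasDerivAt_exp v).hasDerivWithinAt) Real.exp_injective.injOn]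
    refine setLIntegral_mono_ae' measurableSet_Ioi (ae_of_all _ fun v hv => ?_)
    rw [← ENNReal.ofReal_mul (abs_nonneg _), ← ofReal_norm]
    refine ENNReal.ofReal_le_ofReal (le_of_eq ?_)
    have hv0 : (v:ℂ) ≠ 0 := by
      have : (1:ℝ) < v := hv
      exact_mod_cast (by linarith : v ≠ 0)
    have : Ef p t y b v = ((Real.exp (-v) * (PiCount p (Real.exp v) - Real.exp v / Real.log (Real.exp v) *
      (1 + ∑ j, b j * Real.cos (t j * Real.log (Real.exp v) + y j))) : ℝ) : ℂ) := by
      rw [Ef, Md, indicator_of_mem hv, ← sum_cos, Real.log_exp]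
      have h : Real.exp (-v) * (Real.exp v / v) = 1 / v := by
        rw [← mul_div_assoc, ← Real.exp_add]; simp
      rw [mul_sub, ← mul_assoc, h]
      push_cast
      ring
    rw [this, Complex.norm_real, norm_mul, Real.norm_eq_abs, Real.norm_eq_abs, Real.abs_exp, Real.abs_exp,
      Real.exp_neg]
    have := Real.exp_pos v
    field_simp

variable (hE : IntegrableOn (Ef p t y b) (Ioi 0))
include hE

lemma Pi_laplace {z : ℂ} (hz : 0 < z.re) :
    IntegrableOn (fun v : ℝ => (PiCount p (Real.exp v) : ℂ) * Complex.exp (-(1 + z) * v)) (Ioi 0) ∧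
    ∫ v in Ioi (0:ℝ), (PiCount p (Real.exp v) : ℂ) * Complex.exp (-(1 + z) * v)
      = Lk z + ∑ i, bf y b i * Lk (z - af t i * Complex.I) + Lap (Ef p t y b) z := by
  have e : ∀ v : ℝ, (PiCount p (Real.exp v) : ℂ) * Complex.exp (-(1 + z) * v) =
      Md t y b v * Complex.exp (-z * v) + Ef p t y b v * Complex.exp (-z * v) := by
    intro v
    have : Complex.exp (-(1 + z) * v) = Complex.exp (-v) * Complex.exp (-z * v) := by
      rw [← Complex.exp_add]; congr 1; ring
    rw [this, Ef]; push_cast; ring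
  simp_rw [e]
  obtain ⟨h1, h2⟩ := Md_integral (t := t) (y := y) (b := b) hz
  have h3 := Lap_integrable hE hz.le
  exact ⟨h1.add h3, by rw [integral_add h1 h3, h2]; rfl⟩

lemma summable_q {ε : ℝ} (hε : 0 < ε) :
    Summable fun q : ℕ × ℕ => (1:ℝ) / (q.1 + 1) * Real.exp (-(1 + ε) * Lq p q) := by
  refine summable_of_laplace (fun q => (Lq_pos hmono hp1 q).le) (fun q => by positivity) (by linarith)
    (fun v _ => PiCount_hasSum hmono hp1 hptop v) ?_
  have := (Pi_laplace hmono hp1 hptop hE (z := ε) (by simpa using hε)).1.re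
  refine this.congr (ae_of_all _ fun v => ?_)
  have : ((PiCount p (Real.exp v) : ℂ) * Complex.exp (-(1 + (ε:ℂ)) * v))
    = ((PiCount p (Real.exp v) * Real.exp (-(1 + ε) * v) : ℝ) : ℂ) := by push_cast; rfl
  show (((PiCount p (Real.exp v) : ℂ) * Complex.exp (-(1 + (ε:ℂ)) * v))).re = _
  rw [this, Complex.ofReal_re]

lemma H_eq {z : ℂ} (hz : 0 < z.re) :
    HasSum (fun q : ℕ × ℕ => (1:ℂ) / (q.1 + 1) * Complex.exp (-(1 + z) * Lq p q))
      (Hf (af t) (bf y b) (Ef p t y b) z) := by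
  have hn : ∀ q : ℕ × ℕ, ‖(1:ℂ) / (q.1 + 1)‖ = 1 / (q.1 + 1) := by
    intro q
    have : (1:ℂ) / (q.1 + 1) = ((1 / ((q.1:ℝ) + 1) : ℝ) : ℂ) := by push_cast; rfl
    rw [this, Complex.norm_real, Real.norm_of_nonneg (by positivity)]
  have hS : Summable (fun q : ℕ × ℕ => ‖(1:ℂ) / (q.1 + 1)‖ * Real.exp (-(1 + z).re * Lq p q)) := by
    simp_rw [hn]
    simpa using summable_q hmono hp1 hptop hE hz
  have h := laplace_step (s := 1 + z) (c := fun q : ℕ × ℕ => (1:ℂ) / (q.1 + 1)) (l := Lq p)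
    (f := fun v => (PiCount p (Real.exp v) : ℂ))
    (fun q => (Lq_pos hmono hp1 q).le) (by simp; linarith) hS (by
      intro v _
      have := (PiCount_hasSum hmono hp1 hptop v).mapL Complex.ofRealCLM
      convert this using 1
      · funext q
        split_ifs <;> simp
      · rfl)
  rw [(Pi_laplace hmono hp1 hptop hE hz).2, eq_div_iff (by
    intro h; have := congrArg Complex.re h; simp at this; linarith)] at h
  have hs : Summable (fun q : ℕ × ℕ => (1:ℂ) / (q.1 + 1) * Complex.exp (-(1 + z) * Lq p q)) := by
    refine Summable.of_norm (hS.congr fun q => ?_)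
    rw [norm_mul, norm_exp_neg_mul]
  have h2 := hs.hasSum
  rw [← h] at h2
  rwa [Hf, mul_comm]
end



/-- log of a squarefree generalized integer -/
noncomputable def lS (p : ℕ → ℝ) (S : Finset ℕ) : ℝ := ∑ k ∈ S, Lpr p k

noncomputable def sg (S : Finset ℕ) : ℝ := (-1) ^ S.card

lemma abs_sg (S : Finset ℕ) : |sg S| = 1 := by simp [sg, abs_pow]

noncomputable def Vf (p : ℕ → ℝ) (z : ℂ) : ℂ :=
  ∑' S : Finset ℕ, (sg S : ℂ) * Complex.exp (-(2 * (1 + z)) * lS p S)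

lemma prod_exp_lS (p : ℕ → ℝ) (s : ℂ) (S : Finset ℕ) :
    ∏ k ∈ S, Complex.exp (-s * Lpr p k) = Complex.exp (-s * lS p S) := by
  rw [← Complex.exp_sum, lS, Complex.ofReal_sum, Finset.mul_sum]

lemma prod_neg_exp_lS (p : ℕ → ℝ) (s : ℂ) (S : Finset ℕ) :
    ∏ k ∈ S, -Complex.exp (-s * Lpr p k) = (sg S : ℂ) * Complex.exp (-s * lS p S) := by
  rw [Finset.prod_neg, prod_exp_lS, sg]; push_cast; rfl

section
variable {p : ℕ → ℝ} (hmono : Monotone p) (hp1 : 1 < p 0) (hptop : Tendsto p atTop atTop)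
  {k : ℕ} {t y b : Fin k → ℝ}

include hmono hp1

lemma lS_nonneg (S : Finset ℕ) : 0 ≤ lS p S :=
  Finset.sum_nonneg fun k _ => (Lpr_pos hmono hp1 k).le

include hptop

lemma lS_finite (u : ℝ) : {S | lS p S ≤ u}.Finite := by
  have hf := Lpr_finite hmono hp1 hptop u
  refine (hf.toFinset.powerset.finite_toSet).subset fun S hS => ?_
  simp only [Finset.coe_powerset, mem_preimage, mem_powerset_iff]
  intro k hk
  have : Lpr p k ≤ lS p S :=
    Finset.single_le_sum (f := Lpr p) (fun k _ => (Lpr_pos hmono hp1 k).le) hk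
  have hS : lS p S ≤ u := hS
  simpa using this.trans hS

variable (hE : IntegrableOn (Ef p t y b) (Ioi 0))
include hE

lemma summable_p {ε : ℝ} (hε : 0 < ε) : Summable fun k => Real.exp (-(1 + ε) * Lpr p k) := by
  have := (summable_q hmono hp1 hptop hE hε).comp_injective (i := fun k : ℕ => ((0, k) : ℕ × ℕ))
    (fun a b h => by simpa using h)
  refine this.congr fun k => ?_
  simp [Lq]

lemma summable_pc {s : ℂ} (hs : 1 < s.re) : Summable fun k => ‖Complex.exp (-s * Lpr p k)‖ := by
  simp_rw [norm_exp_neg_mul]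
  have := summable_p hmono hp1 hptop hE (ε := s.re - 1) (by linarith)
  simpa using this

lemma summable_S {s : ℝ} (hs : 1 < s) : Summable fun S => Real.exp (-s * lS p S) := by
  have h := summable_pc hmono hp1 hptop hE (s := s) (by simpa using hs)
  have := summable_finsetProd_of_summable_nonneg (fun _ ↦ norm_nonneg _) h
  refine this.congr fun S => ?_
  rw [← norm_prod, prod_exp_lS, norm_exp_neg_mul]; simp

lemma norm_p_lt {s : ℂ} (hs : 0 < s.re) (k : ℕ) : ‖Complex.exp (-s * Lpr p k)‖ < 1 := by
  rw [norm_exp_neg_mul, Real.exp_lt_one_iff]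
  have := mul_pos hs (Lpr_pos hmono hp1 k)
  linarith

lemma hasSum_log {z : ℂ} (hz : 0 < z.re) :
    HasSum (fun k => -Complex.log (1 - Complex.exp (-(1 + z) * Lpr p k)))
      (Hf (af t) (bf y b) (Ef p t y b) z) := by
  have h := H_eq hmono hp1 hptop hE hz
  have h2 : HasSum (fun q : ℕ × ℕ => (1:ℂ) / (q.2 + 1) * Complex.exp (-(1 + z) * Lq p q.swap))
      (Hf (af t) (bf y b) (Ef p t y b) z) := (Equiv.prodComm ℕ ℕ).hasSum_iff.mpr h
  refine h2.prod_fiberwise fun k => ?_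
  have := Complex.hasSum_taylorSeries_neg_log' (norm_p_lt hmono hp1 hptop hE (s := 1 + z) (by simp; linarith) k)
  refine this.congr_fun fun j => ?_
  rw [← Complex.exp_nat_mul]
  simp only [Lq, Prod.swap]
  push_cast
  rw [one_div_mul_eq_div]
  congr 2
  ring

lemma W_eq {z : ℂ} (hz : 0 < z.re) :
    HasSum (fun S => (sg S : ℂ) * Complex.exp (-(1 + z) * lS p S))
      (Complex.exp (-Hf (af t) (bf y b) (Ef p t y b) z)) := by
  have hs := summable_pc hmono hp1 hptop hE (s := 1 + z) (by simpa using hz)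
  have h1 : Summable (fun S : Finset ℕ => ∏ k ∈ S, -Complex.exp (-(1 + z) * Lpr p k)) :=
    summable_finsetProd_of_summable_norm (by simpa using hs)
  have h2 := hasProd_one_add_of_hasSum_prod h1.hasSum
  have h3 : HasProd (fun k => 1 + -Complex.exp (-(1 + z) * Lpr p k))
      (Complex.exp (-Hf (af t) (bf y b) (Ef p t y b) z)) := by
    have := (hasSum_log hmono hp1 hptop hE hz).neg
    have := Tendsto.congr (fun s => Complex.exp_sum s _) ((Complex.continuous_exp.tendsto _).comp this)
    refine Tendsto.congr (fun s => Finset.prod_congr rfl fun k _ => ?_) this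
    have hne : 1 - Complex.exp (-(1 + z) * Lpr p k) ≠ 0 := by
      have := norm_p_lt hmono hp1 hptop hE (s := 1 + z) (by simp; linarith) k
      intro h
      rw [← sub_eq_zero.mp h] at this
      simp at this
    rw [neg_neg, Complex.exp_log hne, sub_eq_add_neg]
  have := h1.hasSum
  rw [h2.unique h3] at this
  simpa only [prod_neg_exp_lS] using this

lemma Z_eq {z : ℂ} (hz : 0 < z.re) :
    HasSum (fun S => Complex.exp (-(1 + z) * lS p S))
      (Vf p z * Complex.exp (Hf (af t) (bf y b) (Ef p t y b) z)) := by
  have hs := summable_pc hmono hp1 hptop hE (s := 1 + z) (by simpa using hz)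
  have hs2 := summable_pc hmono hp1 hptop hE (s := 2 * (1 + z)) (by simp; linarith)
  have h1 : Summable (fun S : Finset ℕ => ∏ k ∈ S, Complex.exp (-(1 + z) * Lpr p k)) :=
    summable_finsetProd_of_summable_norm hs
  have hV : Summable (fun S : Finset ℕ => ∏ k ∈ S, -Complex.exp (-(2 * (1 + z)) * Lpr p k)) :=
    summable_finsetProd_of_summable_norm (by simpa using hs2)
  have h2 := hasProd_one_add_of_hasSum_prod h1.hasSum
  have hV2 := hasProd_one_add_of_hasSum_prod hV.hasSum
  have hVe : ∑' S : Finset ℕ, ∏ k ∈ S, -Complex.exp (-(2 * (1 + z)) * Lpr p k) = Vf p z := by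
    simp only [prod_neg_exp_lS]; rfl
  rw [hVe] at hV2
  have h3 : HasProd (fun k => 1 + Complex.exp (-(1 + z) * Lpr p k))
      (Vf p z * Complex.exp (Hf (af t) (bf y b) (Ef p t y b) z)) := by
    have := hasSum_log hmono hp1 hptop hE hz
    have := Tendsto.congr (fun s => Complex.exp_sum s _) ((Complex.continuous_exp.tendsto _).comp this)
    have := HasProd.mul hV2 this
    refine Tendsto.congr (fun s => Finset.prod_congr rfl fun k _ => ?_) this
    have hne : 1 - Complex.exp (-(1 + z) * Lpr p k) ≠ 0 := by
      have := norm_p_lt hmono hp1 hptop hE (s := 1 + z) (by simp; linarith) k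
      intro h
      rw [← sub_eq_zero.mp h] at this
      simp at this
    have e : Complex.exp (-(2 * (1 + z)) * Lpr p k) = Complex.exp (-(1 + z) * Lpr p k) ^ 2 := by
      rw [← Complex.exp_nat_mul]; congr 1; push_cast; ring
    simp only
    rw [Complex.exp_neg, Complex.exp_log hne, e]
    generalize Complex.exp (-(1 + z) * Lpr p k) = X at hne ⊢
    rw [← div_eq_mul_inv, div_eq_iff hne]
    ring
  have := h1.hasSum
  rw [h2.unique h3] at this
  simpa only [prod_exp_lS] using this

lemma norm_V_term {z : ℂ} (hz : 0 ≤ z.re) (S : Finset ℕ) :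
    ‖(sg S : ℂ) * Complex.exp (-(2 * (1 + z)) * lS p S)‖ ≤ Real.exp (-2 * lS p S) := by
  rw [norm_mul, Complex.norm_real, Real.norm_eq_abs, abs_sg, one_mul, norm_exp_neg_mul]
  apply Real.exp_le_exp.mpr
  have := mul_nonneg hz (lS_nonneg hmono hp1 S)
  simp; linarith

lemma Vf_continuousOn : ContinuousOn (Vf p) {z | 0 ≤ z.re} := by
  unfold Vf
  refine continuousOn_tsum (u := fun S => Real.exp (-2 * lS p S)) (fun S => ?_)
    (summable_S hmono hp1 hptop hE (by norm_num)) (fun S z hz => norm_V_term hmono hp1 hptop hE hz S)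
  exact (by fun_prop : Continuous fun z : ℂ => (sg S : ℂ) * Complex.exp (-(2 * (1 + z)) * lS p S)).continuousOn

lemma Vf_bound {z : ℂ} (hz : 0 ≤ z.re) : ‖Vf p z‖ ≤ ∑' S, Real.exp (-2 * lS p S) :=
  tsum_of_norm_bounded (summable_S hmono hp1 hptop hE (by norm_num)).hasSum
    (fun S => norm_V_term hmono hp1 hptop hE hz S)

lemma Vf_mult {z : ℂ} (hz : 0 ≤ z.re) (δ : ℝ) : Mult δ (∑' S, Real.exp (-2 * lS p S))
    (fun t : ℝ => Vf p (z + t * Complex.I)) := by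
  have hsum := summable_S hmono hp1 hptop hE (s := 2) (by norm_num)
  have hre : ∀ t : ℝ, (z + t * Complex.I).re = z.re := by intro t; simp
  have hpow : Tendsto (fun n => (Finset.range n).powerset) atTop atTop :=
    tendsto_finset_powerset_atTop_atTop.comp tendsto_finset_range
  let F : ℕ → ℝ → ℂ := fun n t => ∑ S ∈ (Finset.range n).powerset,
    (sg S : ℂ) * Complex.exp (-(2 * (1 + (z + t * Complex.I))) * lS p S)
  refine Mult.lim (G := F) (R := ∑' S, Real.exp (-2 * lS p S)) ?_ (fun n => ?_) (fun n t _ => ?_)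
    (fun t _ => ?_)
  · refine (Vf_continuousOn hmono hp1 hptop hE).comp_continuous (by fun_prop) fun t => ?_
    simpa using hz
  · have h1 : Mult δ (∑ S ∈ (Finset.range n).powerset, Real.exp (-2 * lS p S)) (F n) := by
      refine Mult.sum _ fun S _ => ?_
      refine ((Mult.char δ ((sg S : ℂ) * Complex.exp (-(2 * (1 + z)) * lS p S)) (2 * lS p S)).mono
        (norm_V_term hmono hp1 hptop hE hz S)).congr fun t => ?_
      rw [cis, mul_assoc, ← Complex.exp_add]; congr 2; push_cast; ring
    exact h1.mono (hsum.sum_le_tsum _ fun _ _ => (Real.exp_pos _).le)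
  · refine (norm_sum_le _ _).trans (le_trans (Finset.sum_le_sum fun S _ =>
      norm_V_term hmono hp1 hptop hE (by rw [hre]; exact hz) S) ?_)
    exact hsum.sum_le_tsum _ fun _ _ => (Real.exp_pos _).le
  · have hs : Summable (fun S => (sg S : ℂ) * Complex.exp (-(2 * (1 + (z + t * Complex.I))) * lS p S)) :=
      Summable.of_norm_bounded hsum fun S => norm_V_term hmono hp1 hptop hE (by rw [hre]; exact hz) S
    have := hs.hasSum
    rw [HasSum, SummationFilter.unconditional_filter] at this
    exact this.comp hpow

end

section
variable {p : ℕ → ℝ} (hmono : Monotone p) (hp1 : 1 < p 0) (hptop : Tendsto p atTop atTop)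

/-- `m` on log scale. -/
noncomputable def mtil (p : ℕ → ℝ) (u : ℝ) : ℝ :=
  ∑' S : Finset ℕ, if lS p S ≤ u then sg S * Real.exp (-lS p S) else 0

include hmono hp1

lemma nval_ind (S : Finset ℕ) : nval p (Finsupp.indicator S fun _ _ => 1) = Real.exp (lS p S) := by
  rw [nval, Finsupp.prod_of_support_subset (s := S) _ (Finsupp.support_indicator_subset _ _) _ (by simp),
    lS, Real.exp_sum]
  refine Finset.prod_congr rfl fun k hk => ?_
  rw [exp_Lp hmono hp1, Finsupp.indicator_of_mem hk, pow_one]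

include hptop

lemma mB_eq {x : ℝ} (hx : 0 < x) : mB p x = mtil p (Real.log x) := by
  have e1 : mB p x = ∑' α : ℕ →₀ ℕ, (if nval p α ≤ x then muB α / nval p α else 0) := by
    unfold mB
    refine (tsum_subtype {α : ℕ →₀ ℕ | nval p α ≤ x} (fun α => muB α / nval p α)).trans ?_
    refine tsum_congr fun α => ?_
    simp only [indicator, mem_setOf_eq]
  let i : Finset ℕ → (ℕ →₀ ℕ) := fun S => Finsupp.indicator S fun _ _ => 1
  have hsupp : ∀ S, (i S).support = S := by
    intro S; ext k; simp [i, Finsupp.indicator_apply]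
  have hi : Function.Injective i := fun S T h => by rw [← hsupp S, h, hsupp T]
  rw [e1, mtil, ← hi.tsum_eq]
  · refine tsum_congr fun S => ?_
    rw [show nval p (i S) = _ from nval_ind hmono hp1 S]
    simp only [← Real.le_log_iff_exp_le hx]
    split_ifs with h
    · have : muB (i S) = sg S := by
        rw [muB, if_pos, hsupp, sg]
        intro k
        simp only [i, Finsupp.indicator_apply]
        split_ifs <;> simp
      rw [this, Real.exp_neg, div_eq_mul_inv]
    · rfl
  · intro α hα
    have h1 : ∀ k, α k ≤ 1 := by
      by_contra hc
      apply hα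
      simp [muB, hc]
    refine ⟨α.support, ?_⟩
    ext k
    simp only [i, Finsupp.indicator_apply, Finsupp.mem_support_iff]
    have := h1 k
    split_ifs <;> omega

end



/-- Fejer tent -/
noncomputable def tent (r t : ℝ) : ℝ := max 0 (1 - |t| / r)

lemma tent_continuous (r : ℝ) : Continuous (tent r) := by unfold tent; fun_prop

lemma tent_nonneg (r t : ℝ) : 0 ≤ tent r t := le_max_left _ _

lemma tent_zero {r t : ℝ} (hr : 0 < r) (h : r ≤ |t|) : tent r t = 0 := by
  unfold tent
  apply max_eq_left
  have : 1 ≤ |t| / r := by rwa [le_div_iff₀ hr, one_mul]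
  linarith

lemma tent_le_one {r : ℝ} (hr : 0 < r) (t : ℝ) : tent r t ≤ 1 := by
  unfold tent
  have : 0 ≤ |t| / r := by positivity
  exact max_le zero_le_one (by linarith)

lemma one_sub_tent {r : ℝ} (t : ℝ) : 1 - tent r t ≤ |t| / r := by
  unfold tent
  have := le_max_right 0 (1 - |t| / r)
  linarith

lemma tent_supp {r : ℝ} (hr : 0 < r) : HasCompactSupport (fun t => (tent r t : ℂ)) := by
  refine HasCompactSupport.intro (isCompact_Icc (a := -r) (b := r)) fun t ht => ?_
  rw [tent_zero hr, Complex.ofReal_zero]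
  by_contra h
  exact ht (abs_le.mp (not_le.mp h).le)

lemma tent_integrable {r : ℝ} (hr : 0 < r) : Integrable (fun t => (tent r t : ℂ)) :=
  (Complex.continuous_ofReal.comp (tent_continuous r)).integrable_of_hasCompactSupport (tent_supp hr)

/-- Fejer kernel -/
noncomputable def Pk (r u : ℝ) : ℝ := (FI (fun t => (tent r t : ℂ)) u).re

lemma half_tent {r : ℝ} (hr : 0 < r) {w : ℂ} (hw : w ≠ 0) :
    ∫ t in (0:ℝ)..r, (1 - (t:ℂ) / r) * Complex.exp (w * t) =
      Complex.exp (w * r) / (r * w ^ 2) - (1 / w + 1 / (r * w ^ 2)) := by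
  have hr' : (r:ℂ) ≠ 0 := by exact_mod_cast hr.ne'
  have hd : ∀ t : ℝ, HasDerivAt (fun t : ℝ => (1 - (t:ℂ) / r) * Complex.exp (w * t) / w +
      Complex.exp (w * t) / (r * w ^ 2)) ((1 - (t:ℂ) / r) * Complex.exp (w * t)) t := by
    intro t
    have h1 : HasDerivAt (fun t : ℝ => (t:ℂ)) 1 t := Complex.ofRealCLM.hasDerivAt
    have h2 : HasDerivAt (fun t : ℝ => Complex.exp (w * t)) (Complex.exp (w * t) * (w * 1)) t :=
      (h1.const_mul w).cexp
    have h3 := (((h1.div_const (r:ℂ)).const_sub 1).mul h2).div_const w |>.add (h2.div_const ((r:ℂ) * w ^ 2))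
    refine h3.congr_deriv ?_
    field_simp
    ring
  rw [intervalIntegral.integral_eq_sub_of_hasDerivAt (fun t _ => hd t)]
  · rw [div_self hr']
    simp
  · exact Continuous.intervalIntegrable (by fun_prop) _ _

lemma FI_tent {r u : ℝ} (hr : 0 < r) (hu : u ≠ 0) :
    FI (fun t => (tent r t : ℂ)) u = (((2 - 2 * Real.cos (r * u)) / (r * u ^ 2) : ℝ) : ℂ) := by
  have h0 : FI (fun t => (tent r t : ℂ)) u = ∫ t in (-r)..r, (tent r t : ℂ) * cis (u * t) := by
    rw [FI, intervalIntegral.integral_eq_integral_of_support_subset]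
    intro t ht
    have : tent r t ≠ 0 := by
      intro h; apply ht; simp [h]
    have h : |t| < r := by
      by_contra h; exact this (tent_zero hr (not_lt.mp h))
    exact ⟨(abs_lt.mp h).1, (abs_lt.mp h).2.le⟩
  have hc : ∀ a b, IntervalIntegrable (fun t => (tent r t : ℂ) * cis (u * t)) volume a b := fun a b =>
    ((Complex.continuous_ofReal.comp (tent_continuous r)).mul (continuous_cis.comp (by fun_prop))).intervalIntegrable _ _
  have hpos : ∀ t ∈ Icc 0 r, tent r t = 1 - t / r := by
    intro t ht
    rw [tent, abs_of_nonneg ht.1]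
    apply max_eq_right
    have := (div_le_one hr).mpr ht.2
    linarith
  have hev : ∀ t, tent r (-t) = tent r t := by intro t; simp [tent]
  have hw : (u:ℂ) * Complex.I ≠ 0 := mul_ne_zero (by exact_mod_cast hu) Complex.I_ne_zero
  have hw' : -((u:ℂ) * Complex.I) ≠ 0 := neg_ne_zero.mpr hw
  have e1 : ∫ t in (0:ℝ)..r, (tent r t : ℂ) * cis (u * t) =
      ∫ t in (0:ℝ)..r, (1 - (t:ℂ) / r) * Complex.exp ((u * Complex.I) * t) := by
    refine intervalIntegral.integral_congr fun t ht => ?_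
    rw [uIcc_of_le hr.le] at ht
    simp only [hpos t ht, cis]
    push_cast; congr 2; ring
  have e2 : ∫ t in (-r)..0, (tent r t : ℂ) * cis (u * t) =
      ∫ t in (0:ℝ)..r, (1 - (t:ℂ) / r) * Complex.exp (-(u * Complex.I) * t) := by
    have := intervalIntegral.integral_comp_neg (a := 0) (b := r) (fun t => (tent r t : ℂ) * cis (u * t))
    rw [neg_zero] at this
    rw [← this]
    refine intervalIntegral.integral_congr fun t ht => ?_
    rw [uIcc_of_le hr.le] at ht
    simp only [hev, hpos t ht, cis]
    push_cast; congr 2; ring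
  rw [h0, ← intervalIntegral.integral_add_adjacent_intervals (hc _ 0) (hc 0 _), e1, e2,
    half_tent hr hw, half_tent hr hw']
  have hcos : (Real.cos (r * u) : ℂ) = (Complex.exp (u * Complex.I * r) + Complex.exp (-(u * Complex.I) * r)) / 2 := by
    push_cast
    rw [Complex.cos]
    rw [show (u:ℂ) * Complex.I * r = r * u * Complex.I by ring,
      show -((u:ℂ) * Complex.I) * r = -(r * u) * Complex.I by ring]
  have hI : ((u:ℂ) * Complex.I) ^ 2 = -u ^ 2 := by rw [mul_pow, Complex.I_sq]; ring
  have hr' : (r:ℂ) ≠ 0 := by exact_mod_cast hr.ne'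
  have hu' : (u:ℂ) ≠ 0 := by exact_mod_cast hu
  rw [Complex.ofReal_div, Complex.ofReal_sub, Complex.ofReal_mul, hcos, neg_sq, hI]
  push_cast
  field_simp
  ring

lemma FI_tent_zero {r : ℝ} : FI (fun t => (tent r t : ℂ)) 0 = ((∫ t, tent r t : ℝ) : ℂ) := by
  rw [FI, ← integral_complex_ofReal]
  refine integral_congr_ae (ae_of_all _ fun t => ?_)
  simp [cis_zero]

lemma FI_tent_eq {r : ℝ} (hr : 0 < r) (u : ℝ) : FI (fun t => (tent r t : ℂ)) u = (Pk r u : ℂ) := by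
  unfold Pk
  by_cases hu : u = 0
  · rw [hu, FI_tent_zero, Complex.ofReal_re]
  · rw [FI_tent hr hu, Complex.ofReal_re]

lemma Pk_eq {r u : ℝ} (hr : 0 < r) (hu : u ≠ 0) : Pk r u = (2 - 2 * Real.cos (r * u)) / (r * u ^ 2) := by
  unfold Pk; rw [FI_tent hr hu, Complex.ofReal_re]

lemma Pk_continuous {r : ℝ} (hr : 0 < r) : Continuous (Pk r) := by
  unfold Pk
  refine Complex.continuous_re.comp ?_
  refine continuous_of_dominated (bound := fun t => ‖(tent r t : ℂ)‖) ?_ ?_ (tent_integrable hr).norm ?_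
  · intro u; exact (integrable_mul_cis (tent_integrable hr) u).1
  · intro u; refine ae_of_all _ fun t => ?_
    rw [norm_mul, norm_cis, mul_one]
  · refine ae_of_all _ fun t => ?_
    exact continuous_const.mul (continuous_cis.comp (by fun_prop))

lemma Pk_nonneg {r : ℝ} (hr : 0 < r) (u : ℝ) : 0 ≤ Pk r u := by
  by_cases hu : u = 0
  · unfold Pk
    rw [hu, FI_tent_zero, Complex.ofReal_re]
    exact integral_nonneg fun t => tent_nonneg r t
  · rw [Pk_eq hr hu]
    have := Real.cos_le_one (r * u)
    exact div_nonneg (by linarith) (by positivity)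

lemma Pk_lower {r u : ℝ} (hr : 0 < r) (h : |r * u| ≤ 1) : r / 4 ≤ Pk r u := by
  have key : ∀ u, u ≠ 0 → |r * u| ≤ 1 → r / 4 ≤ Pk r u := by
    intro u hu h
    rw [Pk_eq hr hu, le_div_iff₀ (by positivity)]
    have h1 := Real.cos_le_one_sub_mul_cos_sq (x := r * u) (h.trans (by linarith [Real.pi_gt_three]))
    have h2 : 1 / 8 ≤ 2 / Real.pi ^ 2 := by
      rw [div_le_div_iff₀ (by norm_num) (by positivity)]
      nlinarith [Real.pi_le_four, Real.pi_pos]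
    have h3 : 1 / 8 * (r * u) ^ 2 ≤ 2 / Real.pi ^ 2 * (r * u) ^ 2 := by gcongr
    nlinarith
  by_cases hu : u = 0
  · have hc := (Pk_continuous hr).tendsto 0
    rw [hu]
    refine ge_of_tendsto (hc.mono_left (nhdsWithin_le_nhds (s := Ioi 0))) ?_
    filter_upwards [Ioo_mem_nhdsGT (show (0:ℝ) < 1 / r by positivity)] with v hv
    refine key v hv.1.ne' ?_
    rw [abs_of_pos (mul_pos hr hv.1)]
    have := (lt_div_iff₀ hr).mp hv.2
    linarith
  · exact key u hu h

lemma Pk_integrable {r : ℝ} (hr : 0 < r) : Integrable (Pk r) := by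
  have hb : ∀ u, Pk r u ≤ ∫ t, ‖(tent r t : ℂ)‖ := fun u =>
    (Complex.re_le_norm _).trans (norm_FI_le u)
  set B := ∫ t, ‖(tent r t : ℂ)‖
  have hB : 0 ≤ B := integral_nonneg fun _ => norm_nonneg _
  refine Integrable.mono' (g := fun u => (2 * B + 8 / r) * (1 + u ^ 2)⁻¹) (integrable_inv_one_add_sq.const_mul _)
    (Pk_continuous hr).aestronglyMeasurable (ae_of_all _ fun u => ?_)
  rw [Real.norm_of_nonneg (Pk_nonneg hr u), ← div_eq_mul_inv, le_div_iff₀ (by positivity)]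
  have h8 : 0 < 8 / r := by positivity
  have hP := Pk_nonneg hr u
  by_cases h : |u| ≤ 1
  · have : u ^ 2 ≤ 1 := by rwa [sq_le_one_iff_abs_le_one]
    nlinarith [hb u]
  · have h1 : 1 ≤ u ^ 2 := by rw [one_le_sq_iff_one_le_abs]; linarith
    have hu : u ≠ 0 := by intro h0; simp [h0] at h
    have h2 : Pk r u * u ^ 2 ≤ 4 / r := by
      rw [Pk_eq hr hu, div_mul_eq_mul_div, div_le_div_iff₀ (by positivity) hr]
      have := Real.neg_one_le_cos (r * u)
      have hx : 0 ≤ u ^ 2 * r := by positivity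
      nlinarith
    have h3 : 8 / r = 2 * (4 / r) := by ring
    nlinarith



lemma cis_sub_mul (u v t : ℝ) : cis ((u - v) * t) = cis (u * t) * Complex.exp (-(t * Complex.I) * v) := by
  simp only [cis]
  rw [← Complex.exp_add]; congr 1; push_cast; ring

lemma FI_Lap_conv {f w : ℝ → ℂ} (hf : Integrable f) (hw : IntegrableOn w (Ioi 0)) (u : ℝ) :
    FI (fun t => Lap w (t * Complex.I) * f t) u = ∫ v in Ioi (0:ℝ), w v * FI f (u - v) := by
  have e : ∀ t : ℝ, Lap w (t * Complex.I) * f t * cis (u * t) =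
      ∫ v in Ioi (0:ℝ), f t * w v * cis ((u - v) * t) := by
    intro t
    rw [Lap, mul_assoc, ← integral_mul_const]
    refine integral_congr_ae (ae_of_all _ fun v => ?_)
    simp only [cis_sub_mul]; ring
  unfold FI
  simp_rw [e]
  rw [integral_integral_swap]
  · refine integral_congr_ae (ae_of_all _ fun v => ?_)
    simp only
    rw [← integral_const_mul]
    refine integral_congr_ae (ae_of_all _ fun t => ?_)
    simp only; ring
  · refine Integrable.mul_bdd (c := 1) (hf.mul_prod hw) ?_ (ae_of_all _ fun q => ?_)
    · refine Continuous.aestronglyMeasurable ?_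
      exact continuous_cis.comp (by fun_prop)
    · exact (norm_cis _).le

lemma FI_series {σ : Type*} [Countable σ] {l : σ → ℝ} {c : σ → ℂ} (hc : Summable fun S => ‖c S‖)
    {f : ℝ → ℂ} (hf : Integrable f) {G : ℝ → ℂ}
    (hG : ∀ t : ℝ, HasSum (fun S => c S * Complex.exp (-(t * Complex.I) * l S)) (G t)) (u : ℝ) :
    HasSum (fun S => c S * FI f (u - l S)) (FI (fun t => G t * f t) u) := by
  have hI : ∀ S, Integrable (fun t => c S * (f t * cis ((u - l S) * t))) := fun S =>
    (integrable_mul_cis hf (u - l S)).const_mul (c S)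
  have hn : ∀ S, ∫ t, ‖c S * (f t * cis ((u - l S) * t))‖ = ‖c S‖ * ∫ t, ‖f t‖ := by
    intro S
    simp_rw [norm_mul, norm_cis, mul_one]
    rw [integral_const_mul]
  have key := hasSum_integral_of_summable_integral_norm hI (by
    simp_rw [hn]; exact hc.mul_right _)
  have e : FI (fun t => G t * f t) u = ∫ t, ∑' S, c S * (f t * cis ((u - l S) * t)) := by
    refine integral_congr_ae (ae_of_all _ fun t => ?_)
    simp only
    rw [mul_assoc, ← ((hG t).mul_right (f t * cis (u * t))).tsum_eq]
    refine tsum_congr fun S => ?_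
    rw [cis_sub_mul]; ring
  rw [e]
  refine key.congr_fun fun S => ?_
  rw [FI, integral_const_mul]

/-- `FI` of the tent over `ε + it` is bounded uniformly. -/
lemma FI_tent_div {δ ε : ℝ} (hδ : 0 < δ) (hε : 0 < ε) (u : ℝ) :
    ‖FI (fun t : ℝ => (tent δ t : ℂ) * (1 / ((ε:ℂ) + t * Complex.I))) u‖ ≤ ∫ v, Pk δ v := by
  let w : ℝ → ℂ := fun v => Complex.exp (-(ε:ℂ) * v)
  have hw : IntegrableOn w (Ioi 0) := integrableOn_exp_neg_mul (by simpa using hε) 0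
  have h := FI_Lap_conv (tent_integrable hδ) hw u
  have e : ∀ t : ℝ, Lap w (t * Complex.I) = 1 / ((ε:ℂ) + t * Complex.I) := by
    intro t
    have h1 : ∀ v : ℝ, w v * Complex.exp (-(t * Complex.I) * v) = Complex.exp (-((ε:ℂ) + t * Complex.I) * v) := by
      intro v; simp only [w]; rw [← Complex.exp_add]; congr 1; ring
    unfold Lap
    simp_rw [h1]
    rw [integral_exp_mul_complex_Ioi (by simpa using hε)]
    have : (ε:ℂ) + t * Complex.I ≠ 0 := by
      intro h; have := congrArg Complex.re h; simp at this; linarith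
    rw [Complex.ofReal_zero, mul_zero, Complex.exp_zero, neg_div_neg_eq]
  have e2 : FI (fun t : ℝ => (tent δ t : ℂ) * (1 / ((ε:ℂ) + t * Complex.I))) u
      = FI (fun t => Lap w (t * Complex.I) * (tent δ t : ℂ)) u := by
    congr 1; funext t; rw [e]; ring
  rw [e2, h]
  have hP : Integrable (fun v => Pk δ (u - v)) := (Pk_integrable hδ).comp_sub_left u
  calc _ ≤ ∫ v in Ioi (0:ℝ), Pk δ (u - v) := by
        refine norm_integral_le_of_norm_le hP.integrableOn ?_
        filter_upwards [ae_restrict_mem measurableSet_Ioi] with v hv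
        rw [FI_tent_eq hδ, norm_mul, Complex.norm_real, Real.norm_of_nonneg (Pk_nonneg hδ _)]
        refine mul_le_of_le_one_left (Pk_nonneg hδ _) ?_
        exact norm_exp_neg_mul_le (by simpa using hε.le) (le_of_lt hv)
    _ ≤ ∫ v, Pk δ (u - v) := setIntegral_le_integral hP (ae_of_all _ fun v => Pk_nonneg hδ _)
    _ = _ := integral_sub_left_eq_self _ volume u



lemma FI_add {f g : ℝ → ℂ} (hf : Integrable f) (hg : Integrable g) (u : ℝ) :
    FI (fun t => f t + g t) u = FI f u + FI g u := by
  unfold FI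
  rw [← integral_add (integrable_mul_cis hf u) (integrable_mul_cis hg u)]
  refine integral_congr_ae (ae_of_all _ fun t => ?_)
  simp only; ring

lemma eps_ne {ε : ℝ} (hε : 0 < ε) (t : ℝ) : (ε:ℂ) + t * Complex.I ≠ 0 := by
  intro h; have := congrArg Complex.re h; simp at this; linarith

lemma eps_re (ε t : ℝ) : ((ε:ℂ) + t * Complex.I).re = ε := by simp

section
variable {p : ℕ → ℝ} (hmono : Monotone p) (hp1 : 1 < p 0) (hptop : Tendsto p atTop atTop)
  {k : ℕ} {t y b : Fin k → ℝ} (hE : IntegrableOn (Ef p t y b) (Ioi 0))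
  (htinj : Function.Injective t) (htpos : ∀ j, 0 < t j)
  (hcond : ∀ j, √(1 + t j ^ 2) * |b j * Real.cos (y j + Real.arctan (t j))| < 2)

/-- the squarefree zeta function -/
noncomputable def Zf (p : ℕ → ℝ) (t y b : Fin k → ℝ) (z : ℂ) : ℂ :=
  Vf p z * Complex.exp (Hf (af t) (bf y b) (Ef p t y b) z)

include hmono hp1 hptop hE

lemma Zf_continuous {ε : ℝ} (hε : 0 < ε) : Continuous fun s : ℝ => Zf p t y b (ε + s * Complex.I) := by
  have h : ∀ s : ℝ, Zf p t y b (ε + s * Complex.I) =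
      ∑' S, Complex.exp (-(1 + ((ε:ℂ) + s * Complex.I)) * lS p S) := fun s =>
    (Z_eq hmono hp1 hptop hE (by rw [eps_re]; exact hε)).tsum_eq.symm
  simp_rw [h]
  refine continuous_tsum (u := fun S => Real.exp (-(1 + ε) * lS p S)) (fun S => by fun_prop)
    (summable_S hmono hp1 hptop hE (by linarith)) fun S s => ?_
  rw [norm_exp_neg_mul]; simp

lemma Z_tent {ε r : ℝ} (hε : 0 < ε) (hr : 0 < r) (u : ℝ) :
    HasSum (fun S => ((Real.exp (-(1 + ε) * lS p S) * Pk r (u - lS p S) : ℝ) : ℂ))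
      (FI (fun s => Zf p t y b (ε + s * Complex.I) * (tent r s : ℂ)) u) := by
  have hc : Summable fun S => ‖((Real.exp (-(1 + ε) * lS p S) : ℝ) : ℂ)‖ := by
    simp_rw [Complex.norm_real, Real.norm_eq_abs, Real.abs_exp]
    exact summable_S hmono hp1 hptop hE (by linarith)
  have := FI_series (l := lS p) hc (tent_integrable hr) (G := fun s : ℝ => Zf p t y b (ε + s * Complex.I)) (by
    intro s
    refine (Z_eq hmono hp1 hptop hE (z := ε + s * Complex.I) (by rw [eps_re]; exact hε)).congr_fun fun S => ?_
    push_cast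
    rw [← Complex.exp_add]; congr 1; ring) u
  refine this.congr_fun fun S => ?_
  rw [FI_tent_eq hr]; push_cast; rfl

include htpos

lemma Z_local : ∃ δ : ℝ, 0 < δ ∧ ∃ C, ∀ ε : ℝ, 0 < ε → ε ≤ 1 → ∀ u,
    ‖FI (fun s => Zf p t y b (ε + s * Complex.I) * (tent δ s : ℂ)) u‖ ≤ C := by
  obtain ⟨δ, hδ, CM, hM⟩ := Mf_mult (af t) (bf y b) (Ef p t y b) hE (af_ne htpos)
  refine ⟨δ, hδ, (∑' S, Real.exp (-2 * lS p S)) * CM * ∫ v, Pk δ v, fun ε hε hε1 u => ?_⟩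
  have hV := Vf_mult hmono hp1 hptop hE (z := ε) (by simpa using hε.le) δ
  have hm := hV.mul (hM ε hε hε1)
  have hf0 : Integrable (fun s : ℝ => (tent δ s : ℂ) * (1 / ((ε:ℂ) + s * Complex.I))) := by
    refine Continuous.integrable_of_hasCompactSupport ?_ (tent_supp hδ).mul_right
    refine (Complex.continuous_ofReal.comp (tent_continuous δ)).mul ?_
    exact Continuous.div continuous_const (by fun_prop) (fun s => eps_ne hε s)
  have := hm.2.2 _ hf0 (fun s hs => by rw [tent_zero hδ hs.le]; simp) _ (FI_tent_div hδ hε) u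
  refine le_trans (le_of_eq ?_) this
  congr 2
  funext s
  rw [Zf, exp_Hf _ _ _ (by rw [eps_re]; exact hε)]
  ring

include htinj hcond

lemma Z_diff {r δ : ℝ} (hr : 0 < r) (hδ : 0 < δ) : ∃ R : ℝ → ℂ,
    (∀ u, Tendsto (fun ε : ℝ => FI (fun s => Zf p t y b (ε + s * Complex.I) *
      ((tent r s : ℂ) - tent δ s)) u) (𝓝[>] 0) (𝓝 (R u))) ∧ Tendsto R atTop (𝓝 0) := by
  set T := max r δ
  have hT : 0 < T := lt_max_of_lt_left hr
  obtain ⟨g, hg, hgb⟩ := Rf_bound (af t) (bf y b) (Ef p t y b) hE (af_inj htinj htpos) (bf_cond hcond) 1 (by simp) T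
  set CV := ∑' S, Real.exp (-2 * lS p S)
  have hCV : 0 ≤ CV := tsum_nonneg fun S => (Real.exp_pos _).le
  have hform : ∀ ε : ℝ, 0 < ε → ∀ s : ℝ, Zf p t y b (ε + s * Complex.I) =
      Vf p (ε + s * Complex.I) * ((1 + (ε + s * Complex.I)) / (ε + s * Complex.I) *
        Rf (af t) (bf y b) (Ef p t y b) 1 (ε + s * Complex.I)) := by
    intro ε hε s
    have hz : 0 < ((ε:ℂ) + s * Complex.I).re := by rw [eps_re]; exact hε
    rw [Zf, Hf_eq _ _ _ hz, add_assoc, Complex.exp_add, exp_log_diff hz, Rf, one_mul]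
  have hae : ∀ᵐ s : ℝ, (∀ i, s ≠ af t i) ∧ s ≠ 0 := by
    have h1 : ∀ᵐ s : ℝ, ∀ i, s ≠ af t i := ae_all_iff.mpr fun i => Measure.ae_ne volume _
    exact h1.and (Measure.ae_ne volume 0)
  refine RL_limit (g := (Icc (-T) T).indicator fun s => CV * ((2 + T) * (1 / r + 1 / δ)) * g s) ?_ ?_ ?_ ?_
  · exact (integrable_indicator_iff measurableSet_Icc).mpr (hg.const_mul _)
  · intro ε hε _
    refine Continuous.aestronglyMeasurable ((Zf_continuous hmono hp1 hptop hE hε).mul ?_)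
    exact (Complex.continuous_ofReal.comp (tent_continuous r)).sub (Complex.continuous_ofReal.comp (tent_continuous δ))
  · intro ε hε hε1
    filter_upwards [hae] with s hs
    by_cases hsT : s ∈ Icc (-T) T
    · rw [indicator_of_mem hsT, hform ε hε]
      have hz := eps_ne hε s
      have hsabs : |s| ≤ T := abs_le.mpr hsT
      have hspos : 0 < |s| := abs_pos.mpr hs.2
      have h1 : ‖Vf p (ε + s * Complex.I)‖ ≤ CV := Vf_bound hmono hp1 hptop hE (by rw [eps_re]; exact hε.le)
      have h2 : ‖1 + ((ε:ℂ) + s * Complex.I)‖ ≤ 2 + T := by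
        calc _ ≤ ‖(1:ℂ)‖ + (‖(ε:ℂ)‖ + ‖(s:ℂ) * Complex.I‖) := (norm_add_le _ _).trans (by gcongr; exact norm_add_le _ _)
          _ ≤ _ := by
            rw [norm_mul, Complex.norm_I, Complex.norm_real, Complex.norm_real, norm_one, Real.norm_of_nonneg hε.le,
              Real.norm_eq_abs]
            linarith
      have h3 : |s| ≤ ‖(ε:ℂ) + s * Complex.I‖ := by
        have := Complex.abs_im_le_norm ((ε:ℂ) + s * Complex.I)
        simpa using this
      have h4 : ‖(tent r s : ℂ) - tent δ s‖ ≤ |s| * (1 / r + 1 / δ) := by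
        rw [← Complex.ofReal_sub, Complex.norm_real, Real.norm_eq_abs, abs_le]
        have a1 := one_sub_tent (r := r) s
        have a2 := one_sub_tent (r := δ) s
        have a3 := tent_le_one hr s
        have a4 := tent_le_one hδ s
        have a5 : |s| * (1 / r + 1 / δ) = |s| / r + |s| / δ := by ring
        have a6 : 0 ≤ |s| / r := by positivity
        have a7 : 0 ≤ |s| / δ := by positivity
        constructor <;> linarith
      have h5 := hgb ε hε hε1 s hsT hs.1
      rw [Complex.ofReal_one] at h5
      have hg0 : 0 ≤ g s := (norm_nonneg _).trans h5
      have h6 : ‖(tent r s : ℂ) - tent δ s‖ / ‖(ε:ℂ) + s * Complex.I‖ ≤ 1 / r + 1 / δ := by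
        rw [div_le_iff₀ (hspos.trans_le h3)]
        refine h4.trans ?_
        rw [mul_comm]
        have : 0 ≤ 1 / r + 1 / δ := by positivity
        gcongr
      rw [norm_mul, norm_mul, norm_mul, norm_div]
      calc _ = ‖Vf p (ε + s * Complex.I)‖ * (‖1 + ((ε:ℂ) + s * Complex.I)‖ *
            (‖(tent r s : ℂ) - tent δ s‖ / ‖(ε:ℂ) + s * Complex.I‖)) *
            ‖Rf (af t) (bf y b) (Ef p t y b) 1 (ε + s * Complex.I)‖ := by ring
        _ ≤ _ := by gcongr
    · have hs' : T < |s| := by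
        by_contra h; exact hsT (abs_le.mp (not_lt.mp h))
      rw [indicator_of_notMem hsT, tent_zero hr ((le_max_left _ _).trans hs'.le),
        tent_zero hδ ((le_max_right _ _).trans hs'.le)]
      simp
  · filter_upwards [hae] with s hs
    obtain ⟨Y, hY⟩ := Rf_tendsto (af t) (bf y b) (Ef p t y b) hE 1 hs.1
    have hs0 : (s:ℂ) * Complex.I ≠ 0 := mul_ne_zero (by exact_mod_cast hs.2) Complex.I_ne_zero
    have hV : Tendsto (fun ε : ℝ => Vf p (ε + s * Complex.I)) (𝓝[>] 0) (𝓝 (Vf p (s * Complex.I))) :=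
      Tendsto.comp (Vf_continuousOn hmono hp1 hptop hE (s * Complex.I) (by simp)) (tendsto_eps s)
    have hz : Tendsto (fun ε : ℝ => (ε:ℂ) + s * Complex.I) (𝓝[>] 0) (𝓝 (s * Complex.I)) :=
      (tendsto_eps s).mono_right nhdsWithin_le_nhds
    have := ((hV.mul (((hz.const_add 1).div hz hs0).mul hY)).mul_const ((tent r s : ℂ) - tent δ s))
    refine ⟨_, this.congr' ?_⟩
    filter_upwards [self_mem_nhdsWithin] with ε hε
    show _ = Zf p t y b (ε + s * Complex.I) * _
    rw [hform ε hε]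
    rfl

lemma mass_bound : ∃ C : ℝ, 0 < C ∧ (∃ δ : ℝ, 0 < δ ∧ ∀ u, ∀ A : Finset (Finset ℕ),
      ∑ S ∈ A, Real.exp (-lS p S) * Pk δ (u - lS p S) ≤ C) ∧
    ∀ r : ℝ, 0 < r → ∃ U, ∀ u, U ≤ u → ∀ A : Finset (Finset ℕ),
      ∑ S ∈ A, Real.exp (-lS p S) * Pk r (u - lS p S) ≤ C := by
  obtain ⟨δ, hδ, C, hC⟩ := Z_local hmono hp1 hptop hE htpos
  have hC0 : 0 ≤ C := (norm_nonneg _).trans (hC 1 one_pos le_rfl 0)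
  -- passage to the limit
  have hfin : ∀ r : ℝ, 0 < r → ∀ u, ∀ A : Finset (Finset ℕ), ∀ D : ℝ → ℝ, ∀ D0,
      Tendsto D (𝓝[>] 0) (𝓝 D0) →
      (∀ ε : ℝ, 0 < ε → ε ≤ 1 → ‖FI (fun s => Zf p t y b (ε + s * Complex.I) * (tent r s : ℂ)) u‖ ≤ D ε) →
      ∑ S ∈ A, Real.exp (-lS p S) * Pk r (u - lS p S) ≤ D0 := by
    intro r hr u A D D0 hD hb
    have hcont : Continuous fun ε : ℝ => ∑ S ∈ A, Real.exp (-(1 + ε) * lS p S) * Pk r (u - lS p S) := by fun_prop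
    have h1 := (hcont.tendsto 0).mono_left (nhdsWithin_le_nhds (s := Ioi 0))
    simp only [add_zero, neg_one_mul] at h1
    refine le_of_tendsto_of_tendsto h1 hD ?_
    filter_upwards [Ioc_mem_nhdsGT one_pos] with ε hε
    refine le_trans ?_ (hb ε hε.1 hε.2)
    have h2 := Z_tent hmono hp1 hptop hE hε.1 hr u (t := t) (y := y) (b := b)
    have h3 : Summable fun S => (Real.exp (-(1 + ε) * lS p S) * Pk r (u - lS p S)) :=
      Complex.summable_ofReal.mp h2.summable
    have h4 := Complex.hasSum_ofReal.mpr h3.hasSum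
    rw [h2.unique h4, Complex.norm_real]
    refine le_trans ?_ (le_abs_self _)
    exact h3.sum_le_tsum _ fun S _ => mul_nonneg (Real.exp_pos _).le (Pk_nonneg hr _)
  refine ⟨C + 1, by linarith, ⟨δ, hδ, fun u A => ?_⟩, fun r hr => ?_⟩
  · have := hfin δ hδ u A (fun _ => C) C tendsto_const_nhds (fun ε h1 h2 => hC ε h1 h2 u)
    linarith
  · obtain ⟨R, hR, hR0⟩ := Z_diff hmono hp1 hptop hE htinj htpos hcond hr hδ
    have : ∀ᶠ u in atTop, ‖R u‖ < 1 := by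
      have := hR0.norm
      rw [norm_zero] at this
      exact this.eventually_lt_const one_pos
    obtain ⟨U, hU⟩ := eventually_atTop.mp this
    refine ⟨U, fun u hu A => ?_⟩
    have := hfin r hr u A (fun ε => C + ‖FI (fun s => Zf p t y b (ε + s * Complex.I) *
      ((tent r s : ℂ) - tent δ s)) u‖) (C + ‖R u‖) (tendsto_const_nhds.add (hR u).norm) (by
        intro ε hε hε1
        have hi : ∀ q : ℝ, 0 < q → Integrable (fun s : ℝ => Zf p t y b (ε + s * Complex.I) * (tent q s : ℂ)) := by
          intro q hq
          exact ((Zf_continuous hmono hp1 hptop hE hε).mul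
            (Complex.continuous_ofReal.comp (tent_continuous q))).integrable_of_hasCompactSupport (tent_supp hq).mul_left
        have hi2 : Integrable (fun s : ℝ => Zf p t y b (ε + s * Complex.I) * ((tent r s : ℂ) - tent δ s)) := by
          refine ((hi r hr).sub (hi δ hδ)).congr (ae_of_all _ fun s => ?_)
          simp only [Pi.sub_apply]; ring
        have e : (fun s : ℝ => Zf p t y b (ε + s * Complex.I) * (tent r s : ℂ)) =
          fun s : ℝ => Zf p t y b (ε + s * Complex.I) * (tent δ s : ℂ) + Zf p t y b (ε + s * Complex.I) * ((tent r s : ℂ) - tent δ s) := by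
          funext s; ring
        rw [e, FI_add (hi δ hδ) hi2]
        refine (norm_add_le _ _).trans ?_
        gcongr
        exact hC ε hε hε1 u)
    linarith [hU u hu]

end



lemma step_bound {N : ℝ → ℝ} (hN : Monotone N) {C h U : ℝ} (hC : 0 ≤ C) (hh : 0 < h)
    (H : ∀ u, U ≤ u → N (u + h) - N (u - h) ≤ 4 * C * h) {u s : ℝ} (hu : U ≤ u) (hs : 0 ≤ s) :
    N (u + s) - N u ≤ 2 * C * s + 4 * C * h := by
  have h1 : ∀ n : ℕ, N (u + n * (2 * h)) - N u ≤ n * (4 * C * h) := by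
    intro n
    induction n with
    | zero => simp
    | succ n ih =>
      have hn : 0 ≤ (n:ℝ) * (2 * h) := by positivity
      have := H (u + n * (2 * h) + h) (by linarith)
      rw [show u + n * (2 * h) + h + h = u + (n + 1 : ℕ) * (2 * h) by push_cast; ring,
        show u + n * (2 * h) + h - h = u + n * (2 * h) by ring] at this
      push_cast at this ⊢
      linarith
  have h2 := Nat.le_ceil (s / (2 * h))
  have h3 := Nat.ceil_lt_add_one (a := s / (2 * h)) (by positivity)
  have h4 : s ≤ ⌈s / (2 * h)⌉₊ * (2 * h) := (div_le_iff₀ (by positivity)).mp h2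
  calc N (u + s) - N u ≤ N (u + ⌈s / (2 * h)⌉₊ * (2 * h)) - N u := by
        have := hN (show u + s ≤ u + ⌈s / (2 * h)⌉₊ * (2 * h) by linarith)
        linarith
    _ ≤ _ := h1 _
    _ ≤ (s / (2 * h) + 1) * (4 * C * h) := by gcongr
    _ = _ := by field_simp; ring

lemma taub {N m : ℝ → ℝ} (hN : Monotone N) (hm : Measurable m)
    (hmN : ∀ v u, v ≤ u → |m u - m v| ≤ N u - N v)
    {C h0 : ℝ} (hC : 0 < C) (hh0 : 0 < h0)
    (H0 : ∀ u, N (u + h0) - N (u - h0) ≤ 4 * C * h0)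
    (H : ∀ h, 0 < h → ∃ U, ∀ u, U ≤ u → N (u + h) - N (u - h) ≤ 4 * C * h)
    {G : ℝ → ℂ} (hG : Integrable G) (hG1n : Integrable fun s : ℝ => |s| * ‖G s‖)
    (hGc : ∫ s, G s ≠ 0)
    (hA : ∀ h, 0 < h → Tendsto (fun u => ∫ s, (m (u - s * h) : ℂ) * G s) atTop (𝓝 0)) :
    Tendsto m atTop (𝓝 0) := by
  set c := ‖∫ s, G s‖ with hc
  have hcpos : 0 < c := norm_pos_iff.mpr hGc
  have hGn := hG.norm
  set K := ∫ s, C * (2 * (|s| * ‖G s‖) + 4 * ‖G s‖) with hK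
  have hKi : Integrable fun s => C * (2 * (|s| * ‖G s‖) + 4 * ‖G s‖) :=
    ((hG1n.const_mul 2).add (hGn.const_mul 4)).const_mul C
  have hK0 : 0 ≤ K := integral_nonneg fun s => by positivity
  have gb : ∀ u s h : ℝ, 0 < h → |m u - m (u - s * h)| ≤ C * h * (2 * |s|) + 4 * C * h0 := by
    intro u s h hh
    have key : ∀ v d : ℝ, 0 ≤ d → |m (v + d) - m v| ≤ 2 * C * d + 4 * C * h0 := fun v d hd =>
      (hmN v (v + d) (by linarith)).trans (step_bound hN (U := v) hC.le hh0 (fun u _ => H0 u) le_rfl hd)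
    rcases le_total 0 s with hs | hs
    · have := key (u - s * h) (s * h) (by positivity)
      rw [sub_add_cancel] at this
      rw [abs_of_nonneg hs]; linarith
    · have := key u (-(s * h)) (by nlinarith)
      rw [← sub_eq_add_neg, abs_sub_comm] at this
      rw [abs_of_nonpos hs]; linarith
  have main : ∀ h, 0 < h → ∃ T : ℝ → ℝ, Tendsto T atTop (𝓝 0) ∧ ∀ᶠ u in atTop, c * |m u| ≤ h * K + T u := by
    intro h hh
    obtain ⟨U, hU⟩ := H h hh
    let J : ℝ → ℝ → ℝ := fun u s => if u - s * h < U then 4 * C * h0 * ‖G s‖ else 0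
    have hJi : ∀ u, Integrable (J u) := by
      intro u
      have : J u = {s | u - s * h < U}.indicator (fun s => 4 * C * h0 * ‖G s‖) := by
        ext s; simp only [J, indicator, mem_setOf_eq]
      rw [this]
      exact (hGn.const_mul _).indicator (measurableSet_lt (by fun_prop) (by fun_prop))
    have hJt : Tendsto (fun u => ∫ s, J u s) atTop (𝓝 0) := by
      have := tendsto_integral_filter_of_dominated_convergence (μ := volume) (l := atTop) (F := J)
        (f := fun _ => (0:ℝ)) (fun s => 4 * C * h0 * ‖G s‖)
        (Eventually.of_forall fun u => (hJi u).aestronglyMeasurable)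
        (Eventually.of_forall fun u => ae_of_all _ fun s => by
          simp only [J]
          have : 0 ≤ 4 * C * h0 * ‖G s‖ := by positivity
          split_ifs
          · rw [Real.norm_of_nonneg this]
          · simpa using this)
        (hGn.const_mul _)
        (ae_of_all _ fun s => by
          refine tendsto_const_nhds.congr' ?_
          filter_upwards [eventually_ge_atTop (U + s * h)] with u hu
          simp only [J]
          rw [if_neg (by linarith)])
      simpa using this
    refine ⟨fun u => ‖∫ s, (m (u - s * h) : ℂ) * G s‖ + ∫ s, J u s, ?_, ?_⟩
    · simpa using (hA h hh).norm.add hJt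
    filter_upwards [eventually_ge_atTop U] with u hu
    have pb : ∀ s, ‖((m u : ℂ) - m (u - s * h)) * G s‖ ≤
        h * (C * (2 * (|s| * ‖G s‖) + 4 * ‖G s‖)) + J u s := by
      intro s
      rw [norm_mul, ← Complex.ofReal_sub, Complex.norm_real, Real.norm_eq_abs]
      have hg0 := norm_nonneg (G s)
      have hJ0 : 0 ≤ J u s := by simp only [J]; split_ifs <;> positivity
      by_cases hc : u - s * h < U
      · have e : J u s = 4 * C * h0 * ‖G s‖ := by simp only [J]; rw [if_pos hc]
        rw [e]
        have := mul_le_mul_of_nonneg_right (gb u s h hh) hg0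
        have h5 : 0 ≤ h * C * 4 * ‖G s‖ := by positivity
        nlinarith
      · have : |m u - m (u - s * h)| ≤ C * h * (2 * |s|) + 4 * C * h := by
          push Not at hc
          rcases le_total 0 s with hs | hs
          · have h1 := hmN (u - s * h) u (by nlinarith)
            have h2 := step_bound hN hC.le hh hU hc (s := s * h) (by positivity)
            rw [sub_add_cancel] at h2
            rw [abs_of_nonneg hs]; linarith
          · have h1 := hmN u (u - s * h) (by nlinarith)
            have h2 := step_bound hN hC.le hh hU hu (s := -(s * h)) (by nlinarith)
            rw [← sub_eq_add_neg] at h2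
            rw [abs_sub_comm, abs_of_nonpos hs]; linarith
        have := mul_le_mul_of_nonneg_right this hg0
        nlinarith
    have hbi : Integrable fun s => h * (C * (2 * (|s| * ‖G s‖) + 4 * ‖G s‖)) + J u s :=
      (hKi.const_mul h).add (hJi u)
    have hdi : Integrable fun s => ((m u : ℂ) - m (u - s * h)) * G s := by
      refine Integrable.mono' hbi ?_ (ae_of_all _ pb)
      refine AEStronglyMeasurable.mul ?_ hG.aestronglyMeasurable
      exact (measurable_const.sub (Complex.measurable_ofReal.comp (hm.comp (by fun_prop)))).aestronglyMeasurable
    have e : (m u : ℂ) * ∫ s, G s = (∫ s, ((m u : ℂ) - m (u - s * h)) * G s) +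
        ∫ s, (m (u - s * h) : ℂ) * G s := by
      have hi2 : Integrable fun s => (m (u - s * h) : ℂ) * G s :=
        ((hG.const_mul (m u : ℂ)).sub hdi).congr (ae_of_all _ fun s => by simp only [Pi.sub_apply]; ring)
      rw [← integral_add hdi hi2, ← integral_const_mul]
      congr 1; ext s; ring
    have e2 := congrArg norm e
    rw [norm_mul, Complex.norm_real, Real.norm_eq_abs, ← hc] at e2
    have e3 := norm_integral_le_of_norm_le hbi (ae_of_all _ pb)
    rw [integral_add (hKi.const_mul h) (hJi u), integral_const_mul, ← hK] at e3
    have e4 := norm_add_le (∫ s, ((m u : ℂ) - m (u - s * h)) * G s) (∫ s, (m (u - s * h) : ℂ) * G s)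
    rw [← e2] at e4
    linarith
  rw [Metric.tendsto_nhds]
  intro ε hε
  obtain ⟨T, hT, hT'⟩ := main (c * ε / (2 * (K + 1))) (by positivity)
  have h1 : ∀ᶠ u in atTop, T u < c * ε / 2 := hT.eventually_lt_const (by positivity)
  filter_upwards [hT', h1] with u a1 a2
  rw [Real.dist_eq, sub_zero]
  have h3 : c * ε / (2 * (K + 1)) * K ≤ c * ε / 2 := by
    rw [div_mul_eq_mul_div, div_le_div_iff₀ (by positivity) (by positivity)]
    nlinarith [mul_pos hcpos hε]
  have : c * |m u| < c * ε := by linarith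
  exact lt_of_mul_lt_mul_left this hcpos.le

/-- absolute counting function -/
noncomputable def Nf (p : ℕ → ℝ) (u : ℝ) : ℝ :=
  ∑' S : Finset ℕ, if lS p S ≤ u then Real.exp (-lS p S) else 0

section
variable {p : ℕ → ℝ} (hmono : Monotone p) (hp1 : 1 < p 0) (hptop : Tendsto p atTop atTop)
include hmono hp1 hptop

lemma Nf_sum {v u : ℝ} (h : v ≤ u) : Nf p v = ∑ S ∈ (lS_finite hmono hp1 hptop u).toFinset,
    if lS p S ≤ v then Real.exp (-lS p S) else 0 := by
  refine tsum_eq_sum fun S hS => if_neg fun h' => hS ?_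
  simpa using h'.trans h

lemma mtil_sum {v u : ℝ} (h : v ≤ u) : mtil p v = ∑ S ∈ (lS_finite hmono hp1 hptop u).toFinset,
    if lS p S ≤ v then sg S * Real.exp (-lS p S) else 0 := by
  refine tsum_eq_sum fun S hS => if_neg fun h' => hS ?_
  simpa using h'.trans h

lemma mtil_Nf {v u : ℝ} (h : v ≤ u) : |mtil p u - mtil p v| ≤ Nf p u - Nf p v := by
  rw [mtil_sum hmono hp1 hptop h, mtil_sum hmono hp1 hptop le_rfl, Nf_sum hmono hp1 hptop h,
    Nf_sum hmono hp1 hptop le_rfl, ← Finset.sum_sub_distrib, ← Finset.sum_sub_distrib]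
  refine (Finset.abs_sum_le_sum_abs _ _).trans (Finset.sum_le_sum fun S _ => ?_)
  split_ifs with h1 h2 h2
  · simp
  · rw [sub_zero, sub_zero, abs_mul, abs_sg, one_mul, abs_of_pos (Real.exp_pos _)]
  · exact absurd (h2.trans h) h1
  · simp

lemma Nf_mono : Monotone (Nf p) := fun v u h => by
  have := (abs_nonneg _).trans (mtil_Nf hmono hp1 hptop h)
  linarith

lemma mtil_neg {v : ℝ} (h : v < 0) : mtil p v = 0 := by
  rw [mtil]
  convert tsum_zero with S
  exact if_neg (not_le.mpr (h.trans_le (lS_nonneg hmono hp1 S)))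

lemma Nf_neg {v : ℝ} (h : v < 0) : Nf p v = 0 := by
  rw [Nf]
  convert tsum_zero with S
  exact if_neg (not_le.mpr (h.trans_le (lS_nonneg hmono hp1 S)))

lemma mtil_measurable : Measurable (mtil p) := by
  have h1 : Monotone fun u => Nf p u + mtil p u := fun v u h => by
    have := (neg_abs_le _).trans' (neg_le_neg (mtil_Nf hmono hp1 hptop h))
    simp only; linarith
  have := h1.measurable.sub (Nf_mono hmono hp1 hptop).measurable
  convert this using 1
  ext u; simp

lemma Nf_window {C h u : ℝ} (hh : 0 < h) (H : ∀ A : Finset (Finset ℕ),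
      ∑ S ∈ A, Real.exp (-lS p S) * Pk (1 / h) (u - lS p S) ≤ C) :
    Nf p (u + h) - Nf p (u - h) ≤ 4 * C * h := by
  have hr : 0 < 1 / h := by positivity
  rw [Nf_sum hmono hp1 hptop (show u - h ≤ u + h by linarith), Nf_sum hmono hp1 hptop le_rfl,
    ← Finset.sum_sub_distrib]
  have h1 := mul_le_mul_of_nonneg_left (H (lS_finite hmono hp1 hptop (u + h)).toFinset)
    (show 0 ≤ 4 * h by positivity)
  rw [Finset.mul_sum] at h1
  refine (Finset.sum_le_sum fun S _ => ?_).trans (h1.trans (by linarith))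
  have hp : 0 ≤ 4 * h * (Real.exp (-lS p S) * Pk (1 / h) (u - lS p S)) := by
    have := Pk_nonneg hr (u - lS p S)
    positivity
  split_ifs with h1 h2 h2
  · simpa using hp
  · have : |1 / h * (u - lS p S)| ≤ 1 := by
      rw [abs_mul, abs_of_pos hr, one_div, inv_mul_le_iff₀ hh, mul_one, abs_le]
      constructor <;> linarith
    have := Pk_lower hr this
    have h3 : 1 ≤ 4 * h * Pk (1 / h) (u - lS p S) := by
      calc 1 = 4 * h * (1 / h / 4) := by field_simp
        _ ≤ _ := by gcongr
    have := mul_le_mul_of_nonneg_left h3 (Real.exp_pos (-lS p S)).le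
    linarith
  · exact absurd (h2.trans (by linarith)) h1
  · simpa using hp
end



lemma exists_kernel : ∃ χ G : ℝ → ℂ, Continuous χ ∧ Integrable χ ∧ (∃ B, ∀ t, ‖χ t‖ ≤ B) ∧
    (∀ t, 2 ≤ |t| → χ t = 0) ∧
    (∀ u, FI χ u = G u) ∧ Continuous G ∧ Integrable G ∧ (Integrable fun s : ℝ => |s| * ‖G s‖) ∧
    (∫ s, G s) ≠ 0 := by
  obtain ⟨χ, h1, h2⟩ := exists_bump
  let k : SchwartzMap ℝ ℂ := FourierTransformInv.fourierInv χ
  have hpi : (0:ℝ) < 2 * Real.pi := by positivity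
  have hk : ∀ u, FI χ u = k (u / (2 * Real.pi)) := by
    intro u
    simp only [k]
    rw [SchwartzMap.fourierInv_coe, Real.fourierInv_eq', FI]
    congr 1; ext v
    rw [smul_eq_mul, mul_comm, cis]
    congr 2
    simp only [RCLike.inner_apply, conj_trivial]
    push_cast
    have : (Real.pi : ℂ) ≠ 0 := by exact_mod_cast Real.pi_ne_zero
    field_simp
  have hInt0 : ∫ v, k v = 1 := by
    have e : χ = FourierTransform.fourier k := by simp [k]
    have h0 := h1 0 (by simp)
    rw [e, SchwartzMap.fourier_coe, Real.fourier_real_eq_integral_exp_smul] at h0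
    simpa using h0
  refine ⟨χ, fun u => k (u / (2 * Real.pi)), χ.continuous, χ.integrable, ?_, h2, hk,
    k.continuous.comp (by fun_prop), k.integrable.comp_div hpi.ne', ?_, ?_⟩
  · obtain ⟨B, hB⟩ := χ.decay 0 0
    exact ⟨B, fun t => by simpa using hB.2 t⟩
  · have := ((k.integrable_pow_mul volume 1).comp_div hpi.ne').const_mul (2 * Real.pi)
    refine this.congr (ae_of_all _ fun s => ?_)
    simp only [pow_one, Real.norm_eq_abs, abs_div, abs_of_pos hpi]
    field_simp
  · rw [Measure.integral_comp_div (fun v => k v), hInt0]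
    simp [Real.pi_ne_zero]

lemma FI_scale {χ : ℝ → ℂ} {h : ℝ} (hh : 0 < h) (u : ℝ) :
    FI (fun s => χ (h * s)) u = (1 / h : ℝ) * FI χ (u / h) := by
  have := Measure.integral_comp_mul_left (fun t => χ t * cis (u / h * t)) h
  rw [FI, FI]
  rw [abs_of_pos (by positivity), Complex.real_smul] at this
  rw [one_div, ← this]
  congr 1; ext s
  rw [show u / h * (h * s) = u * s by field_simp]



section
variable {p : ℕ → ℝ} (hmono : Monotone p) (hp1 : 1 < p 0) (hptop : Tendsto p atTop atTop)
  {k : ℕ} {t y b : Fin k → ℝ} (hE : IntegrableOn (Ef p t y b) (Ioi 0))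
  (htinj : Function.Injective t) (htpos : ∀ j, 0 < t j)
  (hcond : ∀ j, √(1 + t j ^ 2) * |b j * Real.cos (y j + Real.arctan (t j))| < 2)

include hmono hp1 hptop hE

lemma Lap_mtil {ε : ℝ} (hε : 0 < ε) (s : ℝ) :
    Lap (fun v => (mtil p v * Real.exp (-ε * v) : ℝ)) (s * Complex.I) =
      Rf (af t) (bf y b) (Ef p t y b) (-1) (ε + s * Complex.I) / (1 + (ε + s * Complex.I)) := by
  set z : ℂ := ε + s * Complex.I with hzdef
  have hz : 0 < z.re := by rw [hzdef, eps_re]; exact hε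
  have hz0 : z ≠ 0 := eps_ne hε s
  have h1z : 1 + z ≠ 0 := by
    intro h; have := congrArg Complex.re h; simp at this; rw [hzdef] at this; simp at this; linarith
  have e1 : Lap (fun v => (mtil p v * Real.exp (-ε * v) : ℝ)) (s * Complex.I) =
      ∫ v in Ioi (0:ℝ), (mtil p v : ℂ) * Complex.exp (-z * v) := by
    rw [Lap]
    refine integral_congr_ae (ae_of_all _ fun v => ?_)
    simp only [hzdef]
    push_cast
    rw [mul_assoc, ← Complex.exp_add]; congr 2; ring
  rw [e1, laplace_step (l := lS p) (c := fun S => (sg S : ℂ) * Complex.exp (-lS p S))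
    (lS_nonneg hmono hp1) hz]
  · have e2 : ∀ S, (sg S : ℂ) * Complex.exp (-lS p S) * Complex.exp (-z * lS p S) =
        (sg S : ℂ) * Complex.exp (-(1 + z) * lS p S) := by
      intro S; rw [mul_assoc, ← Complex.exp_add]; congr 2; ring
    simp_rw [e2]
    rw [(W_eq hmono hp1 hptop hE hz).tsum_eq, Hf_eq _ _ _ hz, add_assoc, neg_add, Complex.exp_add,
      Complex.exp_neg, exp_log_diff hz, Rf, neg_one_mul]
    field_simp
  · refine (summable_S hmono hp1 hptop hE (s := 1 + z.re) (by linarith)).congr fun S => ?_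
    rw [norm_mul, Complex.norm_real, Real.norm_eq_abs, abs_sg, one_mul, ← Complex.ofReal_neg,
      Complex.norm_exp_ofReal, ← Real.exp_add]
    congr 1; ring
  · intro v _
    have hs : Summable (fun S => if lS p S ≤ v then sg S * Real.exp (-lS p S) else 0) := by
      refine summable_of_finite_support ((lS_finite hmono hp1 hptop v).subset fun S hS => ?_)
      by_contra h
      exact hS (if_neg h)
    have := Complex.hasSum_ofReal.mpr hs.hasSum
    change HasSum _ ((mtil p v : ℝ) : ℂ) at this
    convert this using 2 with S
    split_ifs <;> simp

lemma smooth_lim (htinj : Function.Injective t) (htpos : ∀ j, 0 < t j)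
    (hcond : ∀ j, √(1 + t j ^ 2) * |b j * Real.cos (y j + Real.arctan (t j))| < 2)
    {χ G : ℝ → ℂ} (hχ : Continuous χ) (hχi : Integrable χ) {B : ℝ} (hB : ∀ t, ‖χ t‖ ≤ B)
    (hχ0 : ∀ t, 2 ≤ |t| → χ t = 0) (hG : ∀ u, FI χ u = G u) (hGc : Continuous G) (hGi : Integrable G)
    (hG1 : Integrable fun s : ℝ => |s| * ‖G s‖)
    {a c : ℝ} (ha : 0 ≤ a) (hc : 0 ≤ c) (hbd : ∀ v, 0 < v → |mtil p v| ≤ a + c * v)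
    {h : ℝ} (hh : 0 < h) :
    Tendsto (fun u => ∫ s, (mtil p (u - s * h) : ℂ) * G s) atTop (𝓝 0) := by
  have hmm := mtil_measurable hmono hp1 hptop
  set T := 2 / h with hT
  obtain ⟨g, hg, hgb⟩ := Rf_bound (af t) (bf y b) (Ef p t y b) hE (af_inj htinj htpos) (bf_cond hcond)
    (-1) (by simp) T
  have hB0 : 0 ≤ B := (norm_nonneg _).trans (hB 0)
  have hae : ∀ᵐ s : ℝ, ∀ i, s ≠ af t i := ae_all_iff.mpr fun i => Measure.ae_ne volume _
  have hone : ∀ ε : ℝ, 0 < ε → ∀ s : ℝ, 1 ≤ ‖1 + ((ε:ℂ) + s * Complex.I)‖ := by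
    intro ε hε s
    have := Complex.abs_re_le_norm (1 + ((ε:ℂ) + s * Complex.I))
    simp only [Complex.add_re, Complex.one_re, Complex.ofReal_re, Complex.mul_re, Complex.I_re,
      Complex.ofReal_im, Complex.I_im] at this
    have h2 := le_abs_self (1 + (ε + (s * 0 - 0 * 1)))
    linarith
  obtain ⟨r, hr1, hr2⟩ := RL_limit (F := fun ε s =>
      Rf (af t) (bf y b) (Ef p t y b) (-1) (ε + s * Complex.I) / (1 + (ε + s * Complex.I)) * χ (h * s))
      (g := (Icc (-T) T).indicator fun s => B * g s)
      ((integrable_indicator_iff measurableSet_Icc).mpr (hg.const_mul _))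
      (by
        intro ε hε _
        refine Continuous.aestronglyMeasurable (Continuous.mul (Continuous.div
          (Rf_continuous _ _ _ hE _ hε) (by fun_prop) fun s => ?_) (by fun_prop))
        have := hone ε hε s
        intro h0; rw [h0] at this; simp at this; linarith)
      (by
        intro ε hε hε1
        filter_upwards [hae] with s hs
        by_cases hsT : s ∈ Icc (-T) T
        · rw [indicator_of_mem hsT, norm_mul, norm_div, mul_comm]
          have h1 := hgb ε hε hε1 s hsT hs
          push_cast at h1
          have h2 := hone ε hε s
          have h3 : ‖Rf (af t) (bf y b) (Ef p t y b) (-1) (ε + s * Complex.I)‖ /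
              ‖1 + ((ε:ℂ) + s * Complex.I)‖ ≤ g s := (div_le_self (norm_nonneg _) h2).trans h1
          exact mul_le_mul (hB _) h3 (by positivity) hB0
        · have hs' : T < |s| := by
            by_contra h; exact hsT (abs_le.mp (not_lt.mp h))
          rw [indicator_of_notMem hsT, hχ0 (h * s)]
          · simp
          · rw [abs_mul, abs_of_pos hh]
            rw [hT, div_lt_iff₀ hh] at hs'
            linarith)
      (by
        filter_upwards [hae] with s hs
        obtain ⟨Y, hY⟩ := Rf_tendsto (af t) (bf y b) (Ef p t y b) hE (-1) hs
        have hz : Tendsto (fun ε : ℝ => (ε:ℂ) + s * Complex.I) (𝓝[>] 0) (𝓝 (s * Complex.I)) :=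
          (tendsto_eps s).mono_right nhdsWithin_le_nhds
        have hne : 1 + (s:ℂ) * Complex.I ≠ 0 := by
          intro h; have := congrArg Complex.re h; simp at this
        exact ⟨_, (hY.div (hz.const_add 1) hne).mul_const _⟩)
  refine hr2.congr fun u => ?_
  -- the kernel
  have hK : ∀ v, FI (fun s => χ (h * s)) v = (1 / h : ℝ) * G (v / h) := fun v => by
    rw [FI_scale hh, hG]
  have hχs : Integrable fun s => χ (h * s) := hχi.comp_mul_left' hh.ne'
  have hwi : ∀ ε : ℝ, 0 < ε → IntegrableOn (fun v => ((mtil p v * Real.exp (-ε * v) : ℝ) : ℂ)) (Ioi 0) := by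
    intro ε hε
    have h1 := ((integrableOn_exp_neg_mul (z := (ε / 2 : ℝ)) (by simpa using hε) 0).norm).const_mul
      (a + c * (2 / ε))
    refine Integrable.mono' h1 ?_ ?_
    · refine Measurable.aestronglyMeasurable (Complex.measurable_ofReal.comp (hmm.mul (by fun_prop)))
    · filter_upwards [ae_restrict_mem measurableSet_Ioi] with v hv
      rw [norm_exp_neg_mul, Complex.norm_real, norm_mul, Real.norm_eq_abs, Real.norm_eq_abs, Real.abs_exp,
        Complex.ofReal_re]
      have hv' : 0 < v := hv
      have h2 := hbd v hv
      have h3 : v ≤ 2 / ε * Real.exp (ε / 2 * v) := by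
        have := Real.add_one_le_exp (ε / 2 * v)
        calc v = 2 / ε * (ε / 2 * v) := by field_simp
          _ ≤ _ := by gcongr; linarith
      have h4 : 1 ≤ Real.exp (ε / 2 * v) := Real.one_le_exp (by positivity)
      have h5 : |mtil p v| ≤ (a + c * (2 / ε)) * Real.exp (ε / 2 * v) := by
        calc _ ≤ a * 1 + c * v := by linarith
          _ ≤ a * Real.exp (ε / 2 * v) + c * (2 / ε * Real.exp (ε / 2 * v)) := by gcongr
          _ = _ := by ring
      calc _ ≤ (a + c * (2 / ε)) * Real.exp (ε / 2 * v) * Real.exp (-ε * v) := by gcongr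
        _ = _ := by rw [mul_assoc, ← Real.exp_add]; congr 2; ring
  have e1 : ∀ ε : ℝ, 0 < ε → FI (fun s => Rf (af t) (bf y b) (Ef p t y b) (-1) (ε + s * Complex.I) /
      (1 + (ε + s * Complex.I)) * χ (h * s)) u =
      ∫ v in Ioi (0:ℝ), ((mtil p v * Real.exp (-ε * v) : ℝ) : ℂ) * ((1 / h : ℝ) * G ((u - v) / h)) := by
    intro ε hε
    have := FI_Lap_conv hχs (hwi ε hε) u
    simp_rw [Lap_mtil hmono hp1 hptop hE hε, hK] at this
    exact this
  have hGu : Integrable fun v => G ((u - v) / h) := (hGi.comp_div hh.ne').comp_sub_left u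
  have hGu1 : Integrable fun v => |(u - v) / h| * ‖G ((u - v) / h)‖ :=
    (hG1.comp_div hh.ne').comp_sub_left u
  have e2 : Tendsto (fun ε : ℝ => ∫ v in Ioi (0:ℝ), ((mtil p v * Real.exp (-ε * v) : ℝ) : ℂ) *
      ((1 / h : ℝ) * G ((u - v) / h))) (𝓝[>] 0)
      (𝓝 (∫ v in Ioi (0:ℝ), (mtil p v : ℂ) * ((1 / h : ℝ) * G ((u - v) / h)))) := by
    refine tendsto_integral_filter_of_dominated_convergence
      (fun v => (1 / h) * ((a + c * |u|) * ‖G ((u - v) / h)‖ + c * h * (|(u - v) / h| * ‖G ((u - v) / h)‖))) ?_ ?_ ?_ ?_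
    · refine Eventually.of_forall fun ε => ?_
      refine Measurable.aestronglyMeasurable ((Complex.measurable_ofReal.comp (hmm.mul (by fun_prop))).mul
        (measurable_const.mul (hGc.measurable.comp (by fun_prop))))
    · filter_upwards [self_mem_nhdsWithin] with ε hε
      filter_upwards [ae_restrict_mem measurableSet_Ioi] with v hv
      have hε' : 0 < ε := hε
      have hv' : 0 < v := hv
      have h1 : |mtil p v| * Real.exp (-ε * v) ≤ a + c * |u| + c * h * |(u - v) / h| := by
        have h2 := hbd v hv
        have h3 : Real.exp (-ε * v) ≤ 1 := Real.exp_le_one_iff.mpr (by nlinarith)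
        have h4 : v ≤ |u| + h * |(u - v) / h| := by
          rw [abs_div, abs_of_pos hh, mul_div_cancel₀ _ hh.ne']
          have := le_abs_self u
          have := neg_abs_le (u - v)
          linarith
        calc _ ≤ |mtil p v| * 1 := by gcongr
          _ ≤ a + c * v := by linarith
          _ ≤ a + c * (|u| + h * |(u - v) / h|) := by gcongr
          _ = _ := by ring
      rw [norm_mul, norm_mul, Complex.norm_real, Complex.norm_real, norm_mul, Real.norm_eq_abs,
        Real.norm_eq_abs, Real.abs_exp, Real.norm_of_nonneg (by positivity : 0 ≤ 1 / h)]
      calc _ ≤ (a + c * |u| + c * h * |(u - v) / h|) * (1 / h * ‖G ((u - v) / h)‖) := by gcongr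
        _ = _ := by ring
    · exact (((hGu.norm.const_mul _).add (hGu1.const_mul _)).const_mul _).integrableOn
    · refine ae_of_all _ fun v => ?_
      have hcont : Continuous fun ε : ℝ => ((mtil p v * Real.exp (-ε * v) : ℝ) : ℂ) *
          ((1 / h : ℝ) * G ((u - v) / h)) := by fun_prop
      have := (hcont.tendsto 0).mono_left (nhdsWithin_le_nhds (s := Ioi 0))
      simpa using this
  have e3 := tendsto_nhds_unique (hr1 u) (e2.congr' (by
    filter_upwards [self_mem_nhdsWithin] with ε hε using (e1 ε hε).symm))
  rw [e3, ← integral_indicator measurableSet_Ioi]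
  have e4 : ∀ᵐ v : ℝ, (Ioi (0:ℝ)).indicator (fun v => (mtil p v : ℂ) * ((1 / h : ℝ) * G ((u - v) / h))) v =
      (1 / h : ℝ) * ((mtil p v : ℂ) * G ((u - v) / h)) := by
    filter_upwards [Measure.ae_ne volume (0:ℝ)] with v hv
    rcases lt_or_gt_of_ne hv with h1 | h1
    · rw [indicator_of_notMem (by simpa using h1.le), mtil_neg hmono hp1 hptop h1]; simp
    · rw [indicator_of_mem (show v ∈ Ioi 0 from h1)]; ring
  rw [integral_congr_ae e4, integral_const_mul]
  have e5 := integral_sub_left_eq_self (fun v => (mtil p v : ℂ) * G ((u - v) / h)) volume u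
  rw [← e5]
  have e6 := Measure.integral_comp_mul_right (fun w => (mtil p (u - w) : ℂ) * G ((u - (u - w)) / h)) h
  rw [abs_of_pos (by positivity), Complex.real_smul] at e6
  rw [one_div, ← e6]
  congr 1; ext s
  rw [show (u - (u - s * h)) / h = s by field_simp; ring]
end



lemma mtil_tendsto {p : ℕ → ℝ} (hmono : Monotone p) (hp1 : 1 < p 0) (hptop : Tendsto p atTop atTop)
    {k : ℕ} {t y b : Fin k → ℝ} (hE : IntegrableOn (Ef p t y b) (Ioi 0))
    (htinj : Function.Injective t) (htpos : ∀ j, 0 < t j)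
    (hcond : ∀ j, √(1 + t j ^ 2) * |b j * Real.cos (y j + Real.arctan (t j))| < 2) :
    Tendsto (mtil p) atTop (𝓝 0) := by
  obtain ⟨χ, G, hχ, hχi, ⟨B, hB⟩, hχ0, hG, hGc, hGi, hG1, hGne⟩ := exists_kernel
  obtain ⟨C, hC, ⟨δ, hδ, hloc⟩, hgl⟩ := mass_bound hmono hp1 hptop hE htinj htpos hcond
  have hN := Nf_mono hmono hp1 hptop
  have H0 : ∀ u, Nf p (u + 1 / δ) - Nf p (u - 1 / δ) ≤ 4 * C * (1 / δ) := fun u =>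
    Nf_window hmono hp1 hptop (by positivity) (by rw [one_div_one_div]; exact hloc u)
  have hδ' : 0 < 1 / δ := by positivity
  refine taub hN (mtil_measurable hmono hp1 hptop) (fun v u h => mtil_Nf hmono hp1 hptop h) hC
    hδ' H0 (fun h hh => ?_) hGi hG1 hGne (fun h hh => ?_)
  · obtain ⟨U, hU⟩ := hgl (1 / h) (by positivity)
    exact ⟨U, fun u hu => Nf_window hmono hp1 hptop hh (hU u hu)⟩
  · refine smooth_lim hmono hp1 hptop hE htinj htpos hcond hχ hχi hB hχ0 hG hGc hGi hG1
      (a := 2 * C + 4 * C * (1 / δ)) (c := 2 * C) (by positivity) (by positivity) (fun v hv => ?_) hh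
    have h1 := mtil_Nf hmono hp1 hptop (show -1 ≤ v by linarith)
    rw [mtil_neg hmono hp1 hptop (by norm_num : (-1:ℝ) < 0), sub_zero] at h1
    have h2 := step_bound hN (U := -1) hC.le hδ' (fun u _ => H0 u) le_rfl (s := v + 1) (by linarith)
    rw [neg_add_cancel_comm_assoc] at h2
    linarith


theorem stmt_7 (p : ℕ → ℝ) (hmono : Monotone p) (hp1 : 1 < p 0)
    (hptop : Tendsto p atTop atTop)
    (k : ℕ) (t y b : Fin k → ℝ) (htinj : Function.Injective t) (htpos : ∀ j, 0 < t j)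
    (hL1 : ∫⁻ x in Set.Ici (2:ℝ), ENNReal.ofReal
      (|PiCount p x - x / Real.log x *
        (1 + ∑ j, b j * Real.cos (t j * Real.log x + y j))| / x ^ 2) < ⊤)
    (hcond : ∀ j, Real.sqrt (1 + t j ^ 2) * |b j * Real.cos (y j + Real.arctan (t j))| < 2) :
    Tendsto (mB p) atTop (𝓝 0) := by
  have hE := Ef_integrable (t := t) (y := y) (b := b) hmono hp1 hptop hL1
  have h := (mtil_tendsto hmono hp1 hptop hE htinj htpos hcond).comp Real.tendsto_log_atTop
  refine h.congr' ?_
  filter_upwards [eventually_gt_atTop 0] with x hx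
  exact (mB_eq hmono hp1 hptop hx).symm
end

section
/- Let G be analytic on the half-plane {Re s > 1} and let U ⊆ ℝ be open. Suppose G has A_loc-boundary behavior on 1 + iU, with continuous boundary function t ↦ G(1 + it) on U, and let s₀ = 1 + it₀ with t₀ ∈ U. Then the function s ↦ (G(s) − G(s₀))/(s − s₀) has local pseudofunction boundary behavior on 1 + iU. -/
open Filter MeasureTheory Set Topology
open scoped Classical

noncomputable def FTx (f : ℝ → ℂ) (ξ : ℝ) : ℂ := ∫ t : ℝ, f t * Complex.exp (-(ξ * t) * Complex.I)

lemma FTx_eq (f : ℝ → ℂ) (ξ : ℝ) : FTx f ξ = FourierTransform.fourier f (ξ / (2 * Real.pi)) := by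
  rw [Real.fourier_real_eq_integral_exp_smul, FTx]
  congr 1; ext t
  rw [smul_eq_mul, mul_comm]
  congr 3
  have : (Real.pi : ℂ) ≠ 0 := by exact_mod_cast Real.pi_ne_zero
  push_cast; field_simp

lemma FTx_test_integrable (φ : ℝ → ℂ) (h1 : ContDiff ℝ (⊤ : ℕ∞) φ) (h2 : HasCompactSupport φ) :
    Integrable (FTx φ) := by
  have : FTx φ = fun ξ => (FourierTransform.fourier (h2.toSchwartzMap h1)) (ξ / (2 * Real.pi)) := by
    ext ξ
    rw [FTx_eq, SchwartzMap.fourier_coe]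
    rfl
  rw [this]
  exact (SchwartzMap.integrable _).comp_div (by positivity)

lemma norm_expI (a b : ℝ) : ‖Complex.exp (-(a * b) * Complex.I)‖ = 1 := by
  have := Complex.norm_exp_ofReal_mul_I (-(a*b))
  push_cast at this; exact this

lemma FTx_swap (φ g : ℝ → ℂ) (hφ : Integrable φ) (hg : Integrable g) (ξ : ℝ) :
    FTx (fun t => (∫ y : ℝ, g y * Complex.exp (-(t * y) * Complex.I)) * φ t) ξ =
      ∫ y : ℝ, g y * FTx φ (ξ + y) := by
  have hi : Integrable (Function.uncurry fun t y : ℝ =>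
      φ t * g y * Complex.exp (-(t * (y + ξ : ℝ)) * Complex.I)) (volume.prod volume) := by
    refine (hφ.mul_prod hg).mul_bdd (c := 1) ?_ ?_
    · exact (by fun_prop : Continuous fun p : ℝ × ℝ =>
        Complex.exp (-(p.1 * (p.2 + ξ : ℝ)) * Complex.I)).aestronglyMeasurable
    · exact Eventually.of_forall fun p => (norm_expI _ _).le
  have := integral_integral_swap hi
  calc _ = ∫ t, ∫ y, φ t * g y * Complex.exp (-(t * (y + ξ : ℝ)) * Complex.I) := by
        unfold FTx
        congr 1; ext t
        beta_reduce
        rw [← integral_mul_const, ← integral_mul_const]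
        congr 1; ext y
        rw [show -((t:ℂ) * ((y + ξ : ℝ) : ℂ)) * Complex.I = -(t*y)*Complex.I + -(ξ*t)*Complex.I by
          push_cast; ring, Complex.exp_add]
        ring
    _ = _ := by
        rw [this]
        congr 1; ext y
        unfold FTx
        rw [← integral_const_mul]
        congr 1; ext t
        rw [show -((t:ℂ) * ((y + ξ : ℝ) : ℂ)) * Complex.I = -(((ξ+y:ℝ):ℂ)*t)*Complex.I by
          push_cast; ring]
        ring

lemma cont_ghat (g : ℝ → ℂ) (hg : Integrable g) :
    Continuous fun t : ℝ => ∫ y : ℝ, g y * Complex.exp (-(t * y) * Complex.I) := by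
  refine continuous_of_dominated (bound := fun y => ‖g y‖) ?_ ?_ hg.norm ?_
  · intro t
    exact hg.1.mul (by fun_prop : Continuous fun y : ℝ => Complex.exp (-(t * y) * Complex.I)).aestronglyMeasurable
  · intro t
    exact Eventually.of_forall fun y => by rw [norm_mul, norm_expI, mul_one]
  · exact Eventually.of_forall fun y => by fun_prop

lemma FTx_f_integrable (φ g : ℝ → ℂ) (c : ℂ) (h1 : ContDiff ℝ (⊤ : ℕ∞) φ) (h2 : HasCompactSupport φ)
    (hg : Integrable g) :
    Integrable (FTx fun t => ((∫ y : ℝ, g y * Complex.exp (-(t * y) * Complex.I)) - c) * φ t) := by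
  have hφ : Integrable φ := h1.continuous.integrable_of_hasCompactSupport h2
  have hh := FTx_test_integrable φ h1 h2
  have e : (FTx fun t => ((∫ y : ℝ, g y * Complex.exp (-(t * y) * Complex.I)) - c) * φ t) =
      fun ξ => (∫ y : ℝ, g y * FTx φ (ξ + y)) - c * FTx φ ξ := by
    ext ξ
    rw [← FTx_swap φ g hφ hg]
    unfold FTx
    rw [← integral_const_mul, ← integral_sub]
    · congr 1; ext t; ring
    · refine Continuous.integrable_of_hasCompactSupport ?_ ?_
      · exact ((cont_ghat g hg).mul h1.continuous).mul (by fun_prop)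
      · exact h2.mul_left.mul_right
    · refine Continuous.integrable_of_hasCompactSupport ?_ ?_
      · have := h1.continuous
        fun_prop
      · exact h2.mul_right.mul_left (f := fun _ => c)
  rw [e]
  refine Integrable.sub ?_ (hh.const_mul c)
  have := (Integrable.convolution_integrand (ContinuousLinearMap.mul ℝ ℂ) hg.comp_neg hh).integral_prod_left
  refine this.congr (Eventually.of_forall fun ξ => ?_)
  simp only [ContinuousLinearMap.mul_apply']
  rw [← integral_neg_eq_self]
  simp

lemma FTx_total (f : ℝ → ℂ) (hf : Integrable f) (hc : Continuous f) (hF : Integrable (FTx f))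
    (t₀ : ℝ) (h0 : f t₀ = 0) : ∫ v : ℝ, Complex.exp (v * t₀ * Complex.I) * FTx f v = 0 := by
  have hF' : Integrable (FourierTransform.fourier f) := by
    have := hF.comp_mul_left' (R := 2 * Real.pi) (by positivity)
    refine this.congr (Eventually.of_forall fun ξ => ?_)
    simp only [FTx_eq]
    field_simp
  have := hf.fourierInv_fourier_eq hF' (hc.continuousAt (x := t₀))
  rw [h0, Real.fourierInv_eq'] at this
  have h := Measure.integral_comp_div (fun v : ℝ => Complex.exp (↑(2 * Real.pi * inner ℝ v t₀) * Complex.I) • FourierTransform.fourier f v) (2 * Real.pi)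
  rw [this, smul_zero] at h
  rw [← h]
  congr 1; ext v
  rw [FTx_eq, smul_eq_mul]
  congr 3
  have : (Real.pi : ℂ) ≠ 0 := by exact_mod_cast Real.pi_ne_zero
  simp only [RCLike.inner_apply, conj_trivial]
  push_cast; field_simp

lemma half_line (f : ℝ → ℂ) (hf : Integrable f) (t₀ x ε : ℝ) (hε : 0 < ε) :
    ∫ t : ℝ, f t * Complex.exp (-(x * t) * Complex.I) / (ε + (t - t₀) * Complex.I) =
    ∫ u in Ioi (0:ℝ), Complex.exp (-(ε * u)) * (Complex.exp (u * t₀ * Complex.I) * FTx f (x + u)) := by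
  have hi : Integrable (Function.uncurry fun t u : ℝ =>
      f t * Complex.exp ((-ε : ℝ) * u) * Complex.exp (-(x * t + u * (t - t₀) : ℝ) * Complex.I))
      (volume.prod (volume.restrict (Ioi 0))) := by
    have he : IntegrableOn (fun u : ℝ => Complex.exp ((-ε : ℝ) * u)) (Ioi 0) :=
      integrableOn_exp_mul_complex_Ioi (by simpa using hε) 0
    refine (hf.mul_prod he).mul_bdd (c := 1) ?_ ?_
    · exact (by fun_prop : Continuous fun p : ℝ × ℝ =>
        Complex.exp (-(x * p.1 + p.2 * (p.1 - t₀) : ℝ) * Complex.I)).aestronglyMeasurable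
    · exact Eventually.of_forall fun p => by
        have := norm_expI 1 (x * p.1 + p.2 * (p.1 - t₀))
        rw [Complex.ofReal_one, one_mul] at this
        exact this.le
  have := integral_integral_swap hi
  calc _ = ∫ t : ℝ, ∫ u in Ioi (0:ℝ), f t * Complex.exp ((-ε : ℝ) * u) * Complex.exp (-(x * t + u * (t - t₀) : ℝ) * Complex.I) := by
        congr 1; ext t
        have h := integral_exp_mul_complex_Ioi (a := -(ε + (t - t₀) * Complex.I)) (by simpa using hε) 0
        have h' : (1:ℂ) / (ε + (t - t₀) * Complex.I) =
          ∫ u in Ioi (0:ℝ), Complex.exp (-(ε + (t - t₀) * Complex.I) * u) := by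
          rw [h, Complex.ofReal_zero, mul_zero, Complex.exp_zero, neg_div_neg_eq]
        rw [div_eq_mul_one_div, h', ← integral_const_mul]
        congr 1; ext u
        rw [mul_assoc, mul_assoc, ← Complex.exp_add, ← Complex.exp_add]
        congr 2; push_cast; ring
    _ = _ := by
        rw [this]
        congr 1; ext u
        unfold FTx
        rw [← integral_const_mul, ← integral_const_mul]
        congr 1; ext t
        rw [mul_assoc, mul_left_comm (Complex.exp (u * t₀ * Complex.I)), mul_left_comm _ (f t), ← Complex.exp_add, ← Complex.exp_add, ← Complex.exp_add]
        congr 2; push_cast; ring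

lemma half_line_limit (F : ℝ → ℂ) (hF : Integrable F) (t₀ x : ℝ) :
    Tendsto (fun ε : ℝ => ∫ u in Ioi (0:ℝ), Complex.exp (-(ε * u)) * (Complex.exp (u * t₀ * Complex.I) * F (x + u)))
      (𝓝[>] 0) (𝓝 (∫ u in Ioi (0:ℝ), Complex.exp (u * t₀ * Complex.I) * F (x + u))) := by
  have hF' : Integrable fun u => F (x + u) := hF.comp_add_left x
  have h1 : ∀ u : ℝ, ‖Complex.exp (u * t₀ * Complex.I)‖ = 1 := fun u => by
    have := Complex.norm_exp_ofReal_mul_I (u * t₀); push_cast at this; exact this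
  refine tendsto_integral_filter_of_dominated_convergence (fun u => ‖F (x + u)‖) ?_ ?_ hF'.norm.integrableOn ?_
  · refine Eventually.of_forall fun ε => ?_
    refine AEStronglyMeasurable.mul (by fun_prop) (AEStronglyMeasurable.mul (by fun_prop) hF'.1.restrict)
  · filter_upwards [self_mem_nhdsWithin] with ε hε
    filter_upwards [ae_restrict_mem measurableSet_Ioi] with u hu
    rw [norm_mul, norm_mul, h1, one_mul]
    refine mul_le_of_le_one_left (norm_nonneg _) ?_
    rw [Complex.norm_exp]
    have : 0 < ε * u := mul_pos hε hu
    simpa using this.le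
  · refine Eventually.of_forall fun u => ?_
    have : Continuous fun ε : ℝ => Complex.exp (-(ε * u)) * (Complex.exp (u * t₀ * Complex.I) * F (x + u)) := by fun_prop
    have := this.tendsto 0
    simp only [Complex.ofReal_zero, zero_mul, neg_zero, Complex.exp_zero, one_mul] at this
    exact this.mono_left nhdsWithin_le_nhds

lemma Ioi_shift (f : ℝ → ℂ) (x : ℝ) : ∫ u in Ioi (0:ℝ), f (x + u) = ∫ v in Ioi x, f v := by
  rw [← integral_indicator measurableSet_Ioi, ← integral_indicator measurableSet_Ioi,
    ← integral_add_left_eq_self (indicator (Ioi x) f) x]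
  congr 1; ext u
  simp [indicator]

lemma half_line_decay (F : ℝ → ℂ) (hF : Integrable F) (t₀ : ℝ)
    (h0 : ∫ v : ℝ, Complex.exp (v * t₀ * Complex.I) * F v = 0) :
    Tendsto (fun x : ℝ => ∫ u in Ioi (0:ℝ), Complex.exp (u * t₀ * Complex.I) * F (x + u))
      (cocompact ℝ) (𝓝 0) := by
  have h1 : ∀ u : ℝ, ‖Complex.exp (u * t₀ * Complex.I)‖ = 1 := fun u => by
    have := Complex.norm_exp_ofReal_mul_I (u * t₀); push_cast at this; exact this
  have hi : Integrable fun v : ℝ => Complex.exp (v * t₀ * Complex.I) * F v :=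
    hF.bdd_mul (c := 1) (by fun_prop) (Eventually.of_forall fun u => (h1 u).le)
  have key : ∀ x : ℝ, ‖∫ u in Ioi (0:ℝ), Complex.exp (u * t₀ * Complex.I) * F (x + u)‖ =
      ‖∫ v in Ioi x, Complex.exp (v * t₀ * Complex.I) * F v‖ := by
    intro x
    have := Ioi_shift (fun v : ℝ => Complex.exp (v * t₀ * Complex.I) * F v) x
    rw [← this, ← one_mul ‖∫ u in Ioi (0:ℝ), Complex.exp (u * t₀ * Complex.I) * F (x + u)‖, ← h1 x, ← norm_mul, ← integral_const_mul]
    congr 2; ext u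
    rw [← mul_assoc, ← Complex.exp_add]
    congr 2; push_cast; ring
  rw [tendsto_zero_iff_norm_tendsto_zero]
  simp only [key]
  rw [← tendsto_zero_iff_norm_tendsto_zero, cocompact_eq_atBot_atTop, tendsto_sup]
  constructor
  · have := (aecover_Ioi (μ := volume) (tendsto_id (α := ℝ) (x := atBot))).integral_tendsto_of_countably_generated hi
    rw [h0] at this
    exact this
  · have := (aecover_Iic (μ := volume) (tendsto_id (α := ℝ) (x := atTop))).integral_tendsto_of_countably_generated hi
    rw [h0] at this
    have h2 := this.neg
    rw [neg_zero] at h2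
    refine h2.congr fun x => ?_
    have := intervalIntegral.integral_Iic_add_Ioi (b := x) hi.integrableOn hi.integrableOn
    rw [h0] at this
    exact neg_eq_of_add_eq_zero_right this

noncomputable def Gext (G : ℂ → ℂ) (Gb : ℝ → ℂ) (s : ℂ) : ℂ := if 1 < s.re then G s else Gb s.im

lemma Gext_cont (G : ℂ → ℂ) (hG : DifferentiableOn ℂ G {s : ℂ | 1 < s.re}) (Gb : ℝ → ℂ)
    (K : Set ℝ) (hb : ContinuousOn Gb K)
    (hu : TendstoUniformlyOn (fun σ : ℝ => fun t : ℝ => G (σ + t * Complex.I)) Gb (𝓝[>] 1) K) :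
    ContinuousOn (Gext G Gb) (Ici 1 ×ℂ K) := by
  have ho : IsOpen {s : ℂ | 1 < s.re} := isOpen_lt continuous_const Complex.continuous_re
  intro s hs
  rw [Complex.mem_reProdIm] at hs
  obtain ⟨hs1, hs2⟩ := hs
  rcases eq_or_lt_of_le (show (1:ℝ) ≤ s.re from hs1) with h | h
  · rw [Metric.continuousWithinAt_iff]
    intro κ hκ
    rw [Metric.tendstoUniformlyOn_iff] at hu
    have h1 := hu (κ/2) (half_pos hκ)
    rw [eventually_nhdsWithin_iff, Metric.eventually_nhds_iff] at h1
    obtain ⟨d1, hd1, h1⟩ := h1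
    obtain ⟨d2, hd2, h2⟩ := Metric.continuousWithinAt_iff.1 (hb s.im hs2) (κ/2) (half_pos hκ)
    refine ⟨min d1 d2, lt_min hd1 hd2, fun {z} hz hd => ?_⟩
    rw [Complex.mem_reProdIm] at hz
    have hre : dist z.re 1 < d1 := by
      rw [h, Real.dist_eq, ← Complex.sub_re]
      exact (Complex.abs_re_le_norm _).trans_lt (by rw [← dist_eq_norm]; exact hd.trans_le (min_le_left _ _))
    have him : dist z.im s.im < d2 := by
      rw [Real.dist_eq, ← Complex.sub_im]
      exact (Complex.abs_im_le_norm _).trans_lt (by rw [← dist_eq_norm]; exact hd.trans_le (min_le_right _ _))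
    have e2 := h2 hz.2 him
    have es : Gext G Gb s = Gb s.im := by simp [Gext, ← h]
    rw [es]
    by_cases hz1 : 1 < z.re
    · have e1 := h1 hre hz1 z.im hz.2
      rw [Complex.re_add_im] at e1
      have ez : Gext G Gb z = G z := by simp [Gext, hz1]
      rw [ez]
      rw [dist_comm] at e1
      linarith [dist_triangle (G z) (Gb z.im) (Gb s.im)]
    · have ez : Gext G Gb z = Gb z.im := by simp [Gext, hz1]
      rw [ez]; linarith
  · have : ContinuousAt G s := (hG.differentiableAt (ho.mem_nhds h)).continuousAt
    refine (this.congr ?_).continuousWithinAt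
    filter_upwards [ho.mem_nhds h] with z hz
    change 1 < z.re at hz
    simp [Gext, hz]

lemma unif_shift (H : ℂ → ℂ) (K : Set ℝ) (hK : IsCompact K) (hc : ContinuousOn H (Ici 1 ×ℂ K))
    (κ : ℝ) (hκ : 0 < κ) :
    ∀ᶠ ε : ℝ in 𝓝[>] 0, ∀ s : ℂ, s ∈ Icc (1:ℝ) 2 ×ℂ K → ‖H (s + ε) - H s‖ ≤ κ := by
  have hcomp : IsCompact (Icc (1:ℝ) 3 ×ℂ K) := isCompact_Icc.reProdIm hK
  have huc := hcomp.uniformContinuousOn_of_continuous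
    (hc.mono (fun s hs => ⟨hs.1.1, hs.2⟩))
  obtain ⟨d, hd, h⟩ := Metric.uniformContinuousOn_iff.1 huc κ hκ
  filter_upwards [Ioo_mem_nhdsGT (show (0:ℝ) < min d 1 by positivity)] with ε hε s hs
  rw [Complex.mem_reProdIm] at hs
  have h1 : ε < d := hε.2.trans_le (min_le_left _ _)
  have h2 : ε < 1 := hε.2.trans_le (min_le_right _ _)
  have h0 := hε.1
  rw [← dist_eq_norm]
  refine (h _ ?_ _ ?_ ?_).le
  · rw [Complex.mem_reProdIm]
    simp only [Complex.add_re, Complex.ofReal_re, Complex.add_im, Complex.ofReal_im, add_zero]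
    exact ⟨⟨by linarith [hs.1.1], by linarith [hs.1.2]⟩, hs.2⟩
  · rw [Complex.mem_reProdIm]
    exact ⟨⟨hs.1.1, by linarith [hs.1.2]⟩, hs.2⟩
  · simp [abs_of_pos h0, h1]

lemma rect_bound (E : ℂ → ℂ) (t₀ δ κ ε : ℝ) (hδ : 0 < δ) (hε : 0 < ε)
    (hc : ContinuousOn E (Icc (1:ℝ) 2 ×ℂ Icc (t₀ - δ) (t₀ + δ)))
    (hd : DifferentiableOn ℂ E {s : ℂ | 1 < s.re ∧ s.im ∈ Ioo (t₀ - δ) (t₀ + δ)})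
    (hb : ∀ s ∈ Icc (1:ℝ) 2 ×ℂ Icc (t₀ - δ) (t₀ + δ), ‖E s‖ ≤ κ) :
    ‖∫ t in (t₀ - δ)..(t₀ + δ), E (1 + t * Complex.I) / (ε + (t - t₀) * Complex.I)‖ ≤
      κ * (2 / δ + 2 * δ) := by
  have hκ : 0 ≤ κ := (norm_nonneg _).trans (hb (1 + t₀ * Complex.I) (by
    rw [Complex.mem_reProdIm]; simp [hδ.le]))
  set f : ℂ → ℂ := fun s => E s / (s - (1 - ε + t₀ * Complex.I)) with hf
  have hne : ∀ s : ℂ, 1 ≤ s.re → s - (1 - ε + t₀ * Complex.I) ≠ 0 := by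
    intro s hs h
    have := congrArg Complex.re h
    simp at this
    linarith
  have hfc : ContinuousOn f (Icc (1:ℝ) 2 ×ℂ Icc (t₀ - δ) (t₀ + δ)) :=
    hc.div (by fun_prop) (fun s hs => hne s hs.1.1)
  have hle : t₀ - δ ≤ t₀ + δ := by linarith
  have R := Complex.integral_boundary_rect_eq_zero_of_continuousOn_of_differentiableOn f
    (⟨1, t₀ - δ⟩ : ℂ) (⟨2, t₀ + δ⟩ : ℂ)
    (by simp only; rw [uIcc_of_le one_le_two, uIcc_of_le hle]; exact hfc)
    (by
      simp only; rw [min_eq_left one_le_two, max_eq_right one_le_two, min_eq_left hle, max_eq_right hle]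
      refine (hd.mono fun s hs => ⟨hs.1.1, hs.2⟩).div (by fun_prop) (fun s hs => hne s hs.1.1.le))
  simp only [smul_eq_mul] at R
  have hor : ∀ t : ℝ, |t - t₀| = δ → t ∈ Icc (t₀ - δ) (t₀ + δ) →
      ‖∫ x in (1:ℝ)..2, f (x + t * Complex.I)‖ ≤ κ / δ := by
    intro t ht ht'
    have := intervalIntegral.norm_integral_le_of_norm_le_const (a := 1) (b := 2) (C := κ / δ)
      (f := fun x : ℝ => f (x + t * Complex.I)) (fun x hx => by
        rw [uIoc_of_le one_le_two] at hx
        simp only [hf, norm_div]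
        gcongr
        · exact hb _ (by rw [Complex.mem_reProdIm]; simpa using ⟨⟨hx.1.le, hx.2⟩, by linarith [ht'.1], ht'.2⟩)
        · rw [← ht]
          refine le_trans (le_of_eq ?_) (Complex.abs_im_le_norm _)
          simp)
    norm_num at this
    exact this
  have ver : ‖∫ y in (t₀ - δ)..(t₀ + δ), f ((2:ℝ) + y * Complex.I)‖ ≤ κ * (2 * δ) := by
    have := intervalIntegral.norm_integral_le_of_norm_le_const (a := t₀ - δ) (b := t₀ + δ) (C := κ)
      (f := fun y : ℝ => f ((2:ℝ) + y * Complex.I)) (fun y hy => by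
        rw [uIoc_of_le hle] at hy
        simp only [hf, norm_div]
        refine div_le_of_le_mul₀ (norm_nonneg _) hκ ?_
        refine (hb _ ?_).trans (le_mul_of_one_le_right hκ ?_)
        · rw [Complex.mem_reProdIm]; simpa using ⟨by linarith [hy.1], hy.2⟩
        · refine le_trans ?_ (Complex.re_le_norm _)
          simp; linarith)
    rw [show |t₀ + δ - (t₀ - δ)| = 2 * δ by rw [abs_of_pos] <;> linarith] at this
    exact this
  have e : ∫ t in (t₀ - δ)..(t₀ + δ), E (1 + t * Complex.I) / (ε + (t - t₀) * Complex.I) =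
      ∫ y in (t₀ - δ)..(t₀ + δ), f ((1:ℝ) + y * Complex.I) := by
    congr 1; ext y
    simp only [hf, Complex.ofReal_one]
    congr 1; ring
  rw [e]
  have hn : ‖∫ y in (t₀ - δ)..(t₀ + δ), f ((1:ℝ) + y * Complex.I)‖ =
      ‖Complex.I * ∫ y in (t₀ - δ)..(t₀ + δ), f ((1:ℝ) + y * Complex.I)‖ := by simp
  rw [hn, ← sub_eq_zero.1 R]
  have b1 := hor (t₀ - δ) (by simp [abs_of_pos hδ]) ⟨le_rfl, hle⟩
  have b2 := hor (t₀ + δ) (by simp [abs_of_pos hδ]) ⟨hle, le_rfl⟩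
  refine (norm_add_le _ _).trans ?_
  rw [norm_mul, Complex.norm_I, one_mul]
  have := norm_sub_le (∫ x in (1:ℝ)..2, f (x + (t₀ - δ : ℝ) * Complex.I)) (∫ x in (1:ℝ)..2, f (x + (t₀ + δ : ℝ) * Complex.I))
  have e3 : κ * (2 / δ + 2 * δ) = κ / δ + κ / δ + κ * (2 * δ) := by ring
  linarith

/-- Key comparison: the shift by `ε` does not matter. -/
lemma shift_limit (H : ℂ → ℂ) (t₀ δ : ℝ) (hδ : 0 < δ) (K : Set ℝ) (hK : IsCompact K)
    (hI : Icc (t₀ - δ) (t₀ + δ) ⊆ K) (hc : ContinuousOn H (Ici 1 ×ℂ K))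
    (hd : DifferentiableOn ℂ H {s : ℂ | 1 < s.re})
    (ψ : ℝ → ℂ) (hψ : ContDiff ℝ (⊤ : ℕ∞) ψ) (hψc : HasCompactSupport ψ) (hψK : tsupport ψ ⊆ K) :
    Tendsto (fun ε : ℝ => ∫ t : ℝ, (H (1 + t * Complex.I + ε) - H (1 + t * Complex.I)) * ψ t /
      (ε + (t - t₀) * Complex.I)) (𝓝[>] 0) (𝓝 0) := by
  obtain ⟨L, hL⟩ := hψ.lipschitzWith_of_hasCompactSupport hψc (by simp)
  obtain ⟨M, hM⟩ := hψc.exists_bound_of_continuous hψ.continuous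
  have hM0 : 0 ≤ M := (norm_nonneg _).trans (hM 0)
  set I := Icc (t₀ - δ) (t₀ + δ) with hIdef
  set B : ℝ := L + M / δ with hB
  set V : ℝ := volume.real K with hV
  have hV0 : 0 ≤ V := measureReal_nonneg
  have hB0 : 0 ≤ B := by positivity
  set Ct : ℝ := B * V + M * (2 / δ + 2 * δ) with hCt
  have hC0 : 0 ≤ Ct := by positivity
  have hle : t₀ - δ ≤ t₀ + δ := by linarith
  rw [Metric.tendsto_nhds]
  intro η hη
  have hκ : 0 < η / (Ct + 1) := by positivity
  filter_upwards [unif_shift H K hK hc _ hκ, self_mem_nhdsWithin] with ε hE hε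
  set κ := η / (Ct + 1) with hκdef
  simp only [mem_Ioi] at hε
  set E : ℂ → ℂ := fun s => H (s + ε) - H s with hEdef
  have hEc : ContinuousOn E (Icc (1:ℝ) 2 ×ℂ K) := by
    refine ContinuousOn.sub ?_ (hc.mono fun s hs => ⟨hs.1.1, hs.2⟩)
    refine hc.comp (by fun_prop) fun s hs => ?_
    rw [Complex.mem_reProdIm] at *
    simp only [Complex.add_re, Complex.ofReal_re, Complex.add_im, Complex.ofReal_im, add_zero]
    exact ⟨by have := hs.1.1; simp only [mem_Ici]; linarith, hs.2⟩
  have hEd : DifferentiableOn ℂ E {s : ℂ | 1 < s.re} := by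
    refine DifferentiableOn.sub ?_ hd
    refine hd.comp (by fun_prop) fun s hs => ?_
    change 1 < s.re at hs
    change 1 < (s + ε).re
    rw [Complex.add_re, Complex.ofReal_re]
    linarith
  have hmem : ∀ t ∈ K, (1 + t * Complex.I : ℂ) ∈ Icc (1:ℝ) 2 ×ℂ K := fun t ht => by
    rw [Complex.mem_reProdIm]; simpa using ht
  have hne : ∀ t : ℝ, (ε + (t - t₀) * Complex.I : ℂ) ≠ 0 := fun t h => by
    have := congrArg Complex.re h
    simp at this
    linarith
  have hRb := rect_bound E t₀ δ κ ε hδ hε (hEc.mono fun s hs => ⟨hs.1, hI hs.2⟩)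
    (hEd.mono fun s hs => hs.1) (fun s hs => hE s ⟨hs.1, hI hs.2⟩)
  have hE1 : ContinuousOn (fun t : ℝ => E (1 + t * Complex.I)) K :=
    hEc.comp (by fun_prop) hmem
  -- the two pieces
  set P : ℝ → ℂ := fun t => E (1 + t * Complex.I) / (ε + (t - t₀) * Complex.I) with hP
  have hPc : ContinuousOn P K := hE1.div (by fun_prop) fun t _ => hne t
  have hPi : IntegrableOn P K := hPc.integrableOn_compact hK
  have e1 : ∫ t : ℝ, E (1 + t * Complex.I) * ψ t / (ε + (t - t₀) * Complex.I) = ∫ t in K, P t * ψ t := by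
    rw [setIntegral_eq_integral_of_forall_compl_eq_zero]
    · congr 1; ext t; simp only [hP]; ring
    · intro t ht
      rw [image_eq_zero_of_notMem_tsupport (fun h => ht (hψK h)), mul_zero]
  have hPψ : IntegrableOn (fun t => P t * ψ t) K :=
    (hPc.mul hψ.continuous.continuousOn).integrableOn_compact hK
  have hPI : IntegrableOn (fun t => I.indicator (fun t => P t * ψ t₀) t) K :=
    (hPi.mul_const _).indicator measurableSet_Icc
  have e2 : ∫ t in K, I.indicator (fun t => P t * ψ t₀) t =
      (∫ t in (t₀ - δ)..(t₀ + δ), P t) * ψ t₀ := by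
    rw [setIntegral_indicator measurableSet_Icc, inter_eq_right.2 hI, integral_mul_const,
      intervalIntegral.integral_of_le hle, integral_Icc_eq_integral_Ioc]
  have e3 : ∫ t in K, P t * ψ t = (∫ t in K, (P t * ψ t - I.indicator (fun t => P t * ψ t₀) t)) +
      (∫ t in (t₀ - δ)..(t₀ + δ), P t) * ψ t₀ := by
    rw [integral_sub hPψ hPI, e2]; ring
  have hden : ∀ t : ℝ, |t - t₀| ≤ ‖(ε + (t - t₀) * Complex.I : ℂ)‖ := fun t => by
    refine le_trans (le_of_eq ?_) (Complex.abs_im_le_norm _)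
    simp
  have hpt : ∀ t ∈ K, ‖P t * ψ t - I.indicator (fun t => P t * ψ t₀) t‖ ≤ κ * B := by
    intro t ht
    have hEt : ‖E (1 + t * Complex.I)‖ ≤ κ := hE _ (hmem t ht)
    have hpos : 0 < ‖(ε + (t - t₀) * Complex.I : ℂ)‖ := norm_pos_iff.2 (hne t)
    have hMd : 0 ≤ M / δ := by positivity
    by_cases htI : t ∈ I
    · rw [indicator_of_mem htI, ← mul_sub, norm_mul, hP]
      simp only [norm_div]
      rw [div_mul_eq_mul_div, div_le_iff₀ hpos, mul_assoc]
      refine mul_le_mul hEt ?_ (norm_nonneg _) hκ.le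
      have := hL.dist_le_mul t t₀
      rw [dist_eq_norm, Real.dist_eq] at this
      refine this.trans (mul_le_mul ?_ (hden t) (abs_nonneg _) hB0)
      linarith
    · rw [indicator_of_notMem htI, sub_zero, norm_mul, hP]
      simp only [norm_div]
      rw [div_mul_eq_mul_div, div_le_iff₀ hpos, mul_assoc]
      refine mul_le_mul hEt ?_ (norm_nonneg _) hκ.le
      have hfar : δ ≤ |t - t₀| := by
        by_contra hcon
        push Not at hcon
        rw [abs_lt] at hcon
        exact htI ⟨by linarith [hcon.1], by linarith [hcon.2]⟩
      calc ‖ψ t‖ ≤ M := hM t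
        _ = M / δ * δ := by field_simp
        _ ≤ B * _ := by
          refine mul_le_mul ?_ (hfar.trans (hden t)) hδ.le hB0
          have : (0:ℝ) ≤ L := L.2
          linarith
  have hb1 : ‖∫ t in K, (P t * ψ t - I.indicator (fun t => P t * ψ t₀) t)‖ ≤ κ * B * V :=
    norm_setIntegral_le_of_norm_le_const hK.measure_lt_top hpt
  have hb2 : ‖(∫ t in (t₀ - δ)..(t₀ + δ), P t) * ψ t₀‖ ≤ κ * (2 / δ + 2 * δ) * M := by
    rw [norm_mul]
    exact mul_le_mul hRb (hM _) (norm_nonneg _) (by positivity)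
  rw [dist_zero_right]
  change ‖∫ t : ℝ, E (1 + t * Complex.I) * ψ t / (ε + (t - t₀) * Complex.I)‖ < η
  rw [e1, e3]
  calc _ ≤ κ * B * V + κ * (2 / δ + 2 * δ) * M := (norm_add_le _ _).trans (add_le_add hb1 hb2)
    _ = κ * Ct := by rw [hCt]; ring
    _ < κ * (Ct + 1) := by nlinarith
    _ = η := by rw [hκdef]; field_simp

theorem stmt_9 (G : ℂ → ℂ) (hG : DifferentiableOn ℂ G {s : ℂ | 1 < s.re})
    (U : Set ℝ) (hU : IsOpen U) (Gb : ℝ → ℂ)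
    (hGA : ∀ K : Set ℝ, K ⊆ U → IsCompact K → ∃ g : ℝ → ℂ, Integrable g ∧
      (∀ t ∈ K, Gb t = ∫ x : ℝ, g x * Complex.exp (-(t * x) * Complex.I)) ∧
      TendstoUniformlyOn (fun σ : ℝ => fun t : ℝ => G (σ + t * Complex.I)) Gb (𝓝[>] 1) K)
    (t₀ : ℝ) (ht₀ : t₀ ∈ U) :
    LocalPseudofunctionBoundary
      (fun s => (G s - Gb t₀) / (s - (1 + t₀ * Complex.I))) U := by
  intro φ h1 h2 hφU
  obtain ⟨d, hd, hdU⟩ := Metric.isOpen_iff.1 hU t₀ ht₀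
  obtain ⟨δ, hδ, hδd⟩ : ∃ δ : ℝ, 0 < δ ∧ δ < d := ⟨d / 2, by positivity, by linarith⟩
  have hIU : Icc (t₀ - δ) (t₀ + δ) ⊆ U := fun t ht => hdU (by
    rw [Metric.mem_ball, Real.dist_eq, abs_lt]
    exact ⟨by linarith [ht.1], by linarith [ht.2]⟩)
  set K : Set ℝ := tsupport φ ∪ Icc (t₀ - δ) (t₀ + δ) with hKdef
  have hK : IsCompact K := h2.isCompact.union isCompact_Icc
  have hI : Icc (t₀ - δ) (t₀ + δ) ⊆ K := subset_union_right
  have hφK : tsupport φ ⊆ K := subset_union_left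
  obtain ⟨g, hg, hgb, hu⟩ := hGA K (union_subset hφU hIU) hK
  set gh : ℝ → ℂ := fun t => ∫ y : ℝ, g y * Complex.exp (-(t * y) * Complex.I) with hgh
  have hghc : Continuous gh := cont_ghat g hg
  have hbc : ContinuousOn Gb K := hghc.continuousOn.congr hgb
  have ht₀K : t₀ ∈ K := hI ⟨by linarith, by linarith⟩
  set c := Gb t₀ with hc
  set f : ℝ → ℂ := fun t => (gh t - c) * φ t with hf
  have hfc : Continuous f := (hghc.sub continuous_const).mul h1.continuous
  have hfs : HasCompactSupport f := h2.mul_left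
  have hfi : Integrable f := hfc.integrable_of_hasCompactSupport hfs
  have hF : Integrable (FTx f) := FTx_f_integrable φ g c h1 h2 hg
  have hf0 : f t₀ = 0 := by
    have : gh t₀ = c := (hgb t₀ ht₀K).symm
    simp [hf, this]
  have hHc := Gext_cont G hG Gb K hbc hu
  have hHd : DifferentiableOn ℂ (Gext G Gb) {s : ℂ | 1 < s.re} := hG.congr fun s hs => by
    change 1 < s.re at hs
    simp [Gext, hs]
  refine ⟨fun x => ∫ u in Ioi (0:ℝ), Complex.exp (u * t₀ * Complex.I) * FTx f (x + u), ?_,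
    half_line_decay _ hF t₀ (FTx_total f hfi hfc hF t₀ hf0)⟩
  intro x
  set ψ : ℝ → ℂ := fun t => φ t * Complex.exp (-(x * t) * Complex.I) with hψ
  have hexp : ContDiff ℝ (⊤ : ℕ∞) (fun t : ℝ => Complex.exp (-(x * t) * Complex.I)) := by
    have : ContDiff ℝ (⊤ : ℕ∞) (fun t : ℝ => (t : ℂ)) := Complex.ofRealCLM.contDiff
    fun_prop
  have hψ1 : ContDiff ℝ (⊤ : ℕ∞) ψ := h1.mul hexp
  have hψ2 : HasCompactSupport ψ := h2.mul_right
  have hψK : tsupport ψ ⊆ K := (tsupport_mul_subset_left).trans hφK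
  have hD := shift_limit (Gext G Gb) t₀ δ hδ K hK hI hHc hHd ψ hψ1 hψ2 hψK
  have hB := half_line_limit (FTx f) hF t₀ x
  have hT := hD.add hB
  rw [zero_add] at hT
  have hsub : Tendsto (fun σ : ℝ => σ - 1) (𝓝[>] 1) (𝓝[>] 0) := by
    refine tendsto_nhdsWithin_iff.2 ⟨?_, ?_⟩
    · have : Continuous fun σ : ℝ => σ - 1 := by fun_prop
      have := this.tendsto 1
      rw [sub_self] at this
      exact this.mono_left nhdsWithin_le_nhds
    · filter_upwards [self_mem_nhdsWithin] with σ hσ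
      simpa using hσ
  refine (hT.comp hsub).congr' ?_
  filter_upwards [self_mem_nhdsWithin] with σ hσ
  simp only [mem_Ioi] at hσ
  have hε : 0 < σ - 1 := by linarith
  simp only [Function.comp]
  rw [← half_line f hfi t₀ x (σ - 1) hε]
  have hne : ∀ t : ℝ, (((σ - 1 : ℝ) : ℂ) + (t - t₀) * Complex.I : ℂ) ≠ 0 := fun t h => by
    have := congrArg Complex.re h
    simp at this
    linarith
  have hout : ∀ t, t ∉ K → φ t = 0 := fun t ht =>
    image_eq_zero_of_notMem_tsupport (fun h => ht (hφK h))
  have eD : (fun t : ℝ => (Gext G Gb (1 + t * Complex.I + (σ - 1 : ℝ)) - Gext G Gb (1 + t * Complex.I)) * ψ t /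
      ((σ - 1 : ℝ) + (t - t₀) * Complex.I)) =
      fun t : ℝ => (G (σ + t * Complex.I) - gh t) * ψ t / ((σ - 1 : ℝ) + (t - t₀) * Complex.I) := by
    ext t
    by_cases ht : t ∈ K
    · have ea : Gext G Gb (1 + t * Complex.I + (σ - 1 : ℝ)) = G (σ + t * Complex.I) := by
        rw [show (1 + t * Complex.I + (σ - 1 : ℝ) : ℂ) = σ + t * Complex.I by push_cast; ring]
        simp [Gext, hσ]
      have eb : Gext G Gb (1 + t * Complex.I) = gh t := by
        have : gh t = Gb t := (hgb t ht).symm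
        simp [Gext, this]
      rw [ea, eb]
    · simp [hψ, hout t ht]
  rw [eD]
  have hGc : Continuous fun t : ℝ => G (σ + t * Complex.I) :=
    hG.continuousOn.comp_continuous (by fun_prop) (fun t => by
      change 1 < (σ + t * Complex.I : ℂ).re
      simpa using hσ)
  have hden : Continuous fun t : ℝ => (((σ - 1 : ℝ) : ℂ) + (t - t₀) * Complex.I : ℂ) := by fun_prop
  rw [← integral_add]
  · congr 1; ext t
    rw [← add_div]
    rw [show (σ + t * Complex.I - (1 + t₀ * Complex.I) : ℂ) = ((σ - 1 : ℝ) : ℂ) + (t - t₀) * Complex.I by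
      push_cast; ring]
    simp only [hψ, hf]
    ring
  · refine Continuous.integrable_of_hasCompactSupport
      (((hGc.sub hghc).mul hψ1.continuous).div hden hne) ?_
    simp only [div_eq_mul_inv]
    exact (hψ2.mul_left (f := fun t : ℝ => G (σ + t * Complex.I) - gh t)).mul_right
  · refine Continuous.integrable_of_hasCompactSupport
      ((hfc.mul hexp.continuous).div hden hne) ?_
    simp only [div_eq_mul_inv]
    exact hfs.mul_right.mul_right
end
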